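/- Let J ≥ 1 and let q₁, …, q_J be distinct primes with q_i ≡ −1 (mod 3) for all i; let t_i ∈ {1, 2} for all i, let s ∈ {0, 1, 2}, and set m = 3^s · ∏_{i=1}^J q_i^{t_i}. Let K = ℚ(ζ₃, m^{1/3}). Then dim_{𝔽₃} Cl(K)[3] = 2r, where r = J if every q_i ≡ −1 (mod 9) and m ≢ ±1 (mod 9); r = J − 1 if either every q_i ≡ −1 (mod 9) and m ≡ ±1 (mod 9), or some q_i ≡ 2 or 5 (mod 9) and m ≢ ±1 (mod 9); and r = J − 2 if some q_i ≡ 2 or 5 (mod 9) and m ≡ ±1 (mod 9). -/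

import Mathlib

open NumberField

section
open IsDedekindDomain

section places
variable {R : Type*} [CommRing R] [IsDedekindDomain R] {K : Type*} [Field K]
  [Algebra R K] [IsFractionRing R K] (v : HeightOneSpectrum R)

/-- additive valuation -/
noncomputable def ordZ (x : Kˣ) : ℤ := - Multiplicative.toAdd (v.valuationOfNeZero x)

theorem ordZ_mul (x y : Kˣ) : ordZ v (x * y) = ordZ v x + ordZ v y := by
  simp [ordZ]; ring

theorem ordZ_one : ordZ v (1 : Kˣ) = 0 := by simp [ordZ]

theorem ordZ_inv (x : Kˣ) : ordZ v x⁻¹ = - ordZ v x := by simp [ordZ]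

theorem ordZ_div (x y : Kˣ) : ordZ v (x / y) = ordZ v x - ordZ v y := by
  rw [div_eq_mul_inv, ordZ_mul, ordZ_inv]; ring

theorem ordZ_pow (x : Kˣ) (n : ℕ) : ordZ v (x ^ n) = n * ordZ v x := by
  simp [ordZ]

theorem ordZ_zpow (x : Kˣ) (n : ℤ) : ordZ v (x ^ n) = n * ordZ v x := by
  simp [ordZ]

theorem valuation_eq_ordZ (x : Kˣ) : v.valuation K (x : K) = WithZero.exp (- ordZ v x) := by
  rw [← HeightOneSpectrum.valuationOfNeZero_eq]
  simp [ordZ, WithZero.exp]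

theorem ordZ_eq_zero_iff (x : Kˣ) : ordZ v x = 0 ↔ v.valuation K (x : K) = 1 := by
  rw [valuation_eq_ordZ, ← WithZero.exp_zero, WithZero.exp_inj]; simp

theorem ordZ_neg (x : Kˣ) : ordZ v (-x) = ordZ v x := by
  have h := valuation_eq_ordZ v (-x)
  rw [Units.val_neg, Valuation.map_neg, valuation_eq_ordZ, WithZero.exp_inj] at h
  omega

theorem ordZ_alg_nonneg (x : Kˣ) (r : R) (h : (x : K) = algebraMap R K r) : 0 ≤ ordZ v x := by
  have h1 : v.valuation K (algebraMap R K r) ≤ 1 := v.valuation_le_one r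
  rw [← h, valuation_eq_ordZ, ← WithZero.exp_zero, WithZero.exp_le_exp] at h1
  omega

theorem ordZ_alg_eq_zero (x : Kˣ) (r : R) (h : (x : K) = algebraMap R K r) :
    ordZ v x = 0 ↔ r ∉ v.asIdeal := by
  rw [ordZ_eq_zero_iff, h, HeightOneSpectrum.valuation_eq_one_iff_notMem]

theorem ordZ_alg_pos (x : Kˣ) (r : R) (h : (x : K) = algebraMap R K r) :
    0 < ordZ v x ↔ r ∈ v.asIdeal := by
  have h1 := ordZ_alg_nonneg v x r h
  have h2 := ordZ_alg_eq_zero v x r h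
  by_cases h3 : r ∈ v.asIdeal
  · have : ordZ v x ≠ 0 := fun h => h2.1 h h3
    simp only [h3, iff_true]; omega
  · have := h2.2 h3
    simp [h3, this]

theorem ordZ_add (x y z : Kˣ) (h : (z : K) = x + y) : min (ordZ v x) (ordZ v y) ≤ ordZ v z := by
  have := (v.valuation K).map_add (x : K) y
  rw [← h, valuation_eq_ordZ, valuation_eq_ordZ, valuation_eq_ordZ] at this
  rcases le_max_iff.1 this with h | h <;> rw [WithZero.exp_le_exp] at h
  · exact (min_le_left _ _).trans (by omega)
  · exact (min_le_right _ _).trans (by omega)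

theorem exists_frac_ordZ (x : Kˣ) (h : ordZ v x = 0) :
    ∃ a b : R, a ∉ v.asIdeal ∧ b ∉ v.asIdeal ∧ (x : K) * algebraMap R K b = algebraMap R K a := by
  obtain ⟨n, d, hd⟩ := v.exists_primeCompl_mul_eq_of_integer (x : K)
    (by rw [(ordZ_eq_zero_iff v x).1 h])
  refine ⟨n, d, ?_, d.2, hd⟩
  have h1 : v.valuation K (algebraMap R K n) = 1 := by
    rw [← hd, map_mul, (ordZ_eq_zero_iff v x).1 h, one_mul,
      HeightOneSpectrum.valuation_eq_one_iff_notMem]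
    exact d.2
  rwa [HeightOneSpectrum.valuation_eq_one_iff_notMem] at h1

theorem exists_unif : ∃ π : Kˣ, ordZ v π = 1 := by
  obtain ⟨p, hp⟩ := v.valuation_exists_uniformizer K
  have h0 : p ≠ 0 := by rintro rfl; rw [map_zero] at hp; exact WithZero.exp_ne_zero hp.symm
  refine ⟨Units.mk0 p h0, ?_⟩
  have := valuation_eq_ordZ v (Units.mk0 p h0)
  rw [Units.val_mk0, hp, WithZero.exp_inj] at this
  omega

theorem exists_residue (π : Kˣ) (hπ : ordZ v π = 1) :
    ∃ θ : Kˣ →* (R ⧸ v.asIdeal)ˣ, ∀ (x : Kˣ) (a b : R), b ∉ v.asIdeal → a ∉ v.asIdeal →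
      (x : K) * algebraMap R K b = algebraMap R K a * ((π ^ ordZ v x : Kˣ) : K) →
      (θ x : R ⧸ v.asIdeal) * Ideal.Quotient.mk _ b = Ideal.Quotient.mk _ a := by
  classical
  have := v.isMaximal
  have hex : ∀ x : Kˣ, ∃ ab : R × R, ab.1 ∉ v.asIdeal ∧ ab.2 ∉ v.asIdeal ∧
      (x : K) * algebraMap R K ab.2 = algebraMap R K ab.1 * ((π ^ ordZ v x : Kˣ) : K) := by
    intro x
    obtain ⟨a, b, ha, hb, hab⟩ := exists_frac_ordZ v (x / π ^ ordZ v x)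
      (by rw [ordZ_div, ordZ_zpow, hπ]; ring)
    refine ⟨(a, b), ha, hb, ?_⟩
    rw [Units.val_div_eq_div_val] at hab
    rw [← hab]
    have := (π ^ ordZ v x : Kˣ).ne_zero
    field_simp
  choose f hf using hex
  have hu : ∀ a : R, a ∉ v.asIdeal → IsUnit (Ideal.Quotient.mk v.asIdeal a) := by
    intro a ha
    let := Ideal.Quotient.field v.asIdeal
    exact IsUnit.mk0 _ (by rwa [Ne, Ideal.Quotient.eq_zero_iff_mem])
  let g : Kˣ → (R ⧸ v.asIdeal)ˣ := fun x => (hu _ (hf x).1).unit / (hu _ (hf x).2.1).unit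
  have hg : ∀ (x : Kˣ) (a b : R), b ∉ v.asIdeal → a ∉ v.asIdeal →
      (x : K) * algebraMap R K b = algebraMap R K a * ((π ^ ordZ v x : Kˣ) : K) →
      (g x : R ⧸ v.asIdeal) * Ideal.Quotient.mk _ b = Ideal.Quotient.mk _ a := by
    intro x a b hb ha hab
    have h1 : (f x).1 * b = a * (f x).2 := by
      apply IsFractionRing.injective R K
      have h2 := (hf x).2.2
      have h0 := x.ne_zero
      have h3 := (π ^ ordZ v x : Kˣ).ne_zero
      rw [map_mul, map_mul]
      apply mul_left_cancel₀ (mul_ne_zero h0 h3)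
      linear_combination (x : K) * algebraMap R K (f x).2 * hab
        - (x : K) * algebraMap R K b * h2
    have h2 : (g x) * (hu b hb).unit = (hu a ha).unit := by
      rw [div_mul_eq_mul_div, div_eq_iff_eq_mul]
      apply Units.ext
      simp only [Units.val_mul, IsUnit.unit_spec, ← map_mul]
      rw [h1]
    simpa using congrArg Units.val h2
  refine ⟨⟨⟨g, ?_⟩, ?_⟩, hg⟩
  · have := hg 1 1 1 (fun h => v.isPrime.ne_top ((Ideal.eq_top_iff_one _).2 h))
      (fun h => v.isPrime.ne_top ((Ideal.eq_top_iff_one _).2 h)) (by simp [ordZ_one])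
    apply Units.ext; simpa using this
  · intro x y
    have hx := hf x
    have hy := hf y
    have h1 := hg (x * y) ((f x).1 * (f y).1) ((f x).2 * (f y).2)
      (fun h => (v.isPrime.mem_or_mem h).elim hx.2.1 hy.2.1)
      (fun h => (v.isPrime.mem_or_mem h).elim hx.1 hy.1) (by
        rw [ordZ_mul, zpow_add, Units.val_mul, Units.val_mul, map_mul, map_mul]
        linear_combination (y : K) * algebraMap R K (f y).2 * hx.2.2 +
          algebraMap R K (f x).1 * ((π ^ ordZ v x : Kˣ) : K) * hy.2.2)
    have h2 : g (x * y) * ((hu _ hx.2.1).unit * (hu _ hy.2.1).unit) =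
        ((hu _ hx.1).unit * (hu _ hy.1).unit) := by
      apply Units.ext; simpa using h1
    change g (x * y) = g x * g y
    rw [← eq_mul_inv_iff_mul_eq] at h2
    rw [h2]; simp only [g]
    rw [div_mul_div_comm, div_eq_mul_inv]

end places
end

section
open IsDedekindDomain

section tate
variable {R : Type*} [CommRing R] [IsDedekindDomain R] {F : Type*} [Field F]
  [Algebra R F] [IsFractionRing R F]

noncomputable def unif (F : Type*) [Field F] [Algebra R F] [IsFractionRing R F]
    (v : HeightOneSpectrum R) : Fˣ := (exists_unif v).choose

theorem ordZ_unif (v : HeightOneSpectrum R) : ordZ v (unif F v) = 1 := (exists_unif v).choose_spec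

noncomputable def resid (F : Type*) [Field F] [Algebra R F] [IsFractionRing R F]
    (v : HeightOneSpectrum R) : Fˣ →* (R ⧸ v.asIdeal)ˣ :=
  (exists_residue v (unif F v) (ordZ_unif v)).choose

theorem resid_spec (v : HeightOneSpectrum R) (x : Fˣ) (a b : R) (hb : b ∉ v.asIdeal)
    (ha : a ∉ v.asIdeal)
    (h : (x : F) * algebraMap R F b = algebraMap R F a * (((unif F v) ^ ordZ v x : Fˣ) : F)) :
    (resid F v x : R ⧸ v.asIdeal) * Ideal.Quotient.mk _ b = Ideal.Quotient.mk _ a :=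
  (exists_residue v (unif F v) (ordZ_unif v)).choose_spec x a b hb ha h

theorem resid_alg (v : HeightOneSpectrum R) (x : Fˣ) (a : R) (ha : a ∉ v.asIdeal)
    (h : (x : F) = algebraMap R F a) :
    (resid F v x : R ⧸ v.asIdeal) = Ideal.Quotient.mk _ a := by
  have h0 := (ordZ_alg_eq_zero v x a h).2 ha
  have := resid_spec v x a 1 (fun h => v.isPrime.ne_top ((Ideal.eq_top_iff_one _).2 h)) ha
    (by rw [h0, h]; simp)
  simpa using this

theorem resid_frac (v : HeightOneSpectrum R) (x : Fˣ) (a b : R) (hb : b ∉ v.asIdeal)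
    (ha : a ∉ v.asIdeal)
    (h : (x : F) * algebraMap R F b = algebraMap R F a) (h0 : ordZ v x = 0) :
    (resid F v x : R ⧸ v.asIdeal) * Ideal.Quotient.mk _ b = Ideal.Quotient.mk _ a :=
  resid_spec v x a b hb ha (by rw [h0, h]; simp)

theorem resid_neg_one (v : HeightOneSpectrum R) : resid F v (-1) = -1 := by
  have := resid_alg (F := F) v (-1) (-1)
    (fun h => v.isPrime.ne_top ((Ideal.eq_top_iff_one _).2 (by simpa using v.asIdeal.neg_mem h)))
    (by simp)
  apply Units.ext
  simpa using this

/-- if `ord a > 0` and `a + b = 1` then `b ≡ 1`. -/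
theorem resid_one_sub (v : HeightOneSpectrum R) (a b : Fˣ) (hab : (a : F) + b = 1)
    (ha : 0 < ordZ v a) : ordZ v b = 0 ∧ resid F v b = 1 := by
  have hb : ordZ v b = 0 := by
    by_contra hne
    have h1 := ordZ_add v a b 1 (by simpa using hab.symm)
    have h2 := ordZ_add v 1 (-a) b (by rw [Units.val_neg, Units.val_one, ← hab]; ring)
    rw [ordZ_one] at h1
    rw [ordZ_one, ordZ_neg] at h2
    rw [min_eq_left ha.le] at h2
    rcases min_le_iff.1 h1 with h | h <;> omega
  refine ⟨hb, ?_⟩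
  obtain ⟨n, d, hn, hd, h⟩ := exists_frac_ordZ v b hb
  have h1 := resid_frac v b n d hd hn h hb
  have h2 : Ideal.Quotient.mk v.asIdeal n = Ideal.Quotient.mk v.asIdeal d := by
    rw [eq_comm, Ideal.Quotient.eq]
    have hd0 : algebraMap R F d ≠ 0 := by
      rw [Ne, FaithfulSMul.algebraMap_eq_zero_iff]
      rintro rfl; exact hd (zero_mem _)
    have h3 : (a : F) * algebraMap R F d = algebraMap R F (d - n) := by
      rw [map_sub, ← h]; linear_combination (algebraMap R F d) * hab
    have h4 : 0 < ordZ v (a * Units.mk0 _ hd0) := by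
      rw [ordZ_mul, (ordZ_alg_eq_zero v (Units.mk0 _ hd0) d rfl).2 hd]; omega
    exact (ordZ_alg_pos v _ (d - n) (by simpa using h3)).1 h4
  have h3 : IsUnit (Ideal.Quotient.mk v.asIdeal d) := by
    have := v.isMaximal
    let := Ideal.Quotient.field v.asIdeal
    exact IsUnit.mk0 _ (by rwa [Ne, Ideal.Quotient.eq_zero_iff_mem])
  apply Units.ext
  rw [h2] at h1
  simpa using h3.mul_right_cancel (h1.trans (one_mul _).symm)

def TameTriv (v : HeightOneSpectrum R) (a b : Fˣ) : Prop :=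
  ∃ c, (resid F v a) ^ (ordZ v b) / (resid F v b) ^ (ordZ v a) = c ^ 3

/-- Steinberg symbol -/
def IsSym {F H : Type*} [Field F] [CommGroup H] (s : Fˣ →* Fˣ →* H) : Prop :=
  ∀ a b : Fˣ, (a : F) + b = 1 → s a b = 1

variable {H : Type*} [CommGroup H]

theorem sym_neg_one (h3 : ∀ h : H, h ^ 3 = 1) (s : Fˣ →* Fˣ →* H) (a : Fˣ) : s a (-1) = 1 ∧ s (-1) a = 1 := by
  constructor
  · have h1 : s a (-1) ^ 2 = 1 := by rw [← map_pow]; simp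
    have h2 := h3 (s a (-1))
    rw [pow_succ, h1, one_mul] at h2; exact h2
  · have h1 : s (-1) a ^ 2 = 1 := by rw [← MonoidHom.pow_apply, ← map_pow]; simp
    have h2 := h3 (s (-1) a)
    rw [pow_succ, h1, one_mul] at h2; exact h2

theorem sym_self (h3 : ∀ h : H, h ^ 3 = 1) (s : Fˣ →* Fˣ →* H) (hs : IsSym s) (a : Fˣ) : s a a = 1 := by
  by_cases h1 : (a : F) = 1
  · have : a = 1 := Units.ext h1
    subst this; simp
  have hne : (1 - a : F) ≠ 0 := fun h => h1 (sub_eq_zero.1 h).symm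
  have h2 := hs a (Units.mk0 _ hne) (by simp)
  have hne' : (1 - ((a⁻¹ : Fˣ) : F)) ≠ 0 := by
    intro h
    have : (a⁻¹ : Fˣ) = 1 := Units.ext (by simpa using (sub_eq_zero.1 h).symm)
    apply h1; rw [inv_eq_one.1 this]; simp
  have h4 := hs a⁻¹ (Units.mk0 _ hne') (by simp)
  have h5 : (Units.mk0 _ hne) = (-1) * a * Units.mk0 _ hne' := by
    apply Units.ext
    simp
    have := a.ne_zero
    field_simp
    ring
  rw [map_inv, MonoidHom.inv_apply, inv_eq_one] at h4
  rw [h5, map_mul, map_mul, h4, (sym_neg_one h3 s a).1] at h2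
  simpa using h2

theorem sym_anti (h3 : ∀ h : H, h ^ 3 = 1) (s : Fˣ →* Fˣ →* H) (hs : IsSym s) (a b : Fˣ) : s a b * s b a = 1 := by
  have h := sym_self h3 s hs (a * b)
  rw [map_mul (s (a * b)), map_mul s, MonoidHom.mul_apply, MonoidHom.mul_apply,
    sym_self h3 s hs a, sym_self h3 s hs b] at h
  simpa [mul_comm] using h

/-- the tame symbol composed with a character -/
theorem exists_tameSym (h3 : ∀ h : H, h ^ 3 = 1) (v : HeightOneSpectrum R) (χ : (R ⧸ v.asIdeal)ˣ →* H) :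
    ∃ s : Fˣ →* Fˣ →* H, IsSym s ∧
      ∀ a b, s a b = χ ((resid F v a) ^ (ordZ v b) / (resid F v b) ^ (ordZ v a)) := by
  refine ⟨MonoidHom.mk' (fun a => MonoidHom.mk' (fun b =>
    χ ((resid F v a) ^ (ordZ v b) / (resid F v b) ^ (ordZ v a))) ?_) ?_, ?_, fun a b => rfl⟩
  · intro b c
    rw [← map_mul, map_mul (resid F v), ordZ_mul, zpow_add, mul_zpow, mul_div_mul_comm]
  · intro a b
    ext c
    simp only [MonoidHom.mk'_apply, MonoidHom.mul_apply]
    rw [← map_mul, map_mul (resid F v), ordZ_mul, zpow_add, mul_zpow, mul_div_mul_comm]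
  · intro a b hab
    simp only [MonoidHom.mk'_apply]
    rcases lt_trichotomy (ordZ v a) 0 with h | h | h
    · -- negative
      have h1 : ((a⁻¹ : Fˣ) : F) + ((-(b * a⁻¹) : Fˣ) : F) = 1 := by
        have := a.ne_zero
        simp
        field_simp
        linear_combination -hab
      obtain ⟨h4, h5⟩ := resid_one_sub v _ _ h1 (by rw [ordZ_inv]; omega)
      rw [ordZ_neg, ordZ_mul, ordZ_inv] at h4
      have h6 : ordZ v b = ordZ v a := by omega
      have h7 : resid F v b = -1 * resid F v a := by
        rw [show (-(b * a⁻¹)) = (-1) * b * a⁻¹ by simp, map_mul, map_mul, resid_neg_one,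
          map_inv, mul_inv_eq_one] at h5
        rw [← h5]; simp
      rw [h6, h7, mul_zpow, div_mul_eq_div_div_swap, div_self', one_div, map_inv, map_zpow]
      have : χ (-1) = 1 := by
        have h1 : χ (-1) ^ 2 = 1 := by rw [← map_pow]; simp
        have h2 := h3 (χ (-1))
        rw [pow_succ, h1, one_mul] at h2; exact h2
      simp [this]
    · rcases lt_trichotomy (ordZ v b) 0 with h' | h' | h'
      · have h1 := ordZ_add v 1 (-a) b (by rw [Units.val_neg, Units.val_one, ← hab]; ring)
        rw [ordZ_one, ordZ_neg, h] at h1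
        simp at h1; omega
      · rw [h, h']; simp
      · rw [h, (resid_one_sub v b a (by rw [add_comm]; exact hab) h').2]; simp
    · obtain ⟨h4, h5⟩ := resid_one_sub v a b hab h
      rw [h4, h5]; simp

end tate
end

section
set_option linter.unusedSectionVars false
open IsDedekindDomain

section ordlemmas
variable {R : Type*} [CommRing R] [IsDedekindDomain R] {F : Type*} [Field F]
  [Algebra R F] [IsFractionRing R F]

theorem ordZ_ge_zero_iff (v : HeightOneSpectrum R) (x : Fˣ) :
    0 ≤ ordZ v x ↔ v.valuation F (x : F) ≤ 1 := by
  rw [valuation_eq_ordZ, ← WithZero.exp_zero, WithZero.exp_le_exp]; omega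

theorem finite_ordZ (x : Fˣ) : {v : HeightOneSpectrum R | ordZ v x ≠ 0}.Finite := by
  refine ((HeightOneSpectrum.Support.finite R (x : F)).union
    (HeightOneSpectrum.Support.finite R ((x⁻¹ : Fˣ) : F))).subset ?_
  intro v hv
  have h : ordZ v x ≠ 0 := hv
  rcases lt_or_gt_of_ne h with h | h
  · left
    change 1 < v.valuation F _
    rw [← not_le, ← ordZ_ge_zero_iff]; omega
  · right
    change 1 < v.valuation F _
    rw [← not_le, ← ordZ_ge_zero_iff, ordZ_inv]; omega

theorem exists_int_of_ordZ (x : Fˣ) (h : ∀ v : HeightOneSpectrum R, 0 ≤ ordZ v x) :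
    ∃ r : R, algebraMap R F r = x :=
  HeightOneSpectrum.mem_integers_of_valuation_le_one F (x : F)
    (fun v => (ordZ_ge_zero_iff v x).1 (h v))

theorem exists_unit_of_ordZ (x : Fˣ) (h : ∀ v : HeightOneSpectrum R, ordZ v x = 0) :
    ∃ r : Rˣ, algebraMap R F r = x := by
  obtain ⟨r, hr⟩ := exists_int_of_ordZ x (fun v => (h v).ge)
  obtain ⟨r', hr'⟩ := exists_int_of_ordZ (R := R) (x⁻¹) (fun v => by rw [ordZ_inv, h v]; simp)
  have : r * r' = 1 := by
    apply FaithfulSMul.algebraMap_injective R F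
    rw [map_mul, hr, hr']; simp
  exact ⟨Units.mkOfMulEqOne r r' this, hr⟩

theorem ordZ_unit (x : Fˣ) (r : R) (hr : IsUnit r) (h : (x : F) = algebraMap R F r)
    (v : HeightOneSpectrum R) : ordZ v x = 0 := by
  rw [ordZ_alg_eq_zero v x r h]
  exact fun h => v.isPrime.ne_top (Ideal.eq_top_of_isUnit_mem _ h hr)

variable [IsPrincipalIdealRing R]

noncomputable def gen (v : HeightOneSpectrum R) : R := Submodule.IsPrincipal.generator v.asIdeal

theorem gen_dvd (v : HeightOneSpectrum R) (x : R) : gen v ∣ x ↔ x ∈ v.asIdeal := by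
  rw [gen, Submodule.IsPrincipal.mem_iff_generator_dvd]

theorem gen_ne (v : HeightOneSpectrum R) : gen v ≠ 0 := by
  intro h
  exact v.ne_bot ((Submodule.IsPrincipal.eq_bot_iff_generator_eq_zero _).2 h)

theorem algmap_ne {x : R} (h : x ≠ 0) : algebraMap R F x ≠ 0 := by
  rwa [Ne, FaithfulSMul.algebraMap_eq_zero_iff]

noncomputable def genF (F : Type*) [Field F] [Algebra R F] [IsFractionRing R F]
    (v : HeightOneSpectrum R) : Fˣ := Units.mk0 (algebraMap R F (gen v)) (algmap_ne (gen_ne v))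

theorem ordZ_genF_ne (v w : HeightOneSpectrum R) (h : w ≠ v) : ordZ w (genF F v) = 0 := by
  rw [ordZ_alg_eq_zero w _ (gen v) rfl]
  intro hm
  apply h
  have : v.asIdeal ≤ w.asIdeal := fun x hx => by
    obtain ⟨c, rfl⟩ := (gen_dvd v x).2 hx
    exact Ideal.mul_mem_right _ _ hm
  exact HeightOneSpectrum.ext (v.isMaximal.eq_of_le w.isPrime.ne_top this).symm

theorem ordZ_genF (v : HeightOneSpectrum R) : ordZ v (genF F v) = 1 := by
  have h1 : 0 < ordZ v (genF F v) :=
    (ordZ_alg_pos v _ (gen v) rfl).2 ((gen_dvd v _).1 dvd_rfl)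
  obtain ⟨p, hp⟩ := v.intValuation_exists_uniformizer
  have hp0 : p ≠ 0 := by rintro rfl; rw [map_zero] at hp; exact WithZero.exp_ne_zero hp.symm
  have h2 : ordZ v (Units.mk0 (algebraMap R F p) (algmap_ne hp0)) = 1 := by
    have h := valuation_eq_ordZ v (Units.mk0 (algebraMap R F p) (algmap_ne hp0))
    rw [Units.val_mk0, HeightOneSpectrum.valuation_of_algebraMap, hp, WithZero.exp_inj] at h
    omega
  obtain ⟨c, hc⟩ := (gen_dvd v p).2 ((ordZ_alg_pos v _ p rfl).1 (by rw [h2]; simp))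
  have hc0 : c ≠ 0 := by rintro rfl; simp at hc; exact hp0 hc
  have h3 : Units.mk0 (algebraMap R F p) (algmap_ne hp0) =
      genF F v * Units.mk0 (algebraMap R F c) (algmap_ne hc0) := by
    apply Units.ext; simp [genF, hc]
  rw [h3, ordZ_mul] at h2
  have := ordZ_alg_nonneg v (Units.mk0 (algebraMap R F c) (algmap_ne hc0)) c rfl
  omega

end ordlemmas
end

section
set_option linter.unusedSectionVars false
open IsDedekindDomain

structure EuclidData (R : Type*) [CommRing R] where
  φ : R →+* ℂ
  nm : R → ℕ
  hnm : ∀ x, ‖φ x‖ ^ 2 = (nm x : ℝ)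
  h0 : ∀ x, nm x = 0 → x = 0
  h1 : ∀ x, nm x = 1 → IsUnit x
  h2 : ∀ x, nm x ≠ 2
  hdiv : ∀ a b : R, b ≠ 0 → ∃ r, b ∣ a - r ∧ 3 * nm r ≤ nm b
  hfin : ∀ n, {v : HeightOneSpectrum R | ∃ x ∈ v.asIdeal, x ≠ 0 ∧ nm x ≤ n}.Finite
  hunit : ∃ z : R, IsUnit z ∧ ∀ u, IsUnit u → ∃ j : ℕ, u = z ^ j ∨ u = - z ^ j

namespace EuclidData
variable {R : Type*} [CommRing R] [IsDedekindDomain R] {F : Type*} [Field F]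
  [Algebra R F] [IsFractionRing R F] [IsPrincipalIdealRing R] (E : EuclidData R)
  {H : Type*} [CommGroup H]

theorem nm_mul (x y : R) : E.nm (x * y) = E.nm x * E.nm y := by
  have := E.hnm (x * y)
  rw [map_mul, norm_mul, mul_pow, E.hnm, E.hnm] at this
  exact_mod_cast this.symm

theorem nm_pos {x : R} (h : x ≠ 0) : 0 < E.nm x :=
  Nat.pos_of_ne_zero (fun h' => h (E.h0 x h'))

theorem nm_le_of_dvd {x y : R} (h : x ∣ y) (hy : y ≠ 0) : E.nm x ≤ E.nm y := by
  obtain ⟨c, rfl⟩ := h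
  rw [E.nm_mul]
  exact Nat.le_mul_of_pos_right _ (E.nm_pos (right_ne_zero_of_mul hy))

theorem nm_unit {x : R} (h : IsUnit x) : E.nm x = 1 := by
  obtain ⟨y, hy⟩ := h.exists_right_inv
  have h2 : E.nm 1 = 1 := by
    have := E.hnm 1
    simp at this
    exact_mod_cast this.symm
  have := E.nm_mul x y
  rw [hy, h2] at this
  exact Nat.eq_one_of_mul_eq_one_right this.symm

theorem nm_gen (v : HeightOneSpectrum R) : 3 ≤ E.nm (gen v) := by
  have a := E.nm_pos (gen_ne v)
  have b := E.h2 (gen v)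
  have c : E.nm (gen v) ≠ 1 := fun h =>
    v.isPrime.ne_top (Ideal.eq_top_of_isUnit_mem _ ((gen_dvd v _).1 dvd_rfl) (E.h1 _ h))
  omega

/-- the P-units -/
def InU (P : Finset (HeightOneSpectrum R)) (x : Fˣ) : Prop := ∀ v ∉ P, ordZ v x = 0

theorem InU.mul {P : Finset (HeightOneSpectrum R)} {x y : Fˣ} (hx : InU P x) (hy : InU P y) :
    InU P (x * y) := fun v hv => by rw [ordZ_mul, hx v hv, hy v hv]; rfl
theorem InU.div {P : Finset (HeightOneSpectrum R)} {x y : Fˣ} (hx : InU P x) (hy : InU P y) :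
    InU P (x / y) := fun v hv => by rw [ordZ_div, hx v hv, hy v hv]; rfl

theorem InU.neg {P : Finset (HeightOneSpectrum R)} {x : Fˣ} (hx : InU P x)  :
    InU P (-x) := fun v hv => by rw [ordZ_neg, hx v hv]

/-- small elements are P-units -/
theorem small_inU (P : Finset (HeightOneSpectrum R)) (π : HeightOneSpectrum R)
    (hP : ∀ w, E.nm (gen w) < E.nm (gen π) → w ∈ P) (k : R) (x : Fˣ) (hx : (x : F) = algebraMap R F k)
    (hk : E.nm k < E.nm (gen π)) : InU P x := by
  intro v hv
  by_contra hne
  have h1 := ordZ_alg_nonneg v x k hx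
  have h2 := (ordZ_alg_pos v x k hx).1 (by omega)
  have hk0 : k ≠ 0 := by rintro rfl; simp at hx
  exact hv (hP v (lt_of_le_of_lt (E.nm_le_of_dvd ((gen_dvd v k).2 h2) hk0) hk))

/-- Lemma L -/
theorem lemL (s : Fˣ →* Fˣ →* H) (hs : IsSym s) (P : Finset (HeightOneSpectrum R))
    (π : HeightOneSpectrum R) (ht : ∀ a b : Fˣ, InU P a → InU P b → s a b = 1)
    (hP : ∀ w, E.nm (gen w) < E.nm (gen π) → w ∈ P) (x y k : R) (X Y : Fˣ)
    (hX : (X : F) = algebraMap R F x) (hY : (Y : F) = algebraMap R F y)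
    (hXU : InU P X) (hYU : InU P Y) (hk : x - y = gen π * k) (hlt : E.nm k < E.nm (gen π)) :
    s X (genF F π) = s Y (genF F π) := by
  by_cases hk0 : k = 0
  · subst hk0
    rw [mul_zero, sub_eq_zero] at hk
    have : X = Y := Units.ext (by rw [hX, hY, hk])
    rw [this]
  have h1 := hs (X / Y) (-(genF F π * Units.mk0 _ (algmap_ne (F := F) hk0) / Y)) (by
    have := Y.ne_zero
    simp only [Units.val_div_eq_div_val, Units.val_neg, Units.val_mul, Units.val_mk0, genF]
    field_simp
    rw [hX, hY, ← map_mul, ← hk, map_sub]; ring)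
  have hkU : InU P (Units.mk0 _ (algmap_ne (F := F) hk0)) := E.small_inU P π hP k _ rfl hlt
  rw [show (-(genF F π * Units.mk0 _ (algmap_ne (F := F) hk0) / Y)) =
    genF F π * (-(Units.mk0 _ (algmap_ne (F := F) hk0) / Y)) by
      rw [mul_div_assoc, mul_neg], map_mul, ht (X / Y) _ (hXU.div hYU) (hkU.div hYU).neg, mul_one,
      map_div, MonoidHom.div_apply, div_eq_one] at h1
  exact h1

theorem nm_lt_of_norm (x y : R) (h : ‖E.φ x‖ < ‖E.φ y‖) : E.nm x < E.nm y := by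
  have : (E.nm x : ℝ) < E.nm y := by
    rw [← E.hnm, ← E.hnm]
    exact pow_lt_pow_left₀ h (norm_nonneg _) (by norm_num)
  exact_mod_cast this

theorem exists_char (s : Fˣ →* Fˣ →* H) (hs : IsSym s) (P : Finset (HeightOneSpectrum R))
    (π : HeightOneSpectrum R) (hπ : π ∉ P) (ht : ∀ a b : Fˣ, InU P a → InU P b → s a b = 1)
    (hP : ∀ w, E.nm (gen w) < E.nm (gen π) → w ∈ P)
    (hP' : ∀ w ∈ P, E.nm (gen w) ≤ E.nm (gen π)) :
    ∃ χ : (R ⧸ π.asIdeal)ˣ →* H, ∀ u : Fˣ, InU P u → s u (genF F π) = χ (resid F π u) := by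
  have hp3 := E.nm_gen π
  set p := gen π with hp
  have hw : ∀ c : (R ⧸ π.asIdeal)ˣ, ∃ r : R, Ideal.Quotient.mk _ r = (c : R ⧸ π.asIdeal) ∧
      3 * E.nm r ≤ E.nm p := by
    intro c
    obtain ⟨a, ha⟩ := Ideal.Quotient.mk_surjective (c : R ⧸ π.asIdeal)
    obtain ⟨r, hr, h⟩ := E.hdiv a p (gen_ne π)
    refine ⟨r, ?_, h⟩
    rw [← ha, eq_comm, Ideal.Quotient.eq]
    exact (gen_dvd π _).1 hr
  choose w hw1 hw2 using hw
  have hwn : ∀ c, w c ∉ π.asIdeal := by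
    intro c h
    have : Nontrivial (R ⧸ π.asIdeal) := Ideal.Quotient.nontrivial_iff.2 π.isPrime.ne_top
    apply c.ne_zero
    rw [← hw1, Ideal.Quotient.eq_zero_iff_mem]; exact h
  have hw0 : ∀ c, w c ≠ 0 := fun c h => hwn c (h ▸ zero_mem _)
  let W : (R ⧸ π.asIdeal)ˣ → Fˣ := fun c => Units.mk0 _ (algmap_ne (F := F) (hw0 c))
  have hWU : ∀ c, InU P (W c) := fun c => E.small_inU P π hP (w c) _ rfl (by
    have := hw2 c
    have := E.nm_pos (hw0 c)
    rw [← hp]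
    omega)
  have hsp : E.φ p ≠ 0 ∧ (3:ℝ) ≤ ‖E.φ p‖ ^ 2 := by
    constructor
    · intro h
      have := E.hnm p
      rw [h] at this
      simp at this
      have : E.nm p = 0 := by exact_mod_cast this.symm
      omega
    · rw [E.hnm]; exact_mod_cast hp3
  have hpp : 0 < ‖E.φ p‖ := norm_pos_iff.2 hsp.1
  have hp1 : (1.7:ℝ) < ‖E.φ p‖ := by nlinarith [hsp.2]
  have hwn2 : ∀ c, ‖E.φ (w c)‖ ≤ 0.58 * ‖E.φ p‖ := by
    intro c
    have h : 3 * ‖E.φ (w c)‖ ^ 2 ≤ ‖E.φ p‖ ^ 2 := by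
      rw [E.hnm, E.hnm]; exact_mod_cast hw2 c
    have := norm_nonneg (E.φ (w c))
    nlinarith
  have key : ∀ (x : R) (X : Fˣ) (c : (R ⧸ π.asIdeal)ˣ), (X : F) = algebraMap R F x → InU P X →
      Ideal.Quotient.mk _ x = (c : R ⧸ π.asIdeal) →
      (∀ k, x - w c = p * k → E.nm k < E.nm p) → s X (genF F π) = s (W c) (genF F π) := by
    intro x X c hX hXU hc hk
    have : p ∣ x - w c := by
      rw [hp, gen_dvd, ← Ideal.Quotient.eq, hc, hw1]
    obtain ⟨k, hk'⟩ := this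
    exact E.lemL s hs P π ht hP x (w c) k X (W c) hX rfl hXU (hWU c) hk' (hk k hk')
  have key2 : ∀ (x : R) (X : Fˣ), (X : F) = algebraMap R F x → InU P X →
      E.nm x ≤ E.nm p → s X (genF F π) = s (W (resid F π X)) (genF F π) := by
    intro x X hX hXU hxp
    have hxn := (ordZ_alg_eq_zero π X x hX).1 (hXU π hπ)
    refine key x X _ hX hXU (resid_alg π X x hxn hX).symm ?_
    intro k hk
    have h1 : ‖E.φ x‖ ≤ ‖E.φ p‖ := by
      have : ‖E.φ x‖ ^ 2 ≤ ‖E.φ p‖ ^ 2 := by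
        rw [E.hnm, E.hnm]; exact_mod_cast hxp
      exact le_of_sq_le_sq this hpp.le
    have h2 := hwn2 (resid F π X)
    have h3 : ‖E.φ p‖ * ‖E.φ k‖ ≤ ‖E.φ x‖ + ‖E.φ (w (resid F π X))‖ := by
      rw [← norm_mul, ← map_mul, ← hk, map_sub]
      exact norm_sub_le _ _
    have h4 : ‖E.φ k‖ ≤ 1.58 := by
      by_contra hlt
      push Not at hlt
      nlinarith
    have h5 : (E.nm k : ℝ) < 3 := by
      rw [← E.hnm]; nlinarith [norm_nonneg (E.φ k)]
    have h6 : E.nm k < 3 := by exact_mod_cast h5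
    have := E.h2 k
    omega
  let χ : (R ⧸ π.asIdeal)ˣ →* H := MonoidHom.mk' (fun c => s (W c) (genF F π)) (by
    intro c d
    rw [← MonoidHom.mul_apply, ← map_mul]
    symm
    apply key (w c * w d) _ _ (by simp [W]) ((hWU c).mul (hWU d)) (by simp [hw1])
    intro k hk
    apply E.nm_lt_of_norm
    have h3 : ‖E.φ p‖ * ‖E.φ k‖ ≤ ‖E.φ (w c)‖ * ‖E.φ (w d)‖ + ‖E.φ (w (c * d))‖ := by
      rw [← norm_mul, ← map_mul, ← hk, map_sub, ← norm_mul, ← map_mul]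
      exact norm_sub_le _ _
    have h4 := mul_le_mul (hwn2 c) (hwn2 d) (norm_nonneg _) (by positivity)
    have h5 := hwn2 (c * d)
    by_contra hlt
    push Not at hlt
    nlinarith)
  refine ⟨χ, ?_⟩
  intro u hu
  change _ = s (W (resid F π u)) (genF F π)
  change _ = χ (resid F π u)
  -- decompose
  set g : Fˣ := ∏ v ∈ P, genF F v ^ ordZ v u with hg
  have hog : ∀ w : HeightOneSpectrum R, ordZ w g = ordZ w u := by
    intro w
    classical
    have h1 : ∀ S : Finset (HeightOneSpectrum R), ordZ w (∏ v ∈ S, genF F v ^ ordZ v u) =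
        if w ∈ S then ordZ w u else 0 := by
      intro S
      induction S using Finset.induction_on with
      | empty => simp [ordZ_one]
      | insert a S ha ih =>
        rw [Finset.prod_insert ha, ordZ_mul, ih, ordZ_zpow]
        by_cases hwa : w = a
        · subst hwa
          simp [ha, ordZ_genF]
        · simp [hwa, ordZ_genF_ne a w hwa]
    rw [hg, h1]
    split_ifs with h
    · rfl
    · exact (hu w h).symm
  obtain ⟨r, hr⟩ := exists_unit_of_ordZ (R := R) (u / g) (fun v => by rw [ordZ_div, hog]; simp)
  have hug : u = (u / g) * g := by simp
  have c1 : s (u / g) (genF F π) = χ (resid F π (u / g)) :=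
    key2 r _ hr.symm (fun v _ => by rw [ordZ_div, hog]; simp) (by rw [E.nm_unit r.isUnit]; omega)
  have c2 : ∀ v ∈ P, s (genF F v) (genF F π) = χ (resid F π (genF F v)) := by
    intro v hv
    refine key2 (gen v) _ rfl ?_ (hP' v hv)
    intro w hw
    apply ordZ_genF_ne
    rintro rfl; exact hw hv
  rw [hug, map_mul s, MonoidHom.mul_apply, map_mul (resid F π), map_mul χ, c1, hg]
  congr 1
  rw [map_prod, map_prod, map_prod, MonoidHom.finsetProd_apply]
  apply Finset.prod_congr rfl
  intro v hv
  rw [map_zpow, map_zpow, map_zpow, MonoidHom.zpow_apply, c2 v hv]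

end EuclidData
end

section
set_option linter.unusedSectionVars false
open IsDedekindDomain

namespace EuclidData
variable {R : Type*} [CommRing R] [IsDedekindDomain R] {F : Type*} [Field F]
  [Algebra R F] [IsFractionRing R F] [IsPrincipalIdealRing R] (E : EuclidData R)
  {H : Type*} [CommGroup H]

theorem tate_aux (h3 : ∀ h : H, h ^ 3 = 1) (s : Fˣ →* Fˣ →* H) (hs : IsSym s) (n : ℕ) :
    ∀ P : Finset (HeightOneSpectrum R), P.card = n →
    (∀ v ∈ P, ∀ w, E.nm (gen w) < E.nm (gen v) → w ∈ P) →
    ∃ s' : Fˣ →* Fˣ →* H, IsSym s' ∧ (∀ a b : Fˣ, InU P a → InU P b → s' a b = 1) ∧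
      ∀ a b : Fˣ, (∀ v : HeightOneSpectrum R, TameTriv v a b) → s' a b = s a b := by
  induction n with
  | zero =>
    intro P hP _
    rw [Finset.card_eq_zero] at hP
    subst hP
    refine ⟨s, hs, ?_, fun _ _ _ => rfl⟩
    obtain ⟨z, hz, hzu⟩ := E.hunit
    have hz0 : z ≠ 0 := hz.ne_zero
    have hc : ∀ a : Fˣ, InU (R := R) ∅ a → ∃ j : ℕ, a = (Units.mk0 _ (algmap_ne (F := F) hz0)) ^ j ∨
        a = (-1) * (Units.mk0 _ (algmap_ne (F := F) hz0)) ^ j := by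
      intro a ha
      obtain ⟨r, hr⟩ := exists_unit_of_ordZ (R := R) a (fun v => ha v (by simp))
      obtain ⟨j, hj⟩ := hzu r r.isUnit
      refine ⟨j, ?_⟩
      rcases hj with hj | hj
      · left; apply Units.ext; rw [← hr, hj]; simp
      · right; apply Units.ext; rw [← hr, hj]; simp
    intro a b ha hb
    obtain ⟨i, hi⟩ := hc a ha
    obtain ⟨j, hj⟩ := hc b hb
    have hzz := sym_self h3 s hs (Units.mk0 _ (algmap_ne (F := F) hz0))
    rcases hi with rfl | rfl <;> rcases hj with rfl | rfl <;>
      simp only [map_mul, MonoidHom.mul_apply, map_pow, MonoidHom.pow_apply, hzz, one_pow, mul_one,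
        (sym_neg_one h3 s _).1, (sym_neg_one h3 s _).2]
  | succ n ih =>
    intro P hPc hP
    have hne : P.Nonempty := by rw [← Finset.card_pos]; omega
    obtain ⟨π, hπ, hmax⟩ := Finset.exists_max_image P (fun v => E.nm (gen v)) hne
    classical
    obtain ⟨s1, hs1, ht, hagree⟩ := ih (P.erase π) (by rw [Finset.card_erase_of_mem hπ, hPc]; simp)
      (by
        intro v hv w hw
        rw [Finset.mem_erase] at hv ⊢
        refine ⟨?_, hP v hv.2 w hw⟩
        rintro rfl
        exact absurd (hmax v hv.2) (not_le.2 hw))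
    obtain ⟨χ, hχ⟩ := E.exists_char s1 hs1 (P.erase π) π (by simp) ht
      (by
        intro w hw
        rw [Finset.mem_erase]
        exact ⟨by rintro rfl; exact lt_irrefl _ hw, hP π hπ w hw⟩)
      (fun w hw => hmax w (Finset.mem_of_mem_erase hw))
    obtain ⟨T, hT, hTe⟩ := exists_tameSym (F := F) h3 π χ
    have hsym : IsSym (s1 / T) := by
      intro a b hab
      rw [MonoidHom.div_apply, MonoidHom.div_apply, hs1 a b hab, hT a b hab, div_one]
    refine ⟨s1 / T, hsym, ?_, ?_⟩
    · have hU : ∀ a b : Fˣ, InU (P.erase π) a → InU (P.erase π) b → (s1 / T) a b = 1 := by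
        intro a b ha hb
        rw [MonoidHom.div_apply, MonoidHom.div_apply, ht a b ha hb, hTe, ha π (by simp),
          hb π (by simp)]
        simp
      have hUp : ∀ a : Fˣ, InU (P.erase π) a → (s1 / T) a (genF F π) = 1 := by
        intro a ha
        rw [MonoidHom.div_apply, MonoidHom.div_apply, hχ a ha, hTe, ha π (by simp), ordZ_genF]
        simp
      have hpU : ∀ a : Fˣ, InU (P.erase π) a → (s1 / T) (genF F π) a = 1 := by
        intro a ha
        have := sym_anti h3 (s1 / T) hsym a (genF F π)
        rwa [hUp a ha, one_mul] at this
      have hd : ∀ a : Fˣ, InU P a → ∃ u, InU (P.erase π) u ∧ ∃ k : ℤ, a = u * genF F π ^ k := by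
        intro a ha
        refine ⟨a / genF F π ^ ordZ π a, ?_, ordZ π a, by simp⟩
        intro v hv
        rw [ordZ_div, ordZ_zpow]
        by_cases hvp : v = π
        · subst hvp; rw [ordZ_genF]; simp
        · rw [ordZ_genF_ne π v hvp, ha v (fun h => hv (Finset.mem_erase.2 ⟨hvp, h⟩))]; simp
      intro a b ha hb
      obtain ⟨u, hu, k, rfl⟩ := hd a ha
      obtain ⟨u', hu', k', rfl⟩ := hd b hb
      rw [map_mul (s1 / T), MonoidHom.mul_apply, map_mul, map_mul, map_zpow, map_zpow, map_zpow,
        MonoidHom.zpow_apply, MonoidHom.zpow_apply, hU u u' hu hu', hUp u hu, hpU u' hu',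
        sym_self h3 (s1 / T) hsym]
      simp
    · intro a b hab
      rw [MonoidHom.div_apply, MonoidHom.div_apply, hagree a b hab, hTe]
      obtain ⟨c, hc⟩ := hab π
      rw [hc, map_pow, h3, div_one]

/-- Tate's theorem on `K₂` of an imaginary quadratic Euclidean field, modulo 3 -/
theorem tate (E : EuclidData R) (h3 : ∀ h : H, h ^ 3 = 1) (s : Fˣ →* Fˣ →* H) (hs : IsSym s) (a b : Fˣ)
    (hab : ∀ v : HeightOneSpectrum R, TameTriv v a b) : s a b = 1 := by
  have hfin := (finite_ordZ (R := R) a).union (finite_ordZ (R := R) b)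
  obtain ⟨n, hn⟩ : ∃ n, ∀ v ∈ hfin.toFinset, E.nm (gen v) ≤ n :=
    ⟨hfin.toFinset.sup (fun v => E.nm (gen v)), fun v hv => Finset.le_sup (f := fun v => E.nm (gen v)) hv⟩
  have hm : ∀ v, v ∈ (E.hfin n).toFinset ↔ E.nm (gen v) ≤ n := by
    intro v
    rw [Set.Finite.mem_toFinset]
    constructor
    · rintro ⟨x, hx, hx0, h⟩
      exact (E.nm_le_of_dvd ((gen_dvd v x).2 hx) hx0).trans h
    · intro h
      exact ⟨gen v, (gen_dvd v _).1 dvd_rfl, gen_ne v, h⟩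
  obtain ⟨s', -, h1, h2⟩ := E.tate_aux h3 s hs _ (E.hfin n).toFinset rfl (by
    intro v hv w hw
    rw [hm] at hv ⊢; omega)
  rw [← h2 a b hab]
  apply h1
  · intro v hv
    by_contra hne
    exact hv ((hm v).2 (hn v (by rw [Set.Finite.mem_toFinset]; left; exact hne)))
  · intro v hv
    by_contra hne
    exact hv ((hm v).2 (hn v (by rw [Set.Finite.mem_toFinset]; right; exact hne)))

end EuclidData
end

section
set_option linter.unusedSectionVars false

section home
variable {F Ω : Type*} [Field F] [Field Ω] [Algebra F Ω] [IsAlgClosed Ω]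

/-- `ζ^k` -/
def zp (z : F) (k : ZMod 3) : F := z ^ k.val

theorem zp_add {z : F} (hz : IsPrimitiveRoot z 3) (k l : ZMod 3) :
    zp z (k + l) = zp z k * zp z l := by
  unfold zp
  rw [← pow_add, ZMod.val_add]
  conv_rhs => rw [← Nat.mod_add_div (k.val + l.val) 3, pow_add, pow_mul, hz.pow_eq_one, one_pow,
    mul_one]

theorem zp_nat {z : F} (hz : IsPrimitiveRoot z 3) (k : ℕ) : zp z (k : ZMod 3) = z ^ k := by
  unfold zp
  rw [ZMod.val_natCast]
  conv_rhs => rw [← Nat.mod_add_div k 3, pow_add, pow_mul, hz.pow_eq_one, one_pow, mul_one]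

theorem zp_mul {z : F} (hz : IsPrimitiveRoot z 3) (k l : ZMod 3) :
    zp z (k * l) = zp z k ^ l.val := by
  conv_lhs => rw [← ZMod.natCast_zmod_val k, ← ZMod.natCast_zmod_val l, ← Nat.cast_mul, zp_nat hz,
    pow_mul]
  rfl

theorem zp_inj {z : F} (hz : IsPrimitiveRoot z 3) {k l : ZMod 3} (h : zp z k = zp z l) : k = l := by
  have := hz.pow_inj (ZMod.val_lt k) (ZMod.val_lt l) h
  exact ZMod.val_injective 3 this

theorem zp_ne {z : F} (hz : IsPrimitiveRoot z 3) (k : ZMod 3) : zp z k ≠ 0 :=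
  pow_ne_zero _ (hz.ne_zero (by norm_num))

theorem exists_chi {z : F} (hz : IsPrimitiveRoot z 3) :
    ∃ f : Fˣ → (Ω ≃ₐ[F] Ω) → ZMod 3, ∀ (a : Fˣ) (g : Ω ≃ₐ[F] Ω) (ρ : Ω), ρ ^ 3 = algebraMap F Ω a →
      g ρ = algebraMap F Ω (zp z (f a g)) * ρ := by
  have hz' : IsPrimitiveRoot (algebraMap F Ω z) 3 := hz.map_of_injective (algebraMap F Ω).injective
  have h : ∀ (a : Fˣ) (g : Ω ≃ₐ[F] Ω), ∃ k : ZMod 3, ∀ ρ, ρ ^ 3 = algebraMap F Ω a →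
      g ρ = algebraMap F Ω (zp z k) * ρ := by
    intro a g
    obtain ⟨ρ, hρ⟩ := IsAlgClosed.exists_pow_nat_eq (algebraMap F Ω a) (n := 3) (by norm_num)
    have hρ0 : ρ ≠ 0 := by
      rintro rfl
      have := a.ne_zero
      simp at hρ
      exact this ((map_eq_zero _).1 hρ.symm)
    have hfrac : ∀ x y : Ω, y ≠ 0 → x ^ 3 = y ^ 3 → ∃ i < 3, x = algebraMap F Ω z ^ i * y := by
      intro x y hy hxy
      obtain ⟨i, hi, h⟩ := hz'.eq_pow_of_pow_eq_one (ξ := x / y)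
        (by rw [div_pow, hxy, div_self (pow_ne_zero _ hy)])
      exact ⟨i, hi, by rw [h]; field_simp⟩
    obtain ⟨i, hi, h⟩ := hfrac (g ρ) ρ hρ0 (by rw [← map_pow, hρ]; simp)
    refine ⟨i, fun ρ' hρ' => ?_⟩
    rw [zp_nat hz, map_pow]
    obtain ⟨j, hj, h'⟩ := hfrac ρ' ρ hρ0 (by rw [hρ, hρ'])
    rw [h', map_mul, map_pow, AlgEquiv.commutes, h]; ring
  choose f hf using h
  exact ⟨f, hf⟩

/-- characters attached to cube roots -/
noncomputable def chi (Ω : Type*) [Field Ω] [Algebra F Ω] [IsAlgClosed Ω] {z : F}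
    (hz : IsPrimitiveRoot z 3) :
    Fˣ → (Ω ≃ₐ[F] Ω) → ZMod 3 := (exists_chi hz).choose

variable {z : F} (hz : IsPrimitiveRoot z 3)

theorem chi_spec (a : Fˣ) (g : Ω ≃ₐ[F] Ω) (ρ : Ω) (h : ρ ^ 3 = algebraMap F Ω a) :
    g ρ = algebraMap F Ω (zp z (chi Ω hz a g)) * ρ := (exists_chi hz).choose_spec a g ρ h

theorem exists_rt (a : Fˣ) : ∃ ρ : Ω, ρ ^ 3 = algebraMap F Ω a ∧ ρ ≠ 0 := by
  obtain ⟨ρ, hρ⟩ := IsAlgClosed.exists_pow_nat_eq (algebraMap F Ω a) (n := 3) (by norm_num)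
  refine ⟨ρ, hρ, ?_⟩
  rintro rfl
  have := a.ne_zero
  simp at hρ
  exact this ((map_eq_zero _).1 hρ.symm)

theorem chi_eq (a : Fˣ) (g : Ω ≃ₐ[F] Ω) (ρ : Ω) (h : ρ ^ 3 = algebraMap F Ω a) (h0 : ρ ≠ 0)
    (k : ZMod 3) (hk : g ρ = algebraMap F Ω (zp z k) * ρ) : chi Ω hz a g = k := by
  rw [chi_spec hz a g ρ h] at hk
  exact zp_inj hz ((algebraMap F Ω).injective (mul_right_cancel₀ h0 hk))

theorem chi_mul (a b : Fˣ) (g : Ω ≃ₐ[F] Ω) : chi Ω hz (a * b) g = chi Ω hz a g + chi Ω hz b g := by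
  obtain ⟨ρ, h1, h2⟩ := exists_rt (Ω := Ω) a
  obtain ⟨ρ', h1', h2'⟩ := exists_rt (Ω := Ω) b
  apply chi_eq hz (a * b) g (ρ * ρ') (by rw [mul_pow, h1, h1']; simp) (mul_ne_zero h2 h2')
  rw [map_mul, chi_spec hz a g ρ h1, chi_spec hz b g ρ' h1', zp_add hz, map_mul]; ring

theorem chi_comp (a : Fˣ) (g h : Ω ≃ₐ[F] Ω) :
    chi Ω hz a (g * h) = chi Ω hz a g + chi Ω hz a h := by
  obtain ⟨ρ, h1, h2⟩ := exists_rt (Ω := Ω) a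
  apply chi_eq hz a (g * h) ρ h1 h2
  rw [AlgEquiv.mul_apply, chi_spec hz a h ρ h1, map_mul, AlgEquiv.commutes, chi_spec hz a g ρ h1,
    zp_add hz, map_mul]; ring

/-- locally constant functions on the Galois group -/
def LocC (φ : (Ω ≃ₐ[F] Ω) → Ωˣ) : Prop :=
  ∃ E : IntermediateField F Ω, FiniteDimensional F E ∧ ∀ g g' : Ω ≃ₐ[F] Ω,
    (∀ x ∈ E, g x = g' x) → φ g = φ g'

theorem LocC.mul {φ ψ : (Ω ≃ₐ[F] Ω) → Ωˣ} (h1 : LocC φ) (h2 : LocC ψ) :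
    LocC (fun g => φ g * ψ g) := by
  obtain ⟨E, hE, h⟩ := h1
  obtain ⟨E', hE', h'⟩ := h2
  refine ⟨E ⊔ E', IntermediateField.finiteDimensional_sup E E', fun g g' hg => ?_⟩
  dsimp only
  rw [h g g' (fun x hx => hg x (le_sup_left (a := E) hx)),
    h' g g' (fun x hx => hg x (le_sup_right (a := E) hx))]

theorem LocC.inv {φ : (Ω ≃ₐ[F] Ω) → Ωˣ} (h1 : LocC φ) : LocC (fun g => (φ g)⁻¹) := by
  obtain ⟨E, hE, h⟩ := h1
  exact ⟨E, hE, fun g g' hg => by dsimp only; rw [h g g' hg]⟩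

theorem locC_fun (ρ ρ' : Ω) (h : IsIntegral F ρ) (h' : IsIntegral F ρ')
    (φ : (Ω ≃ₐ[F] Ω) → Ωˣ)
    (hφ : ∀ g g' : Ω ≃ₐ[F] Ω, g ρ = g' ρ → g ρ' = g' ρ' → φ g = φ g') : LocC φ := by
  have := IntermediateField.adjoin.finiteDimensional h
  have := IntermediateField.adjoin.finiteDimensional h'
  refine ⟨IntermediateField.adjoin F {ρ} ⊔ IntermediateField.adjoin F {ρ'},
    IntermediateField.finiteDimensional_sup _ _, fun g g' hg => hφ g g' (hg _ ?_) (hg _ ?_)⟩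
  · exact le_sup_left (a := IntermediateField.adjoin F {ρ}) (IntermediateField.mem_adjoin_simple_self F ρ)
  · exact le_sup_right (b := IntermediateField.adjoin F {ρ'}) (IntermediateField.mem_adjoin_simple_self F ρ')

/-- trivial classes -/
def trivSub (Ω : Type*) [Field Ω] [Algebra F Ω] [IsAlgClosed Ω] {z : F}
    (hz : IsPrimitiveRoot z 3) : AddSubgroup ((Ω ≃ₐ[F] Ω) → (Ω ≃ₐ[F] Ω) → ZMod 3) where
  carrier := {f | ∃ φ : (Ω ≃ₐ[F] Ω) → Ωˣ, LocC φ ∧ ∀ g h,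
    algebraMap F Ω (zp z (f g h)) * (φ (g * h) : Ω) = φ g * g (φ h)}
  zero_mem' := ⟨fun _ => 1, ⟨⊥, inferInstance, fun _ _ _ => rfl⟩, fun g h => by simp [zp]⟩
  add_mem' := by
    rintro f f' ⟨φ, h1, h2⟩ ⟨φ', h1', h2'⟩
    refine ⟨_, h1.mul h1', fun g h => ?_⟩
    have := h2 g h
    have := h2' g h
    simp only [Pi.add_apply, zp_add hz, map_mul, Units.val_mul]
    linear_combination (φ' g * g (φ' h) : Ω) * h2 g h +
      algebraMap F Ω (zp z (f g h)) * (φ (g * h) : Ω) * h2' g h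
  neg_mem' := by
    rintro f ⟨φ, h1, h2⟩
    refine ⟨_, h1.inv, fun g h => ?_⟩
    have e := h2 g h
    have h3 : zp z (f g h) * zp z (-(f g h)) = 1 := by rw [← zp_add hz, add_neg_cancel]; simp [zp]
    have h4 : algebraMap F Ω (zp z (f g h)) * algebraMap F Ω (zp z (-(f g h))) = 1 := by
      rw [← map_mul, h3, map_one]
    have h5 : g (φ h : Ω) ≠ 0 := by simp
    have h6 : algebraMap F Ω (zp z (f g h)) ≠ 0 := left_ne_zero_of_mul_eq_one h4
    simp only [Pi.neg_apply, Units.val_inv_eq_inv_val, map_inv₀]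
    rw [eq_inv_of_mul_eq_one_right h4, ← mul_inv, ← mul_inv, e]

/-- the symbol -/
noncomputable def homeSym (Ω : Type*) [Field Ω] [Algebra F Ω] [IsAlgClosed Ω] {z : F}
    (hz : IsPrimitiveRoot z 3) : Fˣ →* Fˣ →*
    Multiplicative (((Ω ≃ₐ[F] Ω) → (Ω ≃ₐ[F] Ω) → ZMod 3) ⧸ trivSub Ω hz) :=
  MonoidHom.mk' (fun a => MonoidHom.mk' (fun b => Multiplicative.ofAdd
    (QuotientAddGroup.mk (fun g h => chi Ω hz a g * chi Ω hz b h))) (by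
      intro b c
      rw [← ofAdd_add, ← QuotientAddGroup.mk_add]
      congr 2
      ext g h
      simp [chi_mul, mul_add])) (by
    intro a b
    refine MonoidHom.ext fun c => ?_
    simp only [MonoidHom.mk'_apply, MonoidHom.mul_apply]
    rw [← ofAdd_add, ← QuotientAddGroup.mk_add]
    refine congrArg Multiplicative.ofAdd (congrArg _ ?_)
    funext g h
    simp [chi_mul, add_mul])

theorem homeSym_eq_one (a b : Fˣ) : homeSym Ω hz a b = 1 ↔
    ∃ φ : (Ω ≃ₐ[F] Ω) → Ωˣ, LocC φ ∧ ∀ g h,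
    algebraMap F Ω (zp z (chi Ω hz a g * chi Ω hz b h)) * (φ (g * h) : Ω) = φ g * g (φ h) := by
  change Multiplicative.ofAdd _ = _ ↔ _
  rw [ofAdd_eq_one, QuotientAddGroup.eq_zero_iff]
  rfl

theorem homeSym_exp (h : Multiplicative (((Ω ≃ₐ[F] Ω) → (Ω ≃ₐ[F] Ω) → ZMod 3) ⧸ trivSub Ω hz)) :
    h ^ 3 = 1 := by
  obtain ⟨f, hf⟩ := QuotientAddGroup.mk_surjective (Multiplicative.toAdd h)
  have : h = Multiplicative.ofAdd (QuotientAddGroup.mk f) := by rw [hf]; rfl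
  rw [this, ← ofAdd_nsmul, ← QuotientAddGroup.mk_nsmul]
  have h3 : 3 • f = 0 := by
    funext g h
    change 3 • f g h = 0
    generalize f g h = k
    revert k; decide
  rw [h3]; rfl

end home
end

section
set_option linter.unusedSectionVars false

section home
variable {F Ω : Type*} [Field F] [Field Ω] [Algebra F Ω] [IsAlgClosed Ω]
variable {z : F} (hz : IsPrimitiveRoot z 3)

theorem isInt_rt (a : Fˣ) (ρ : Ω) (h : ρ ^ 3 = algebraMap F Ω a) : IsIntegral F ρ := by
  refine IsIntegral.of_pow (n := 3) (by norm_num) ?_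
  rw [h]; exact isIntegral_algebraMap

theorem homeSym_isSym : IsSym (homeSym Ω hz) := by
  intro a b hab
  rw [homeSym_eq_one]
  obtain ⟨β, hβ, hβ0⟩ := exists_rt (Ω := Ω) a
  obtain ⟨ρ, hρ, hρ0⟩ := exists_rt (Ω := Ω) b
  set w := algebraMap F Ω z with hw
  have hw3 : w ^ 3 = 1 := by rw [hw, ← map_pow, hz.pow_eq_one, map_one]
  have hw2 : w ^ 2 + w + 1 = 0 := by
    have h1 : w ≠ 1 := by
      intro h
      have : z = 1 := (algebraMap F Ω).injective (by rw [map_one]; exact h)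
      exact hz.ne_one (by norm_num) this
    have : (w - 1) * (w ^ 2 + w + 1) = 0 := by linear_combination hw3
    exact (mul_eq_zero.1 this).resolve_left (sub_ne_zero.2 h1)
  let Q : ℕ → Ω := fun k => ∏ j ∈ Finset.range k, (1 - w ^ j * ρ)
  have hQ3 : Q 3 = β ^ 3 := by
    have : Q 3 = 1 - ρ ^ 3 := by
      simp only [Q, Finset.prod_range_succ, Finset.prod_range_zero]
      linear_combination (-ρ + w * ρ ^ 2) * hw2 + (-ρ ^ 3) * hw3
    rw [this, hβ, hρ, ← map_one (algebraMap F Ω), ← hab]; simp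
  have hf : ∀ j, 1 - w ^ j * ρ ≠ 0 := by
    intro j h
    have h1 : w ^ j * ρ = 1 := (sub_eq_zero.1 h).symm
    have h2 : (w ^ j * ρ) ^ 3 = ρ ^ 3 := by
      rw [mul_pow, ← pow_mul, mul_comm j, pow_mul, hw3, one_pow, one_mul]
    rw [h1, one_pow, hρ, ← map_one (algebraMap F Ω)] at h2
    have h3 := (algebraMap F Ω).injective h2
    rw [← h3] at hab
    exact a.ne_zero (by simp at hab)
  have hQ0 : ∀ k, Q k ≠ 0 := fun k => Finset.prod_ne_zero_iff.2 (fun j _ => hf j)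
  have hQadd : ∀ k l, Q (k + l) = Q k * ∏ j ∈ Finset.range l, (1 - w ^ j * (w ^ k * ρ)) := by
    intro k l
    simp only [Q]
    rw [Finset.prod_range_add]
    congr 1
    apply Finset.prod_congr rfl
    intro j _
    rw [pow_add]; ring
  let T : ℕ → Ω := fun k => β ^ k / Q k
  have hT3 : ∀ k, T (k + 3) = T k := by
    intro k
    simp only [T]
    rw [add_comm k 3, hQadd, hQ3, hw3, one_mul, pow_add, mul_div_mul_left _ _ (pow_ne_zero 3 hβ0)]
  have hTmod : ∀ n, T (n % 3) = T n := by
    intro n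
    conv_rhs => rw [← Nat.mod_add_div n 3]
    generalize n / 3 = q
    induction q with
    | zero => rfl
    | succ q ih => rw [ih, Nat.mul_succ, ← add_assoc, hT3]
  have hT0 : ∀ k, T k ≠ 0 := fun k => div_ne_zero (pow_ne_zero _ hβ0) (hQ0 k)
  refine ⟨fun g => Units.mk0 (T (chi Ω hz b g).val) (hT0 _), ?_, ?_⟩
  · refine locC_fun ρ ρ (isInt_rt b ρ hρ) (isInt_rt b ρ hρ) _ ?_
    intro g g' h _
    have : chi Ω hz b g = chi Ω hz b g' := by
      apply chi_eq hz b g ρ hρ hρ0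
      rw [h, chi_spec hz b g' ρ hρ]
    simp only [this]
  · intro g h
    simp only [Units.val_mk0]
    rw [chi_comp, ZMod.val_add, hTmod, zp_mul hz]
    set k := (chi Ω hz b g).val with hk
    set l := (chi Ω hz b h).val with hl
    have e1 : g ρ = w ^ k * ρ := by rw [chi_spec hz b g ρ hρ, zp, map_pow]
    have e2 : g β = algebraMap F Ω (zp z (chi Ω hz a g)) * β := chi_spec hz a g β hβ
    have e3 : g (Q l) = ∏ j ∈ Finset.range l, (1 - w ^ j * (w ^ k * ρ)) := by
      simp only [Q, map_prod]
      apply Finset.prod_congr rfl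
      intro j _
      rw [map_sub, map_one, map_mul, map_pow, e1, hw, AlgEquiv.commutes]
    have e4 : Q (k + l) = Q k * g (Q l) := by rw [e3, hQadd]
    have h5 : g (Q l) ≠ 0 := by simpa using hQ0 l
    have h6 := hQ0 k
    simp only [T]
    rw [e4, map_div₀, map_pow, map_pow, e2, pow_add, mul_pow]
    field_simp

/-- Hilbert 90 -/
theorem h90 (N : Subgroup (Ω ≃ₐ[F] Ω)) (ψ : (Ω ≃ₐ[F] Ω) → Ωˣ) (hψ : LocC ψ)
    (hc : ∀ g ∈ N, ∀ h ∈ N, (ψ (g * h) : Ω) = ψ g * g (ψ h)) :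
    ∃ y : Ω, y ≠ 0 ∧ ∀ h ∈ N, (ψ h : Ω) * h y = y := by
  obtain ⟨E, hE, hloc⟩ := hψ
  classical
  let res : (Ω ≃ₐ[F] Ω) → (E →ₐ[F] Ω) := fun g => (g : Ω →ₐ[F] Ω).comp E.val
  let Ψ : (E →ₐ[F] Ω) → Ω := fun τ =>
    if h : ∃ g ∈ N, res g = τ then (ψ h.choose : Ω) else 0
  have hΨ : ∀ g ∈ N, Ψ (res g) = ψ g := by
    intro g hg
    have h : ∃ g' ∈ N, res g' = res g := ⟨g, hg, rfl⟩
    simp only [Ψ, dif_pos h]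
    congr 1
    apply hloc
    intro x hx
    exact DFunLike.congr_fun h.choose_spec.2 ⟨x, hx⟩
  have hli : LinearIndependent Ω (fun τ : E →ₐ[F] Ω => (⇑τ : E → Ω)) := by
    have := linearIndependent_monoidHom E Ω
    have hinj : Function.Injective (fun τ : E →ₐ[F] Ω => ((τ : E →+* Ω) : E →* Ω)) := by
      intro a b h
      ext x
      exact DFunLike.congr_fun h x
    exact this.comp _ hinj
  have hex : ∃ x : E, ∑ τ : E →ₐ[F] Ω, Ψ τ * τ x ≠ 0 := by
    by_contra hcon
    push Not at hcon
    rw [Fintype.linearIndependent_iff] at hli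
    have := hli Ψ (by
      funext x
      simpa [Finset.sum_apply] using hcon x) (res 1)
    rw [hΨ 1 N.one_mem] at this
    exact (ψ 1).ne_zero this
  obtain ⟨x, hx⟩ := hex
  refine ⟨_, hx, ?_⟩
  intro h hh
  rw [map_sum, Finset.mul_sum]
  refine Fintype.sum_equiv (AlgEquiv.arrowCongr (AlgEquiv.refl) h) _ _ ?_
  intro τ
  have h1 : Ψ ((AlgEquiv.arrowCongr AlgEquiv.refl h) τ) = ψ h * h (Ψ τ) := by
    by_cases hτ : ∃ g ∈ N, res g = τ
    · obtain ⟨g, hg, rfl⟩ := hτ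
      have : (AlgEquiv.arrowCongr AlgEquiv.refl h) (res g) = res (h * g) := by
        ext x; rfl
      rw [this, hΨ _ (N.mul_mem hh hg), hΨ _ hg, hc h hh g hg]
    · have hτ' : ¬ ∃ g ∈ N, res g = (AlgEquiv.arrowCongr AlgEquiv.refl h) τ := by
        rintro ⟨g, hg, he⟩
        refine hτ ⟨h⁻¹ * g, N.mul_mem (N.inv_mem hh) hg, ?_⟩
        ext x
        have := DFunLike.congr_fun he x
        change h⁻¹ (g x) = τ x
        change g x = h (τ x) at this
        rw [this]
        exact h.symm_apply_apply _
      simp only [Ψ, dif_neg hτ, dif_neg hτ']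
      simp
  rw [h1, map_mul]
  change _ = _ * h (τ x)
  ring

end home
end

section
set_option linter.unusedSectionVars false

theorem home_detect {F K Ω : Type*} [Field F] [CharZero F] [Field K] [Algebra F K]
    [Algebra.IsAlgebraic F K] [Field Ω] [Algebra F Ω] [Algebra K Ω] [IsScalarTower F K Ω]
    [IsAlgClosed Ω] [Algebra.IsAlgebraic K Ω] {z : F} (hz : IsPrimitiveRoot z 3) (m b : Fˣ) (α : K)
    (hα : α ^ 3 = algebraMap F K m) (hgen : IntermediateField.adjoin F {α} = ⊤)
    (σ : K ≃ₐ[F] K) (hσ : σ α = algebraMap F K z * α)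
    (h : homeSym Ω hz b m = 1) :
    ∃ y : K, y * σ y * σ (σ y) = algebraMap F K b := by
  have : CharZero K := charZero_of_injective_algebraMap (algebraMap F K).injective
  have : Algebra.IsAlgebraic F Ω := Algebra.IsAlgebraic.trans F K Ω
  have : IsAlgClosure F Ω := ⟨inferInstance, this⟩
  have : IsAlgClosure K Ω := ⟨inferInstance, inferInstance⟩
  have : Normal F Ω := inferInstance
  rw [homeSym_eq_one] at h
  obtain ⟨φ, hφl, hφ⟩ := h
  set ι := algebraMap K Ω with hι
  have hFK : ∀ x : F, ι (algebraMap F K x) = algebraMap F Ω x := fun x =>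
    (IsScalarTower.algebraMap_apply F K Ω x).symm
  have hρ : (ι α) ^ 3 = algebraMap F Ω m := by rw [← map_pow, hα, hFK]
  have hρ0 : ι α ≠ 0 := by
    intro h
    rw [h] at hρ
    have := m.ne_zero
    apply this
    apply (algebraMap F Ω).injective
    rw [map_zero, ← hρ]; simp
  obtain ⟨β, hβ, hβ0⟩ := exists_rt (Ω := Ω) b
  set χ := chi Ω hz m with hχ
  -- fixing K
  have hfixK : ∀ g : Ω ≃ₐ[F] Ω, χ g = 0 → ∀ x : K, g (ι x) = ι x := by
    intro g hg x
    have h1 : g (ι α) = ι α := by rw [chi_spec hz m g _ hρ, ← hχ, hg]; simp [zp]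
    have hx : x ∈ IntermediateField.adjoin F {α} := by rw [hgen]; trivial
    induction hx using IntermediateField.adjoin_induction with
    | mem x hx => rw [Set.mem_singleton_iff] at hx; rw [hx]; exact h1
    | algebraMap x => rw [hFK]; simp
    | add x y _ _ hx hy => rw [map_add, map_add, hx, hy]
    | inv x _ hx => rw [map_inv₀, map_inv₀, hx]
    | mul x y _ _ hx hy => rw [map_mul, map_mul, hx, hy]
  let N : Subgroup (Ω ≃ₐ[F] Ω) :=
    { carrier := {g | χ g = 0}
      one_mem' := by
        have := chi_comp hz m (1 : Ω ≃ₐ[F] Ω) 1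
        simpa using this
      mul_mem' := by
        intro a b ha hb
        change χ _ = 0
        rw [hχ, chi_comp]
        change χ a + χ b = 0
        rw [show χ a = 0 from ha, show χ b = 0 from hb]; rfl
      inv_mem' := by
        intro a ha
        have h1 := chi_comp hz m a a⁻¹
        have h2 := chi_comp hz m (1 : Ω ≃ₐ[F] Ω) 1
        rw [mul_inv_cancel] at h1
        change χ _ = 0
        change χ _ = χ _ + χ _ at h1
        change χ _ = χ _ + χ _ at h2
        rw [show χ a = 0 from ha] at h1
        rw [mul_one] at h2
        have h3 : χ 1 = 0 := by simpa using h2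
        rw [h3] at h1; simpa using h1.symm }
  have hN : ∀ g, g ∈ N ↔ χ g = 0 := fun g => Iff.rfl
  have hχm : ∀ g h, χ (g * h) = χ g + χ h := fun g h => chi_comp hz m g h
  -- ψ
  let ψ : (Ω ≃ₐ[F] Ω) → Ωˣ := fun g => (Units.mk0 β hβ0) ^ (χ g).val * (φ g)⁻¹
  have hψl : LocC ψ := by
    refine LocC.mul ?_ hφl.inv
    refine locC_fun (ι α) (ι α) (isInt_rt m _ hρ) (isInt_rt m _ hρ) _ ?_
    intro g g' h _
    have : χ g = χ g' := by
      apply chi_eq hz m g _ hρ hρ0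
      rw [h, chi_spec hz m g' _ hρ]
    rw [this]
  have hψ : ∀ g h, (χ g).val + (χ h).val < 3 → (ψ (g * h) : Ω) = ψ g * g (ψ h) := by
    intro g h hlt
    have e := hφ g h
    rw [zp_mul hz] at e
    simp only [ψ, Units.val_mul, Units.val_pow_eq_pow_val, Units.val_mk0, map_mul, map_pow,
      Units.val_inv_eq_inv_val, map_inv₀]
    rw [chi_spec hz b g β hβ, hχm, ZMod.val_add_of_lt hlt, pow_add, mul_pow, map_pow] at *
    have h1 := (φ g).ne_zero
    have h2 := (φ (g * h)).ne_zero
    have h3 : g (φ h : Ω) ≠ 0 := by simp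
    change _ ^ (χ h).val * _ = _ at e
    field_simp
    rw [← e]; ring
  have hψ3 : ∀ g h, (χ g).val + (χ h).val = 3 →
      (ψ (g * h) : Ω) * algebraMap F Ω b = ψ g * g (ψ h) := by
    intro g h hlt
    have e := hφ g h
    rw [zp_mul hz] at e
    simp only [ψ, Units.val_mul, Units.val_pow_eq_pow_val, Units.val_mk0, map_mul, map_pow,
      Units.val_inv_eq_inv_val, map_inv₀]
    have hv : χ g + χ h = 0 := by
      rw [← ZMod.natCast_zmod_val (χ g), ← ZMod.natCast_zmod_val (χ h), ← Nat.cast_add, hlt]; rfl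
    rw [chi_spec hz b g β hβ, hχm, hv, mul_pow, map_pow] at *
    have h1 := (φ g).ne_zero
    have h2 := (φ (g * h)).ne_zero
    have h3 : g (φ h : Ω) ≠ 0 := by simp
    change _ ^ (χ h).val * _ = _ at e
    have h4 : β ^ (χ g).val * β ^ (χ h).val = algebraMap F Ω b := by rw [← pow_add, hlt, hβ]
    rw [← h4]
    simp only [ZMod.val_zero, pow_zero]
    field_simp
    rw [← e]; ring
  obtain ⟨y, hy0, hy⟩ := h90 N ψ hψl (fun g hg h hh => hψ g h (by
    rw [(hN g).1 hg, (hN h).1 hh]; simp))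
  -- ψ'
  let P : (Ω ≃ₐ[F] Ω) → Ω := fun g => ψ g * g y / y
  have hP1 : ∀ g ∈ N, P g = 1 := by
    intro g hg
    simp only [P, hy g hg, div_self hy0]
  have hP : ∀ g h, (χ g).val + (χ h).val < 3 → P (g * h) = P g * g (P h) := by
    intro g h hlt
    have h3 : g y ≠ 0 := by simpa using hy0
    simp only [P, hψ g h hlt, map_div₀, map_mul, AlgEquiv.mul_apply]
    field_simp
  have hP3 : ∀ g h, (χ g).val + (χ h).val = 3 → P (g * h) * algebraMap F Ω b = P g * g (P h) := by
    intro g h hlt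
    have h3 : g y ≠ 0 := by simpa using hy0
    have := hψ3 g h hlt
    simp only [P, map_div₀, map_mul, AlgEquiv.mul_apply]
    field_simp
    linear_combination (g (h y)) * this
  -- s
  set s := σ.liftNormal Ω with hs
  have hsc : ∀ x : K, s (ι x) = ι (σ x) := fun x => AlgEquiv.liftNormal_commutes σ Ω x
  have hs1 : χ s = 1 := by
    apply chi_eq hz m s _ hρ hρ0
    rw [hsc, hσ, map_mul, hFK]
    congr 2
    have : (1 : ZMod 3) = ((1:ℕ) : ZMod 3) := by simp
    rw [this, zp_nat hz, pow_one]
  have v1 : (χ s).val = 1 := by rw [hs1]; rfl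
  have hss : χ (s * s) = 2 := by rw [hχm, hs1]; rfl
  have v2 : (χ (s * s)).val = 2 := by rw [hss]; rfl
  have hfix : ∀ n ∈ N, n (P s) = P s := by
    intro n hn
    have hn0 : χ n = 0 := hn
    have h1 := hP n s (by rw [hn0, v1]; simp)
    rw [hP1 n hn, one_mul] at h1
    have h0 : χ (1 : Ω ≃ₐ[F] Ω) = 0 := N.one_mem
    have hn' : χ (s⁻¹ * n * s) = 0 := by
      have e : χ s⁻¹ + χ s = 0 := by rw [← hχm, inv_mul_cancel, h0]
      rw [hχm, hχm, hn0, add_zero, e]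
    have h2 := hP s (s⁻¹ * n * s) (by rw [hn', v1]; simp)
    rw [hP1 _ hn', map_one, mul_one, show s * (s⁻¹ * n * s) = n * s by group] at h2
    rw [← h1, h2]
  have hmem : ∃ x : K, ι x = P s := by
    have : IsGalois K Ω := inferInstance
    have h1 := (InfiniteGalois.mem_bot_iff_fixed (k := K) (K := Ω) (P s)).2 (by
      intro f
      have hf : f.restrictScalars F ∈ N := by
        apply chi_eq hz m _ _ hρ hρ0
        change f (ι α) = _
        rw [AlgEquiv.commutes]; simp [zp, hι]
      exact hfix _ hf)
    rw [IntermediateField.mem_bot] at h1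
    exact h1
  obtain ⟨x, hx⟩ := hmem
  refine ⟨x, ?_⟩
  apply ι.injective
  rw [map_mul, map_mul, hFK, ← hsc, ← hsc, ← hsc, hx]
  have e1 := hP s s (by rw [v1]; norm_num)
  have e2 := hP3 (s * s) s (by rw [v1, v2])
  rw [hP1 (s * s * s) (by
    change χ _ = 0
    rw [hχm, hss, hs1]; rfl), one_mul, e1] at e2
  rw [e2]; rfl

/-- Hasse-type norm theorem -/
theorem hasse_norm {R F K : Type*} [CommRing R] [IsDedekindDomain R] [IsPrincipalIdealRing R]
    [Field F] [Algebra R F] [IsFractionRing R F] (E : EuclidData R)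
    [CharZero F] [Field K] [Algebra F K]
    [Algebra.IsAlgebraic F K] {z : F} (hz : IsPrimitiveRoot z 3) (m b : Fˣ) (α : K)
    (hα : α ^ 3 = algebraMap F K m) (hgen : IntermediateField.adjoin F {α} = ⊤)
    (σ : K ≃ₐ[F] K) (hσ : σ α = algebraMap F K z * α)
    (h : ∀ v : IsDedekindDomain.HeightOneSpectrum R, TameTriv v b m) :
    ∃ y : K, y * σ y * σ (σ y) = algebraMap F K b :=
  home_detect (Ω := AlgebraicClosure K) hz m b α hα hgen σ hσ
    (EuclidData.tate E (homeSym_exp hz) _ (homeSym_isSym hz) b m h)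
end

section
set_option linter.unusedSectionVars false

section m3
variable {L I : Type*} [AddCommGroup L] [AddCommGroup I]

def dOp (s : L →+ L) : L →+ L := AddMonoidHom.id L - s
def nOp (s : L →+ L) : L →+ L := AddMonoidHom.id L + s + s.comp s

theorem dOp_apply (s : L →+ L) (x : L) : dOp s x = x - s x := rfl
theorem nOp_apply (s : L →+ L) (x : L) : nOp s x = x + s x + s (s x) := rfl

theorem count_thm (s : L →+ L) (S : I →+ I) (dv : L →+ I)
    (hs : ∀ x, s (s (s x)) = x) (hS : ∀ x, S (S (S x)) = x)
    (hsd : ∀ x, dv (s x) = S (dv x))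
    (h90L : ∀ x, nOp s x = 0 → ∃ y, x = dOp s y)
    (h90I : ∀ x, nOp S x = 0 → ∃ y, x = dOp S y)
    (a e : ℕ)
    (hT : ((dOp s).ker.map dv).relIndex (dOp S).ker = a)
    (hE : (dv.ker.map (dOp s)).relIndex dv.ker = 18)
    (he : Nat.card (dv.ker ⊓ (nOp s).range : AddSubgroup L) = e) :
    dv.range.relIndex (dv.range.comap (dOp S)) * 18 = a * e := by
  have hnd : ∀ x, nOp s (dOp s x) = 0 := by
    intro x
    simp only [nOp_apply, dOp_apply, map_sub, hs]; abel
  have hND : ∀ x, nOp S (dOp S x) = 0 := by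
    intro x
    simp only [nOp_apply, dOp_apply, map_sub, hS]; abel
  have hdD : ∀ x, dv (dOp s x) = dOp S (dv x) := by
    intro x
    simp only [dOp_apply, map_sub, hsd]
  have hnN : ∀ x, dv (nOp s x) = nOp S (dv x) := by
    intro x
    simp only [nOp_apply, map_add, hsd]
  set E := dv.ker with hEdef
  set P := dv.range with hPdef
  set LG := (dOp s).ker
  set IG := (dOp S).ker
  have hIGA : IG ≤ P.comap (dOp S) := by
    intro x hx
    rw [AddSubgroup.mem_comap, (AddMonoidHom.mem_ker).1 hx]; exact zero_mem _
  have hPA : P ≤ P.comap (dOp S) := by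
    rintro _ ⟨x, rfl⟩
    exact ⟨dOp s x, hdD x⟩
  -- step 1
  have s1 : P.relIndex IG * (P ⊔ IG).relIndex (P.comap (dOp S)) =
      P.relIndex (P.comap (dOp S)) := by
    rw [← AddSubgroup.relIndex_mul_relIndex P (P ⊔ IG) _ le_sup_left (sup_le hPA hIGA),
      AddSubgroup.relIndex_sup_left]
  -- step 2
  have hLGI : LG.map dv ≤ P ⊓ IG := by
    rintro _ ⟨x, hx, rfl⟩
    refine ⟨⟨x, rfl⟩, ?_⟩
    change dOp S (dv x) = 0
    rw [← hdD, (AddMonoidHom.mem_ker).1 hx, map_zero]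
  have s2 : (LG.map dv).relIndex (P ⊓ IG) * P.relIndex IG = a := by
    rw [← hT, ← AddSubgroup.inf_relIndex_right P IG]
    exact AddSubgroup.relIndex_mul_relIndex _ _ _ hLGI inf_le_right
  -- step 3
  have e1 : (E.comap (dOp s)).map dv = P ⊓ IG := by
    ext x
    constructor
    · rintro ⟨y, hy, rfl⟩
      refine ⟨⟨y, rfl⟩, ?_⟩
      change dOp S (dv y) = 0
      rw [← hdD]; exact hy
    · rintro ⟨⟨y, rfl⟩, hx⟩
      refine ⟨y, ?_, rfl⟩
      change dv (dOp s y) = 0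
      rw [hdD]; exact hx
  have e2 : (E.comap (dOp s)).map (dOp s) = E ⊓ (nOp s).ker := by
    ext x
    constructor
    · rintro ⟨y, hy, rfl⟩
      exact ⟨hy, hnd y⟩
    · rintro ⟨hx, hx'⟩
      obtain ⟨y, rfl⟩ := h90L x hx'
      exact ⟨y, hx, rfl⟩
  have s3 : (LG.map dv).relIndex (P ⊓ IG) = (E.map (dOp s)).relIndex (E ⊓ (nOp s).ker) := by
    rw [← e1, ← e2, ← AddSubgroup.relIndex_comap, ← AddSubgroup.relIndex_comap,
      AddSubgroup.comap_map_eq, AddSubgroup.comap_map_eq, sup_comm]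
  have hEs : ∀ x ∈ E, dOp s x ∈ E := by
    intro x hx
    change dv _ = 0
    rw [hdD, (AddMonoidHom.mem_ker).1 hx, map_zero]
  have hE1 : E.map (dOp s) ≤ E ⊓ (nOp s).ker := by
    rintro _ ⟨x, hx, rfl⟩
    exact ⟨hEs x hx, hnd x⟩
  have s4 : (E.map (dOp s)).relIndex (E ⊓ (nOp s).ker) * Nat.card (E.map (nOp s)) = 18 := by
    have h0 : (E ⊓ (nOp s).ker).relIndex E = (nOp s).ker.relIndex E := AddSubgroup.inf_relIndex_left ..
    rw [← hE, ← AddSubgroup.relIndex_ker, ← h0]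
    exact AddSubgroup.relIndex_mul_relIndex _ _ _ hE1 inf_le_left
  -- step 5
  set B := (dOp S).range.comap dv with hB
  have e3 : (P.comap (dOp S)).map (dOp S) = B.map dv := by
    ext x
    constructor
    · rintro ⟨y, ⟨z, hz⟩, rfl⟩
      exact ⟨z, ⟨y, hz.symm⟩, hz⟩
    · rintro ⟨y, ⟨z, hz⟩, rfl⟩
      exact ⟨z, ⟨y, hz.symm⟩, hz⟩
  have e4 : P.map (dOp S) = (dOp s).range.map dv := by
    ext x
    constructor
    · rintro ⟨_, ⟨z, rfl⟩, rfl⟩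
      exact ⟨dOp s z, ⟨z, rfl⟩, hdD z⟩
    · rintro ⟨_, ⟨z, rfl⟩, rfl⟩
      exact ⟨dv z, ⟨z, rfl⟩, (hdD z).symm⟩
  have e5 : B.map (nOp s) = E ⊓ (nOp s).range := by
    ext x
    constructor
    · rintro ⟨y, ⟨z, hz⟩, rfl⟩
      refine ⟨?_, ⟨y, rfl⟩⟩
      change dv _ = 0
      rw [hnN, ← hz, hND]
    · rintro ⟨hx, ⟨y, rfl⟩⟩
      refine ⟨y, ?_, rfl⟩
      have hx' : dv (nOp s y) = 0 := hx
      rw [hnN] at hx'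
      obtain ⟨z, hz⟩ := h90I _ hx'
      exact ⟨z, hz.symm⟩
  have e6 : (dOp s).range = (nOp s).ker := by
    ext x
    constructor
    · rintro ⟨y, rfl⟩; exact hnd y
    · intro hx
      obtain ⟨y, rfl⟩ := h90L x hx
      exact ⟨y, rfl⟩
  have s5 : (P ⊔ IG).relIndex (P.comap (dOp S)) = (E.map (nOp s)).relIndex (E ⊓ (nOp s).range) := by
    rw [← AddSubgroup.comap_map_eq, AddSubgroup.relIndex_comap, e3, e4, ← AddSubgroup.relIndex_comap,
      AddSubgroup.comap_map_eq, e6, ← e5, ← AddSubgroup.relIndex_comap, AddSubgroup.comap_map_eq,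
      sup_comm]
  have s6 : Nat.card (E.map (nOp s)) * (E.map (nOp s)).relIndex (E ⊓ (nOp s).range) = e := by
    rw [← he, ← AddSubgroup.relIndex_bot_left, ← AddSubgroup.relIndex_bot_left]
    refine AddSubgroup.relIndex_mul_relIndex _ _ _ bot_le ?_
    rintro _ ⟨x, hx, rfl⟩
    refine ⟨?_, ⟨x, rfl⟩⟩
    change dv _ = 0
    rw [hnN, (AddMonoidHom.mem_ker).1 hx, map_zero]
  rw [← s1, s5]
  rw [s3] at s2
  calc _ = ((E.map (dOp s)).relIndex (E ⊓ (nOp s).ker) * P.relIndex IG) *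
      (Nat.card (E.map (nOp s)) * (E.map (nOp s)).relIndex (E ⊓ (nOp s).range)) := by
        rw [← s4]; ring
    _ = _ := by rw [s2, s6]

theorem square_thm (s t : L →+ L) (S T : I →+ I) (dv : L →+ I)
    (hs : ∀ x, s (s (s x)) = x) (hS : ∀ x, S (S (S x)) = x)
    (hT : ∀ x, T (T x) = x)
    (hts : ∀ x, t (s x) = s (s (t x))) (hTS : ∀ x, T (S x) = S (S (T x)))
    (hsd : ∀ x, dv (s x) = S (dv x)) (htd : ∀ x, dv (t x) = T (dv x))
    (h90L : ∀ x, nOp s x = 0 → ∃ y, x = dOp s y)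
    (h90I : ∀ x, nOp S x = 0 → ∃ y, x = dOp S y)
    (hN : ∀ D, ∃ f, s f = f ∧ nOp S D = dv f)
    (hfix : ∀ D, S D = D → T D - D ∈ dv.range)
    (hE : ∀ x, dv x = 0 → s x = x → t x = - x)
    (key : ∀ D f, s f = f → dv f = nOp S D → ∃ x, nOp s x = f + t f) :
    dv.range.relIndex (dv.range.comap (3 • AddMonoidHom.id I)) =
      dv.range.relIndex (dv.range.comap (dOp S)) ^ 2 := by
  have hnd : ∀ x, nOp s (dOp s x) = 0 := by
    intro x
    simp only [nOp_apply, dOp_apply, map_sub, hs]; abel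
  have hND : ∀ x, nOp S (dOp S x) = 0 := by
    intro x
    simp only [nOp_apply, dOp_apply, map_sub, hS]; abel
  have hdD : ∀ x, dv (dOp s x) = dOp S (dv x) := by
    intro x
    simp only [dOp_apply, map_sub, hsd]
  have hnN : ∀ x, dv (nOp s x) = nOp S (dv x) := by
    intro x
    simp only [nOp_apply, map_add, hsd]
  set P := dv.range with hPdef
  have hNP : ∀ D, nOp S D ∈ P := fun D => by
    obtain ⟨f, -, hf⟩ := hN D
    exact ⟨f, hf.symm⟩
  have hSP : ∀ D, D ∈ P → S D ∈ P := by
    rintro _ ⟨x, rfl⟩; exact ⟨s x, hsd x⟩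
  -- claim
  have claim : ∀ D, dOp S D ∈ P → ∃ C, D - dOp S C ∈ P := by
    intro D hD
    obtain ⟨x, hx⟩ := hD
    have hNx : dv (nOp s x) = 0 := by rw [hnN, hx, hND]
    have hsNx : s (nOp s x) = nOp s x := by simp only [nOp_apply, map_add, hs]; abel
    have htn : ∀ x, nOp s (t x) = t (nOp s x) := by
      intro x; simp only [nOp_apply, map_add, hts, hs]; abel
    have hTN : ∀ x, nOp S (T x) = T (nOp S x) := by
      intro x; simp only [nOp_apply, map_add, hTS, hS]; abel
    have hns : ∀ x, nOp s (s x) = nOp s x := by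
      intro x; simp only [nOp_apply, hs]; abel
    obtain ⟨y, hy⟩ := h90L (x + s (t x)) (by
      rw [map_add, hns, htn, hE _ hNx hsNx]; abel)
    have h1 : dOp S (D - T D - dv y) = 0 := by
      have e1 : dv (s (t x)) = S (T (D - S D)) := by rw [hsd, htd, hx]; rfl
      have e2 : dv (x + s (t x)) = dOp S (dv y) := by rw [hy, hdD]
      rw [map_add, hx, e1] at e2
      rw [map_sub, ← e2]
      simp only [dOp_apply, map_sub, hTS, hS]; abel
    set U := D - T D - dv y with hU
    have hSU : S U = U := by
      have := h1
      rw [dOp_apply, sub_eq_zero] at this; exact this.symm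
    have h2 := hfix U hSU
    have h3 : U + U + U ∈ P := by
      have := hNP U
      rwa [nOp_apply, hSU, hSU] at this
    have h4 : U + U ∈ P := by
      have : U + U = -(T U - U) - (dv y + dv (t y)) := by
        rw [htd, hU]
        simp only [map_sub, hT]; abel
      rw [this]
      exact sub_mem (neg_mem h2) (add_mem ⟨y, rfl⟩ ⟨t y, rfl⟩)
    have h5 : U ∈ P := by
      have := sub_mem h3 h4
      rwa [add_sub_cancel_left] at this
    have h6 : D - T D ∈ P := by
      have := add_mem h5 (⟨y, rfl⟩ : dv y ∈ P)
      rwa [hU, sub_add_cancel] at this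
    obtain ⟨f, hf1, hf2⟩ := hN D
    obtain ⟨x', hx'⟩ := key D f hf1 hf2.symm
    obtain ⟨C, hC⟩ := h90I (D + T D - dv x') (by
      rw [map_sub, map_add, hTN, ← hnN, hx', map_add, htd, hf2, sub_self])
    have h7 : D + D + D ∈ P := by
      have a1 := hNP D
      have hD' : D - S D ∈ P := ⟨x, hx⟩
      have a2 := hSP _ hD'
      rw [nOp_apply] at a1
      have := add_mem a1 (add_mem hD' (add_mem hD' a2))
      convert this using 1
      simp only [map_sub]; abel
    refine ⟨C + C, ?_⟩
    have h8 : D - dOp S (C + C) = (D - T D) + (D - T D) - (D + D + D)  + (dv x' + dv x') := by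
      rw [map_add, ← hC]; abel
    rw [h8]
    exact add_mem (sub_mem (add_mem h6 h6) h7) (add_mem ⟨x', rfl⟩ ⟨x', rfl⟩)
  set A := P.comap (dOp S) with hA
  have hPA : P ≤ A := by
    rintro _ ⟨x, rfl⟩
    exact ⟨dOp s x, hdD x⟩
  have hC3 : P.comap (3 • AddMonoidHom.id I) = A.comap (dOp S) := by
    ext D
    rw [AddSubgroup.mem_comap, AddSubgroup.mem_comap, hA, AddSubgroup.mem_comap]
    have e : dOp S (dOp S D) = nOp S D - S ((3 • AddMonoidHom.id I) D) := by
      simp only [dOp_apply, nOp_apply, map_sub, AddMonoidHom.smul_apply, AddMonoidHom.id_apply,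
        map_nsmul]; abel
    constructor
    · intro h
      rw [e]; exact sub_mem (hNP D) (hSP _ h)
    · intro h
      rw [e] at h
      have h2 : S ((3 • AddMonoidHom.id I) D) ∈ P := by
        have := sub_mem (hNP D) h
        rwa [sub_sub_cancel] at this
      have := hSP _ (hSP _ h2)
      rwa [hS] at this
  have hAC : A ≤ A.comap (dOp S) := by
    intro x hx
    exact hPA hx
  rw [hC3, ← AddSubgroup.relIndex_mul_relIndex P A _ hPA hAC, pow_two]
  congr 1
  conv_lhs => rw [hA, ← hA]
  have e1 : A.relIndex (A.comap (dOp S)) = P.relIndex ((A.comap (dOp S)).map (dOp S)) := by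
    rw [← AddSubgroup.relIndex_comap]
  rw [e1, ← AddSubgroup.relIndex_sup_left]
  congr 1
  apply le_antisymm
  · refine sup_le hPA ?_
    rintro _ ⟨x, hx, rfl⟩
    exact hx
  · intro D hD
    obtain ⟨C, hC⟩ := claim D hD
    rw [← sub_add_cancel D (dOp S C)]
    refine add_mem (AddSubgroup.mem_sup_left hC) (AddSubgroup.mem_sup_right ⟨C, ?_, rfl⟩)
    change dOp S C ∈ A
    have := sub_mem hD (hPA hC)
    rwa [sub_sub_cancel] at this

end m3
end

section
open IsDedekindDomain nonZeroDivisors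
set_option linter.unusedSectionVars false

section transf
variable {R : Type*} [CommRing R] [IsDedekindDomain R] {K : Type*} [Field K]
  [Algebra R K] [IsFractionRing R K]
variable {R' : Type*} [CommRing R'] [IsDedekindDomain R'] {K' : Type*} [Field K']
  [Algebra R' K'] [IsFractionRing R' K']

theorem ordZ_transfer (f : K →+* K') (g : R →+* R')
    (hfg : ∀ r, f (algebraMap R K r) = algebraMap R' K' (g r))
    (v : HeightOneSpectrum R) (w : HeightOneSpectrum R')
    (hvw : ∀ r, g r ∈ w.asIdeal ↔ r ∈ v.asIdeal) :
    ∃ e : ℤ, 0 < e ∧ ∀ x : Kˣ, ordZ w (Units.map (f : K →* K') x) = e * ordZ v x := by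
  have h0 : ∀ x : Kˣ, ordZ v x = 0 → ordZ w (Units.map (f : K →* K') x) = 0 := by
    intro x hx
    obtain ⟨a, b, ha, hb, hab⟩ := exists_frac_ordZ v x hx
    have hb0 : algebraMap R K b ≠ 0 := by
      rw [Ne, FaithfulSMul.algebraMap_eq_zero_iff]; rintro rfl; exact hb (zero_mem _)
    have ha0 : algebraMap R K a ≠ 0 := by
      rw [Ne, FaithfulSMul.algebraMap_eq_zero_iff]; rintro rfl; exact ha (zero_mem _)
    have h1 : x = Units.mk0 _ ha0 / Units.mk0 _ hb0 := by
      ext; simp [← hab, hb0]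
    rw [h1, map_div, ordZ_div, (ordZ_alg_eq_zero w _ (g a) (by simp [hfg])).2 (by rwa [hvw]),
      (ordZ_alg_eq_zero w _ (g b) (by simp [hfg])).2 (by rwa [hvw])]
    simp
  obtain ⟨π, hπ⟩ := exists_unif (K := K) v
  have hall : ∀ x : Kˣ, ordZ w (Units.map (f : K →* K') x)
      = ordZ w (Units.map (f : K →* K') π) * ordZ v x := by
    intro x
    have h1 := h0 (x / π ^ (ordZ v x)) (by rw [ordZ_div, ordZ_zpow, hπ]; ring)
    rw [map_div, ordZ_div, map_zpow, ordZ_zpow] at h1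
    linarith
  refine ⟨_, ?_, hall⟩
  obtain ⟨p, hp, hp0⟩ := Submodule.exists_mem_ne_zero_of_ne_bot v.ne_bot
  have hpK : algebraMap R K p ≠ 0 := by
    rwa [Ne, FaithfulSMul.algebraMap_eq_zero_iff]
  have h2 := hall (Units.mk0 _ hpK)
  have h3 : 0 < ordZ v (Units.mk0 _ hpK) := (ordZ_alg_pos v _ p rfl).2 hp
  have h4 : 0 < ordZ w (Units.map (f : K →* K') (Units.mk0 _ hpK)) :=
    (ordZ_alg_pos w _ (g p) (by simp [hfg])).2 (by rwa [hvw])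
  rw [h2] at h4
  exact (pos_iff_pos_of_mul_pos h4).2 h3

theorem ordZ_equiv (f : K ≃+* K') (g : R ≃+* R')
    (hfg : ∀ r, f (algebraMap R K r) = algebraMap R' K' (g r))
    (v : HeightOneSpectrum R) (x : Kˣ) :
    ordZ (HeightOneSpectrum.equivOfRingEquiv g v) (Units.map ((f : K →+* K') : K →* K') x)
      = ordZ v x := by
  obtain ⟨e, he, h⟩ := ordZ_transfer (f : K →+* K') (g : R →+* R') (fun r => by simpa using hfg r) v
    (HeightOneSpectrum.equivOfRingEquiv g v) (fun r => by
      change g.symm (g r) ∈ v.asIdeal ↔ _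
      rw [g.symm_apply_apply])
  obtain ⟨π, hπ⟩ := exists_unif (K := K') (HeightOneSpectrum.equivOfRingEquiv g v)
  have h1 := h (Units.map (f.symm : K' →+* K) π)
  have h2 : Units.map ((f : K →+* K') : K →* K') (Units.map (f.symm : K' →+* K) π) = π := by
    ext; simp
  rw [h2, hπ] at h1
  have h3 : e = 1 := Int.eq_one_of_mul_eq_one_right he.le h1.symm
  rw [h, h3, one_mul]

end transf

section divs
variable (R : Type*) [CommRing R] [IsDedekindDomain R] (K : Type*) [Field K]
  [Algebra R K] [IsFractionRing R K]

abbrev Dv := HeightOneSpectrum R →₀ ℤ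

noncomputable def dvH : Additive Kˣ →+ Dv R where
  toFun x := Finsupp.ofSupportFinite (fun v => ordZ v x.toMul) (finite_ordZ (R := R) x.toMul)
  map_zero' := by ext v; exact ordZ_one v
  map_add' x y := by ext v; exact ordZ_mul v _ _

theorem dvH_apply (x : Additive Kˣ) (v : HeightOneSpectrum R) : dvH R K x v = ordZ v x.toMul := rfl

noncomputable def primeU (v : HeightOneSpectrum R) : (FractionalIdeal R⁰ K)ˣ :=
  Units.mk0 (v.asIdeal : FractionalIdeal R⁰ K) (FractionalIdeal.coeIdeal_ne_zero.mpr v.ne_bot)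

noncomputable def divU : Dv R →+ Additive (FractionalIdeal R⁰ K)ˣ :=
  Finsupp.liftAddHom fun v => zmultiplesHom _ (Additive.ofMul (primeU R K v))

theorem divU_coe (D : Dv R) : (((divU R K D).toMul : (FractionalIdeal R⁰ K)ˣ) : FractionalIdeal R⁰ K)
    = D.prod (fun v n => (v.asIdeal : FractionalIdeal R⁰ K) ^ n) := by
  simp only [divU, Finsupp.liftAddHom_apply, Finsupp.sum, Finsupp.prod, toMul_sum, Units.coe_prod]
  refine Finset.prod_congr rfl fun v _ => ?_
  simp [primeU]

theorem count_divU (D : Dv R) (v : HeightOneSpectrum R) :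
    FractionalIdeal.count K v ((divU R K D).toMul : (FractionalIdeal R⁰ K)ˣ) = D v := by
  rw [divU_coe, FractionalIdeal.count_finsuppProd]

theorem fracIdeal_ext {I I' : FractionalIdeal R⁰ K} (hI : I ≠ 0) (hI' : I' ≠ 0)
    (h : ∀ v, FractionalIdeal.count K v I = FractionalIdeal.count K v I') : I = I' := by
  rw [← FractionalIdeal.finprod_heightOneSpectrum_factorization' K hI,
    ← FractionalIdeal.finprod_heightOneSpectrum_factorization' K hI']
  simp only [h]

theorem count_principal (x : Kˣ) (v : HeightOneSpectrum R) :
    FractionalIdeal.count K v (FractionalIdeal.spanSingleton R⁰ (x : K)) = ordZ v x := by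
  classical
  have key : ∀ (y : Kˣ) (r : R), (y : K) = algebraMap R K r →
      FractionalIdeal.count K v (FractionalIdeal.spanSingleton R⁰ (y : K)) = ordZ v y := by
    intro y r hr
    have hr0 : r ≠ 0 := by rintro rfl; simp at hr
    have h1 := valuation_eq_ordZ v y
    rw [hr, HeightOneSpectrum.valuation_of_algebraMap, HeightOneSpectrum.intValuation_if_neg v hr0,
      WithZero.exp_inj] at h1
    rw [hr, ← FractionalIdeal.coeIdeal_span_singleton, FractionalIdeal.count_coe K v (by simpa using hr0)]
    linarith
  obtain ⟨a, b, hb, hab⟩ := IsFractionRing.div_surjective (A := R) (x : K)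
  have hb0 : algebraMap R K b ≠ 0 := by
    rw [Ne, FaithfulSMul.algebraMap_eq_zero_iff]; exact nonZeroDivisors.ne_zero hb
  have ha0 : algebraMap R K a ≠ 0 := by
    intro h; rw [h, zero_div] at hab; exact x.ne_zero hab.symm
  have e1 : x * Units.mk0 _ hb0 = Units.mk0 _ ha0 := by
    ext; simp [← hab, hb0]
  have h2 := key _ a (rfl : ((Units.mk0 _ ha0 : Kˣ) : K) = _)
  have h3 := key _ b (rfl : ((Units.mk0 _ hb0 : Kˣ) : K) = _)
  rw [← e1, Units.val_mul, ← FractionalIdeal.spanSingleton_mul_spanSingleton,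
    FractionalIdeal.count_mul, h3, ordZ_mul] at h2
  · linarith
  · rw [Ne, FractionalIdeal.spanSingleton_eq_zero_iff]; exact x.ne_zero
  · rw [Ne, FractionalIdeal.spanSingleton_eq_zero_iff]; exact hb0

theorem divU_dvH (x : Kˣ) : (divU R K (dvH R K (Additive.ofMul x))).toMul = toPrincipalIdeal R K x := by
  apply Units.ext
  apply fracIdeal_ext R K (Units.ne_zero _) (Units.ne_zero _)
  intro v
  rw [count_divU, coe_toPrincipalIdeal, count_principal]; rfl

theorem divU_inj {D D' : Dv R} (h : divU R K D = divU R K D') : D = D' := by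
  ext v
  rw [← count_divU R K D v, h, count_divU]

theorem divU_surj : Function.Surjective (divU R K) := by
  intro x
  refine ⟨Finsupp.ofSupportFinite (fun v => FractionalIdeal.count K v (x.toMul : (FractionalIdeal R⁰ K)ˣ)) ?_, ?_⟩
  · exact FractionalIdeal.finite_factors _
  · apply Additive.toMul.injective
    apply Units.ext
    apply fracIdeal_ext R K (Units.ne_zero _) (Units.ne_zero _)
    intro v
    rw [count_divU]; rfl

noncomputable def clH : Dv R →+ Additive (ClassGroup R) :=
  (MonoidHom.toAdditive (((ClassGroup.equiv (R := R) K).symm : _ →* ClassGroup R).comp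
    (QuotientGroup.mk' (toPrincipalIdeal R K).range))).comp (divU R K)

theorem clH_surj : Function.Surjective (clH R K) := by
  intro x
  obtain ⟨y, hy⟩ := (ClassGroup.equiv (R := R) K).symm.surjective x.toMul
  obtain ⟨z, rfl⟩ := QuotientGroup.mk'_surjective _ y
  obtain ⟨D, hD⟩ := divU_surj R K (Additive.ofMul z)
  refine ⟨D, ?_⟩
  apply Additive.toMul.injective
  rw [← hy]
  simp [clH, hD]

theorem clH_ker : (clH R K).ker = (dvH R K).range := by
  ext D
  rw [AddMonoidHom.mem_ker]
  have h1 : clH R K D = 0 ↔ (divU R K D).toMul ∈ (toPrincipalIdeal R K).range := by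
    rw [← QuotientGroup.eq_one_iff]
    constructor
    · intro h
      have h2 : (ClassGroup.equiv (R := R) K).symm (QuotientGroup.mk (divU R K D).toMul) = 1 :=
        congrArg Additive.toMul h
      simpa using h2
    · intro h
      apply Additive.toMul.injective
      change (ClassGroup.equiv (R := R) K).symm (QuotientGroup.mk (divU R K D).toMul) = 1
      rw [h, map_one]
  rw [h1]
  constructor
  · rintro ⟨x, hx⟩
    refine ⟨Additive.ofMul x, divU_inj R K ?_⟩
    apply Additive.toMul.injective
    rw [divU_dvH, hx]
  · rintro ⟨x, rfl⟩
    exact ⟨x.toMul, (divU_dvH R K x.toMul).symm⟩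

theorem card_cl3 : Nat.card {c : ClassGroup R // c ^ 3 = 1} =
    (dvH R K).range.relIndex ((dvH R K).range.comap (3 • AddMonoidHom.id (Dv R))) := by
  rw [← clH_ker, AddSubgroup.relIndex_ker]
  refine Nat.card_congr (Equiv.subtypeEquiv Additive.ofMul fun c => ?_)
  constructor
  · intro hc
    obtain ⟨D, hD⟩ := clH_surj R K (Additive.ofMul c)
    refine ⟨D, ?_, hD⟩
    change clH R K ((3 • AddMonoidHom.id (Dv R)) D) = 0
    simp only [AddMonoidHom.nsmul_apply, AddMonoidHom.id_apply, map_nsmul, hD, ← ofMul_pow, hc]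
    rfl
  · rintro ⟨D, hD, h⟩
    have h2 : clH R K ((3 • AddMonoidHom.id (Dv R)) D) = 0 := hD
    simp only [AddMonoidHom.nsmul_apply, AddMonoidHom.id_apply, map_nsmul, h, ← ofMul_pow] at h2
    exact h2

end divs
end

section
open IsDedekindDomain NumberField
set_option linter.unusedSectionVars false

section perm
variable {V : Type*}

noncomputable def permH (p : Equiv.Perm V) : (V →₀ ℤ) →+ (V →₀ ℤ) :=
  (Finsupp.domCongr p : (V →₀ ℤ) ≃+ (V →₀ ℤ)).toAddMonoidHom

theorem permH_apply (p : Equiv.Perm V) (D : V →₀ ℤ) (v : V) : permH p D v = D (p.symm v) := rfl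

theorem permH_apply' (p : Equiv.Perm V) (D : V →₀ ℤ) (v : V) : permH p D (p v) = D v := by
  rw [permH_apply, p.symm_apply_apply]

theorem permH_single (p : Equiv.Perm V) (v : V) (n : ℤ) :
    permH p (Finsupp.single v n) = Finsupp.single (p v) n := by
  classical
  ext w
  rw [permH_apply, Finsupp.single_apply, Finsupp.single_apply, Equiv.eq_symm_apply]

theorem h90_perm (p : Equiv.Perm V) (hp : ∀ v, p (p (p v)) = v) (D : V →₀ ℤ)
    (hD : nOp (permH p) D = 0) : ∃ C, D = dOp (permH p) C := by
  classical
  have hps : ∀ v, p.symm v = p (p v) := fun v => by rw [Equiv.symm_apply_eq, hp]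
  induction hn : D.support.card using Nat.strong_induction_on generalizing D with
  | _ n ih =>
  by_cases h0 : D = 0
  · exact ⟨0, by rw [h0, map_zero]⟩
  have hsum : ∀ v, D v + D (p v) + D (p (p v)) = 0 := by
    intro v
    have := DFunLike.congr_fun hD v
    rw [nOp_apply] at this
    simp only [Finsupp.add_apply, permH_apply, hps, hp, Finsupp.zero_apply] at this
    linarith
  have hu : ∃ u, D u ≠ 0 ∧ D (p u) ≠ 0 := by
    obtain ⟨v, hv⟩ := Finsupp.ne_iff.1 h0
    rw [Finsupp.zero_apply] at hv
    by_cases h1 : D (p v) = 0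
    · refine ⟨p (p v), ?_, ?_⟩
      · intro h2
        have := hsum v
        apply hv; linarith
      · rwa [hp]
    · exact ⟨v, hv, h1⟩
  obtain ⟨u, hu1, hu2⟩ := hu
  have hpu : p u ≠ u := by
    intro h
    have := hsum u
    rw [h, h] at this
    apply hu1; linarith
  set C0 : V →₀ ℤ := Finsupp.single u (D u)
  set D' := D - dOp (permH p) C0 with hD'
  have hD'a : ∀ w, D' w = D w - Finsupp.single u (D u) w + Finsupp.single (p u) (D u) w := by
    intro w
    rw [hD', dOp_apply, permH_single]
    simp only [Finsupp.sub_apply, C0]; ring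
  have hN' : nOp (permH p) D' = 0 := by
    rw [hD', map_sub, hD]
    rw [dOp_apply, map_sub, sub_eq_zero, eq_comm, sub_eq_zero]
    ext w
    simp only [nOp_apply, Finsupp.add_apply, permH_apply, hps, hp]
    ring
  have hlt : D'.support.card < n := by
    rw [← hn]
    apply Finset.card_lt_card
    rw [Finset.ssubset_iff_of_subset]
    · refine ⟨u, by simpa using hu1, ?_⟩
      simp [hD'a, hpu]
    · intro w hw
      rw [Finsupp.mem_support_iff] at hw ⊢
      intro h1
      apply hw
      have a1 : u ≠ w := by rintro rfl; exact hu1 h1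
      have a2 : p u ≠ w := by rintro rfl; exact hu2 h1
      rw [hD'a, Finsupp.single_eq_of_ne (Ne.symm a1), Finsupp.single_eq_of_ne (Ne.symm a2), h1]; simp
  obtain ⟨C, hC⟩ := ih _ hlt D' hN' rfl
  refine ⟨C + C0, ?_⟩
  rw [map_add, ← hC, hD']; abel

end perm

section act
variable {K : Type*} [Field K] [NumberField K]

noncomputable def gal (f : K ≃+* K) : Equiv.Perm (HeightOneSpectrum (𝓞 K)) :=
  HeightOneSpectrum.equivOfRingEquiv (RingOfIntegers.mapRingEquiv f)

theorem mem_gal (f : K ≃+* K) (w : HeightOneSpectrum (𝓞 K)) (x y : 𝓞 K) (h : (y : K) = f x) :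
    y ∈ (gal f w).asIdeal ↔ x ∈ w.asIdeal := by
  have : y = RingOfIntegers.mapRingEquiv f x := by ext; rw [h]; rfl
  rw [this]
  change (RingOfIntegers.mapRingEquiv f).symm _ ∈ w.asIdeal ↔ _
  rw [RingEquiv.symm_apply_apply]

noncomputable def unitH (f : K ≃+* K) : Additive Kˣ →+ Additive Kˣ :=
  MonoidHom.toAdditive (Units.map ((f : K →+* K) : K →* K))

theorem unitH_coe (f : K ≃+* K) (x : Additive Kˣ) :
    ((unitH f x).toMul : K) = f (x.toMul : K) := rfl

theorem ordZ_gal (f : K ≃+* K) (w : HeightOneSpectrum (𝓞 K)) (x : Kˣ) :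
    ordZ (gal f w) (Units.map ((f : K →+* K) : K →* K) x) = ordZ w x :=
  ordZ_equiv f (RingOfIntegers.mapRingEquiv f) (fun r => rfl) w x

theorem dvH_gal (f : K ≃+* K) (x : Additive Kˣ) :
    dvH (𝓞 K) K (unitH f x) = permH (gal f) (dvH (𝓞 K) K x) := by
  ext w
  rw [permH_apply, dvH_apply, dvH_apply, ← ordZ_gal f ((gal f).symm w), Equiv.apply_symm_apply]
  rfl

theorem gal_eq (f g : K ≃+* K) (h : ∀ x, f x = g x) : gal f = gal g := by
  rw [RingEquiv.ext h]

theorem gal_comp (f g : K ≃+* K) (w) : gal f (gal g w) = gal (g.trans f) w := by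
  ext y
  obtain ⟨x, hx⟩ := (RingOfIntegers.mapRingEquiv (g.trans f)).surjective y
  obtain ⟨x', hx'⟩ : ∃ x' : 𝓞 K, x' = RingOfIntegers.mapRingEquiv g x := ⟨_, rfl⟩
  rw [mem_gal (g.trans f) w x y (by rw [← hx]; rfl), mem_gal f _ x' y (by rw [← hx, hx']; rfl),
    mem_gal g w x x' (by rw [hx']; rfl)]

theorem gal_refl (w) : gal (RingEquiv.refl K) w = w := by
  ext y
  rw [mem_gal (RingEquiv.refl K) w y y rfl]

end act
end

section
open IsDedekindDomain NumberField
set_option linter.unusedSectionVars false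

section crt
variable {R : Type*} [CommRing R] [IsDedekindDomain R] {K : Type*} [Field K]
  [Algebra R K] [IsFractionRing R K]

theorem crt_places (S : Finset (HeightOneSpectrum R)) (x : HeightOneSpectrum R → R) :
    ∃ y, ∀ w ∈ S, y - x w ∈ w.asIdeal ^ 2 :=
  IsDedekindDomain.exists_forall_sub_mem_ideal (fun w : HeightOneSpectrum R => w.asIdeal)
    (fun _ => 2) (fun w _ => w.prime) (fun w _ w' _ h h' => h (HeightOneSpectrum.ext h'))
    (fun w => x w)

theorem ordZ_pow_mem (v : HeightOneSpectrum R) (x : Kˣ) (r : R) (h : (x : K) = algebraMap R K r)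
    (n : ℕ) : (n : ℤ) ≤ ordZ v x ↔ r ∈ v.asIdeal ^ n := by
  have e : v.valuation K (x : K) = v.intValuation r := by rw [h, v.valuation_of_algebraMap]
  rw [← v.intValuation_le_pow_iff_mem, ← e, valuation_eq_ordZ, WithZero.exp_le_exp]
  omega

theorem exists_int_unif (v : HeightOneSpectrum R) : ∃ p : R, p ∈ v.asIdeal ∧ p ∉ v.asIdeal ^ 2 := by
  obtain ⟨p, hp⟩ := v.intValuation_exists_uniformizer
  refine ⟨p, ?_, ?_⟩
  · rw [← pow_one v.asIdeal, ← v.intValuation_le_pow_iff_mem, hp]; simp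
  · rw [← v.intValuation_le_pow_iff_mem, hp, WithZero.exp_le_exp]; simp

theorem ordZ_eq_one_of (v : HeightOneSpectrum R) (x : Kˣ) (r p : R) (h : (x : K) = algebraMap R K r)
    (hp : p ∈ v.asIdeal) (hp2 : p ∉ v.asIdeal ^ 2) (hr : r - p ∈ v.asIdeal ^ 2) : ordZ v x = 1 := by
  have h1 := ordZ_pow_mem v x r h 1
  have h2 := ordZ_pow_mem v x r h 2
  have h3 : r ∈ v.asIdeal ^ 1 := by
    rw [pow_one]
    have : r = (r - p) + p := by ring
    rw [this]
    exact add_mem (Ideal.pow_le_self two_ne_zero hr) hp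
  have h4 : ¬ r ∈ v.asIdeal ^ 2 := by
    intro h
    apply hp2
    have := sub_mem h hr
    simpa using this
  have h5 := h1.2 h3
  have h6 := mt h2.1 h4
  push_cast at *
  omega

theorem ordZ_add_lt (v : HeightOneSpectrum R) (x y z : Kˣ) (h : (z : K) = x + y)
    (hlt : ordZ v x < ordZ v y) : ordZ v z = ordZ v x := by
  have h1 := ordZ_add v x y z h
  have h2 := ordZ_add v z (-y) x (by rw [h]; simp)
  rw [ordZ_neg] at h2
  omega
end crt

structure CubicData (F K : Type*) [Field F] [NumberField F] [Field K] [NumberField K]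
    [Algebra F K] where
  z : F
  hz : IsPrimitiveRoot z 3
  m : ℕ
  α : K
  hα : α ^ 3 = m
  hα0 : α ≠ 0
  rep : ∀ x : K, ∃ a b c : F, x = algebraMap F K a + algebraMap F K b * α + algebraMap F K c * α ^ 2
  σ : K ≃ₐ[F] K
  hσ : σ α = algebraMap F K z * α
  τ : K ≃+* K
  hτz : τ (algebraMap F K z) = algebraMap F K z ^ 2
  hτα : τ α = α

namespace CubicData
variable {F K : Type*} [Field F] [NumberField F] [Field K] [NumberField K] [Algebra F K]
  (C : CubicData F K)

theorem z3 : C.z ^ 3 = 1 := C.hz.pow_eq_one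
theorem zsum : 1 + C.z + C.z ^ 2 = 0 := by
  have := C.hz.geom_sum_eq_zero (by norm_num)
  simpa [Finset.sum_range_succ] using this

theorem zsumK : 1 + algebraMap F K C.z + algebraMap F K C.z ^ 2 = 0 := by
  rw [← map_pow, ← map_one (algebraMap F K), ← map_add, ← map_add, C.zsum, map_zero]

theorem zK3 : algebraMap F K C.z ^ 3 = 1 := by
  rw [← map_pow, C.z3, map_one]

theorem σrep (a b c : F) : C.σ (algebraMap F K a + algebraMap F K b * C.α + algebraMap F K c * C.α ^ 2)
    = algebraMap F K a + algebraMap F K b * (algebraMap F K C.z * C.α)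
      + algebraMap F K c * (algebraMap F K C.z * C.α) ^ 2 := by
  simp [C.hσ]

theorem σ3 (x : K) : C.σ (C.σ (C.σ x)) = x := by
  obtain ⟨a, b, c, rfl⟩ := C.rep x
  have := C.zK3
  simp only [map_add, map_mul, map_pow, AlgEquiv.commutes, C.hσ]
  linear_combination (algebraMap F K b * C.α + (algebraMap F K C.z ^ 3 + 1) * algebraMap F K c * C.α ^ 2) * this

theorem tr_mem (x : K) : ∃ a : F, algebraMap F K a = x + C.σ x + C.σ (C.σ x) := by
  obtain ⟨a, b, c, rfl⟩ := C.rep x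
  refine ⟨3 * a, ?_⟩
  have h := C.zK3
  have h' := C.zsumK
  simp only [map_add, map_mul, map_pow, AlgEquiv.commutes, C.hσ, map_ofNat]
  linear_combination (- algebraMap F K b * C.α - (algebraMap F K C.z ^ 2 - algebraMap F K C.z + 1) * algebraMap F K c * C.α ^ 2) * h'

theorem fixed_mem {x : K} (h : C.σ x = x) : ∃ a : F, algebraMap F K a = x := by
  obtain ⟨a, ha⟩ := C.tr_mem x
  refine ⟨a / 3, ?_⟩
  rw [h, h] at ha
  rw [map_div₀, ha, map_ofNat]
  field_simp; ring

theorem nm_mem (x : K) : ∃ a : F, algebraMap F K a = x * C.σ x * C.σ (C.σ x) := by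
  apply C.fixed_mem
  rw [map_mul, map_mul, C.σ3]; ring

noncomputable def s : Equiv.Perm (HeightOneSpectrum (𝓞 K)) := gal (C.σ : K ≃+* K)
noncomputable def t : Equiv.Perm (HeightOneSpectrum (𝓞 K)) := gal C.τ

theorem s3 (w) : C.s (C.s (C.s w)) = w := by
  unfold s
  rw [gal_comp, gal_comp]
  rw [gal_eq _ (RingEquiv.refl K) (fun x => ?_), gal_refl]
  exact C.σ3 x

theorem ssymm (w) : C.s.symm w = C.s (C.s w) := by
  rw [Equiv.symm_apply_eq, s3]

end CubicData

section under
variable {F K : Type*} [Field F] [NumberField F] [Field K] [NumberField K] [Algebra F K]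

noncomputable def und (F : Type*) {K : Type*} [Field F] [NumberField F] [Field K] [NumberField K]
    [Algebra F K] (w : HeightOneSpectrum (𝓞 K)) : HeightOneSpectrum (𝓞 F) where
  asIdeal := w.asIdeal.comap (algebraMap (𝓞 F) (𝓞 K))
  isPrime := Ideal.comap_isPrime _ _
  ne_bot := fun h => w.ne_bot (Ideal.eq_bot_of_comap_eq_bot h)

theorem mem_und (w : HeightOneSpectrum (𝓞 K)) (x : 𝓞 F) :
    x ∈ (und F w).asIdeal ↔ algebraMap (𝓞 F) (𝓞 K) x ∈ w.asIdeal := Iff.rfl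

theorem exists_ram (w : HeightOneSpectrum (𝓞 K)) :
    ∃ e : ℤ, 0 < e ∧ ∀ x : Fˣ, ordZ w (Units.map (algebraMap F K : F →* K) x) = e * ordZ (und F w) x :=
  ordZ_transfer (algebraMap F K) (algebraMap (𝓞 F) (𝓞 K)) (fun _ => rfl) _ w (fun _ => Iff.rfl)

noncomputable def ram (F : Type*) {K : Type*} [Field F] [NumberField F] [Field K] [NumberField K]
    [Algebra F K] (w : HeightOneSpectrum (𝓞 K)) : ℤ := (exists_ram (F := F) w).choose

theorem ram_pos (w : HeightOneSpectrum (𝓞 K)) : 0 < ram F w := (exists_ram (F := F) w).choose_spec.1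
theorem ordZ_ram (w : HeightOneSpectrum (𝓞 K)) (x : Fˣ) :
    ordZ w (Units.map (algebraMap F K : F →* K) x) = ram F w * ordZ (und F w) x :=
  (exists_ram (F := F) w).choose_spec.2 x

theorem exists_over (v : HeightOneSpectrum (𝓞 F)) : ∃ w : HeightOneSpectrum (𝓞 K), und F w = v := by
  obtain ⟨Q, -, hQ, h⟩ := Ideal.exists_ideal_over_prime_of_isIntegral (S := 𝓞 K) v.asIdeal ⊥ (by
    rw [← RingHom.ker_eq_comap_bot, (RingHom.injective_iff_ker_eq_bot _).1
      (FaithfulSMul.algebraMap_injective (𝓞 F) (𝓞 K))]; exact bot_le)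
  refine ⟨⟨Q, hQ, ?_⟩, ?_⟩
  · rintro rfl
    apply v.ne_bot
    rw [← h, ← RingHom.ker_eq_comap_bot, (RingHom.injective_iff_ker_eq_bot _).1
      (FaithfulSMul.algebraMap_injective (𝓞 F) (𝓞 K))]
  · exact HeightOneSpectrum.ext h

end under
end

section
open IsDedekindDomain NumberField
set_option linter.unusedSectionVars false

namespace CubicData
variable {F K : Type*} [Field F] [NumberField F] [Field K] [NumberField K] [Algebra F K]
  (C : CubicData F K)

abbrev Fm (F K : Type*) [Field F] [Field K] [Algebra F K] : Fˣ →* Kˣ :=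
  Units.map (algebraMap F K : F →* K)

/-- sigma on units -/
noncomputable abbrev sg : Kˣ →* Kˣ := Units.map (((C.σ : K ≃+* K) : K →+* K) : K →* K)

theorem und_s (w) : und F (C.s w) = und F w := by
  ext x
  rw [mem_und, mem_und]
  exact mem_gal _ w _ _ (C.σ.commutes _).symm

theorem ordZ_s (w) (x : Kˣ) : ordZ (C.s w) (C.sg x) = ordZ w x := ordZ_gal _ w x

theorem sg_Fm (x : Fˣ) : C.sg (Fm F K x) = Fm F K x := by
  ext; exact C.σ.commutes _

theorem ram_s (w) : ram F (C.s w) = ram F w := by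
  obtain ⟨π, hπ⟩ := exists_unif (K := F) (und F w)
  have h1 := C.ordZ_s w (Fm F K π)
  rw [sg_Fm, ordZ_ram, ordZ_ram, und_s, hπ] at h1
  linarith

theorem nmU (x : Kˣ) : ∃ a : Fˣ, Fm F K a = x * C.sg x * C.sg (C.sg x) := by
  obtain ⟨a, ha⟩ := C.nm_mem x
  have h0 : a ≠ 0 := by
    rintro rfl
    rw [map_zero] at ha
    have := (x * C.sg x * C.sg (C.sg x)).ne_zero
    exact this ha.symm
  exact ⟨Units.mk0 a h0, by ext; exact ha⟩

theorem ram_dvd (w) (x : Kˣ) : ram F w ∣ ordZ w x + ordZ (C.s w) x + ordZ (C.s (C.s w)) x := by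
  obtain ⟨a, ha⟩ := C.nmU x
  have h := ordZ_ram w a
  rw [ha, ordZ_mul, ordZ_mul] at h
  have h1 := C.ordZ_s (C.s (C.s w)) x
  have h2 := C.ordZ_s (C.s w) (C.sg x)
  rw [s3] at h1
  rw [ordZ_s] at h2
  have h2' := C.ordZ_s (C.s (C.s w)) (C.sg x)
  rw [s3] at h2'
  have h3 := C.ordZ_s (C.s w) x
  exact ⟨_, by rw [← h, h1, h2', h3]; ring⟩

theorem ram_fixed (w) (h : C.s w = w) : ram F w = 1 ∨ ram F w = 3 := by
  obtain ⟨π, hπ⟩ := exists_unif (K := K) w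
  have h1 := C.ram_dvd w π
  rw [h, h, hπ] at h1
  have h2 := ram_pos (F := F) w
  have h3 := Int.le_of_dvd (by norm_num) h1
  generalize ram F w = e at *
  interval_cases e <;> simp_all

theorem s_s_ne (w) (h : C.s w ≠ w) : C.s (C.s w) ≠ w ∧ C.s (C.s w) ≠ C.s w := by
  refine ⟨fun h1 => h ?_, fun h1 => h (C.s.injective h1)⟩
  have := C.s3 w
  rw [h1] at this; exact this

theorem exists_U (y : 𝓞 K) (h : y ≠ 0) : ∃ u : Kˣ, (u : K) = algebraMap (𝓞 K) K y :=
  ⟨Units.mk0 (algebraMap (𝓞 K) K y) (by rwa [Ne, FaithfulSMul.algebraMap_eq_zero_iff]), rfl⟩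

theorem ram_nonfixed (w) (h : C.s w ≠ w) : ram F w = 1 := by
  classical
  obtain ⟨h1, h2⟩ := C.s_s_ne w h
  obtain ⟨p, hp, hp2⟩ := exists_int_unif w
  obtain ⟨y, hy⟩ := crt_places {w, C.s w, C.s (C.s w)} (fun v => if v = w then p else 1)
  have y1 := hy w (by simp)
  have y2 := hy (C.s w) (by simp)
  have y3 := hy (C.s (C.s w)) (by simp)
  simp only [if_true, h, h1, if_false] at y1 y2 y3
  have nm : ∀ v : HeightOneSpectrum (𝓞 K), y - 1 ∈ v.asIdeal ^ 2 → y ∉ v.asIdeal := by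
    intro v hv hy
    have := sub_mem hy (Ideal.pow_le_self two_ne_zero hv)
    rw [sub_sub_cancel] at this
    exact v.isPrime.ne_top ((Ideal.eq_top_iff_one _).2 this)
  have y0 : y ≠ 0 := by
    rintro rfl; exact nm _ y2 (zero_mem _)
  obtain ⟨u, hu⟩ := exists_U y y0
  have := C.ram_dvd w u
  rw [ordZ_eq_one_of w u y p hu hp hp2 y1, (ordZ_alg_eq_zero _ u y hu).2 (nm _ y2),
    (ordZ_alg_eq_zero _ u y hu).2 (nm _ y3)] at this
  exact Int.eq_one_of_dvd_one (ram_pos w).le (by simpa using this)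

theorem ram_13 (C : CubicData F K) (w : HeightOneSpectrum (𝓞 K)) : ram F w = 1 ∨ ram F w = 3 := by
  by_cases h : C.s w = w
  · exact C.ram_fixed w h
  · exact Or.inl (C.ram_nonfixed w h)

theorem fixed_of_ram (w : HeightOneSpectrum (𝓞 K)) (h : ram F w = 3) : C.s w = w := by
  by_contra h1
  rw [C.ram_nonfixed w h1] at h
  norm_num at h

noncomputable def sI (x : 𝓞 K) : 𝓞 K := RingOfIntegers.mapRingEquiv (C.σ : K ≃+* K) x

theorem mem_s (w) (x : 𝓞 K) : C.sI x ∈ (C.s w).asIdeal ↔ x ∈ w.asIdeal :=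
  mem_gal _ w _ _ rfl

theorem int_of_F (a : F) (y : 𝓞 K) (h : algebraMap F K a = y) : ∃ c : 𝓞 F, algebraMap (𝓞 F) (𝓞 K) c = y := by
  have h1 : IsIntegral ℤ a := by
    have : IsIntegral ℤ (algebraMap F K a) := by rw [h]; exact y.2
    exact (isIntegral_algebraMap_iff (algebraMap F K).injective).1 this
  refine ⟨⟨a, h1⟩, ?_⟩
  ext; exact h

theorem trans_over (w w') (h : und F w = und F w') : w' = w ∨ w' = C.s w ∨ w' = C.s (C.s w) := by
  classical
  by_contra hc
  push Not at hc
  obtain ⟨c1, c2, c3⟩ := hc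
  obtain ⟨y, hy⟩ := crt_places {w', w, C.s w, C.s (C.s w)} (fun v => if v = w' then 0 else 1)
  have y0 := hy w' (by simp)
  have y1 := hy w (by simp)
  have y2 := hy (C.s w) (by simp)
  have y3 := hy (C.s (C.s w)) (by simp)
  simp only [if_true, c1.symm, c2.symm, c3.symm, if_false, sub_zero] at y0 y1 y2 y3
  have nm : ∀ v : HeightOneSpectrum (𝓞 K), y - 1 ∈ v.asIdeal ^ 2 → y ∉ v.asIdeal := by
    intro v hv hy
    have := sub_mem hy (Ideal.pow_le_self two_ne_zero hv)
    rw [sub_sub_cancel] at this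
    exact v.isPrime.ne_top ((Ideal.eq_top_iff_one _).2 this)
  obtain ⟨a, ha⟩ := C.nm_mem y
  obtain ⟨c, hc⟩ := int_of_F a (y * C.sI y * C.sI (C.sI y)) (by rw [ha]; rfl)
  have hcv : c ∈ (und F w').asIdeal := by
    rw [mem_und, hc]
    exact Ideal.mul_mem_right _ _ (Ideal.mul_mem_right _ _ (Ideal.pow_le_self two_ne_zero y0))
  rw [← h, mem_und, hc] at hcv
  rcases w.isPrime.mem_or_mem hcv with h1 | h1
  · rcases w.isPrime.mem_or_mem h1 with h1 | h1
    · exact nm _ y1 h1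
    · rw [← C.s3 w, mem_s] at h1
      exact nm _ y3 h1
  · rw [← C.s3 w, mem_s, mem_s] at h1
    exact nm _ y2 h1

theorem residue_nonfixed (w) (h : C.s w ≠ w) (β : 𝓞 K) :
    ∃ c : 𝓞 F, algebraMap (𝓞 F) (𝓞 K) c - β ∈ w.asIdeal := by
  classical
  obtain ⟨h1, h2⟩ := C.s_s_ne w h
  obtain ⟨y, hy⟩ := crt_places {w, C.s w, C.s (C.s w)} (fun v => if v = w then β else 0)
  have y1 := hy w (by simp)
  have y2 := hy (C.s w) (by simp)
  have y3 := hy (C.s (C.s w)) (by simp)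
  simp only [if_true, h, h1, if_false, sub_zero] at y1 y2 y3
  obtain ⟨a, ha⟩ := C.tr_mem y
  obtain ⟨c, hc⟩ := int_of_F a (y + C.sI y + C.sI (C.sI y)) (by rw [ha]; rfl)
  refine ⟨c, ?_⟩
  have e : algebraMap (𝓞 F) (𝓞 K) c - β = (y - β) + C.sI y + C.sI (C.sI y) := by rw [hc]; ring
  rw [e]
  refine add_mem (add_mem (Ideal.pow_le_self two_ne_zero y1) ?_) ?_
  · rw [← C.s3 w, mem_s]; exact Ideal.pow_le_self two_ne_zero y3
  · rw [← C.s3 w, mem_s, mem_s]; exact Ideal.pow_le_self two_ne_zero y2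

theorem D_fixed_iff (D : Dv (𝓞 K)) : permH C.s D = D ↔ ∀ w, D (C.s w) = D w := by
  constructor
  · intro h w
    conv_lhs => rw [← h]
    exact permH_apply' _ _ _
  · intro h
    ext w
    rw [permH_apply, ← h, Equiv.apply_symm_apply]

theorem pid_dv [IsPrincipalIdealRing (𝓞 F)] (D : Dv (𝓞 F)) : ∃ f : Fˣ, ∀ v, ordZ v f = D v := by
  have h : D ∈ (clH (𝓞 F) F).ker := by
    rw [AddMonoidHom.mem_ker]; exact Subsingleton.elim _ _
  rw [clH_ker] at h
  obtain ⟨f, rfl⟩ := h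
  exact ⟨f.toMul, fun v => rfl⟩

theorem descend [IsPrincipalIdealRing (𝓞 F)] (D : Dv (𝓞 K)) (h1 : ∀ w, D (C.s w) = D w)
    (h2 : ∀ w, ram F w = 3 → 3 ∣ D w) : ∃ f : Fˣ, dvH (𝓞 K) K (Additive.ofMul (Fm F K f)) = D := by
  classical
  let g : HeightOneSpectrum (𝓞 F) → HeightOneSpectrum (𝓞 K) := fun v => (exists_over v).choose
  have hg : ∀ v, und F (g v) = v := fun v => (exists_over v).choose_spec
  have hinv : ∀ w w', und F w = und F w' → D w' = D w ∧ ram F w' = ram F w := by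
    intro w w' h
    rcases C.trans_over w w' h with rfl | rfl | rfl
    · exact ⟨rfl, rfl⟩
    · exact ⟨h1 _, C.ram_s _⟩
    · exact ⟨by rw [h1, h1], by rw [ram_s, ram_s]⟩
  have hfin : (Function.support fun v => D (g v) / ram F (g v)).Finite := by
    refine (D.support.finite_toSet.image (und F)).subset ?_
    intro v hv
    refine ⟨g v, ?_, hg v⟩
    simp only [Finset.mem_coe, Finsupp.mem_support_iff]
    intro h0
    apply hv
    simp [h0]
  obtain ⟨f, hf⟩ := pid_dv (Finsupp.ofSupportFinite _ hfin)
  refine ⟨f, ?_⟩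
  ext w
  rw [dvH_apply]
  change ordZ w (Fm F K f) = D w
  rw [ordZ_ram, hf]
  change ram F w * (D (g (und F w)) / ram F (g (und F w))) = D w
  obtain ⟨e1, e2⟩ := hinv w (g (und F w)) (hg _).symm
  rw [e1, e2]
  apply Int.mul_ediv_cancel'
  rcases C.ram_13 w with h | h
  · rw [h]; exact one_dvd _
  · rw [h]; exact h2 w h

end CubicData
end

section
open IsDedekindDomain NumberField
set_option linter.unusedSectionVars false

theorem int_corner (n X Y : ℤ) (hX : 0 ≤ X) (hXn : X < n) (hY : 0 ≤ Y) (hYn : Y < n) :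
    ∃ i j : ℤ, 3 * ((X - n * i) ^ 2 - (X - n * i) * (Y - n * j) + (Y - n * j) ^ 2) ≤ n ^ 2 := by
  have key : ∀ w0 w1 w2 f0 f1 f2 : ℤ, 0 ≤ w0 → 0 ≤ w1 → 0 ≤ w2 → w0 + w1 + w2 = n →
      w0 * f0 + w1 * f1 + w2 * f2 = n * (w0 * w1 + w0 * w2 + w1 * w2) →
      3 * f0 ≤ n ^ 2 ∨ 3 * f1 ≤ n ^ 2 ∨ 3 * f2 ≤ n ^ 2 := by
    intro w0 w1 w2 f0 f1 f2 h0 h1 h2 hs he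
    by_contra hc
    push Not at hc
    obtain ⟨c0, c1, c2⟩ := hc
    have hn : 0 < n := by omega
    have e1 : w0 * (3 * f0 - n ^ 2 - 1) ≥ 0 := mul_nonneg h0 (by omega)
    have e2 : w1 * (3 * f1 - n ^ 2 - 1) ≥ 0 := mul_nonneg h1 (by omega)
    have e3 : w2 * (3 * f2 - n ^ 2 - 1) ≥ 0 := mul_nonneg h2 (by omega)
    have e4 : 3 * (w0 * w1 + w0 * w2 + w1 * w2) ≤ n ^ 2 := by
      rw [← hs]; nlinarith [sq_nonneg (w0 - w1), sq_nonneg (w0 - w2), sq_nonneg (w1 - w2)]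
    have e5 : n * (3 * (w0 * w1 + w0 * w2 + w1 * w2)) ≤ n * n ^ 2 :=
      mul_le_mul_of_nonneg_left e4 hn.le
    have e6 : w0 * (n ^ 2 + 1) + w1 * (n ^ 2 + 1) + w2 * (n ^ 2 + 1) = n * n ^ 2 + n := by
      rw [← hs]; ring
    linarith
  rcases le_total Y X with h | h
  · rcases key (n - X) (X - Y) Y _ _ _ (by omega) (by omega) hY (by ring)
      (show (n - X) * ((X - n * 0) ^ 2 - (X - n * 0) * (Y - n * 0) + (Y - n * 0) ^ 2) +
        (X - Y) * ((X - n * 1) ^ 2 - (X - n * 1) * (Y - n * 0) + (Y - n * 0) ^ 2) +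
        Y * ((X - n * 1) ^ 2 - (X - n * 1) * (Y - n * 1) + (Y - n * 1) ^ 2) = _ by ring) with h | h | h
    exacts [⟨_, _, h⟩, ⟨_, _, h⟩, ⟨_, _, h⟩]
  · rcases key (n - Y) (Y - X) X _ _ _ (by omega) (by omega) hX (by ring)
      (show (n - Y) * ((X - n * 0) ^ 2 - (X - n * 0) * (Y - n * 0) + (Y - n * 0) ^ 2) +
        (Y - X) * ((X - n * 0) ^ 2 - (X - n * 0) * (Y - n * 1) + (Y - n * 1) ^ 2) +
        X * ((X - n * 1) ^ 2 - (X - n * 1) * (Y - n * 1) + (Y - n * 1) ^ 2) = _ by ring) with h | h | h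
    exacts [⟨_, _, h⟩, ⟨_, _, h⟩, ⟨_, _, h⟩]

section eis
variable {F : Type*} [Field F] [NumberField F] [IsCyclotomicExtension {3} ℚ F] {z : F}
  (hz : IsPrimitiveRoot z 3)

theorem eis_rel : hz.toInteger ^ 2 = - 1 - hz.toInteger := by
  have h := hz.toInteger_isPrimitiveRoot.geom_sum_eq_zero (by norm_num)
  simp only [Finset.sum_range_succ, Finset.sum_range_zero] at h
  linear_combination h

theorem eis_rep (x : 𝓞 F) : ∃ a b : ℤ, x = a + b * hz.toInteger := by
  haveI : IsCyclotomicExtension {3 ^ 1} ℚ F := by simpa using ‹IsCyclotomicExtension {3} ℚ F›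
  have hz' : IsPrimitiveRoot z (3 ^ 1) := by simpa using hz
  haveI : Fact (Nat.Prime 3) := ⟨Nat.prime_three⟩
  have h1 := hz'.integralPowerBasisOfPrimePow.adjoin_gen_eq_top
  rw [hz'.integralPowerBasisOfPrimePow_gen] at h1
  have hx : x ∈ Algebra.adjoin ℤ {hz'.toInteger} := by rw [h1]; trivial
  have e : hz'.toInteger = hz.toInteger := rfl
  rw [e] at hx
  have hr := eis_rel hz
  induction hx using Algebra.adjoin_induction with
  | mem x hx => rw [Set.mem_singleton_iff] at hx; exact ⟨0, 1, by rw [hx]; simp⟩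
  | algebraMap r => exact ⟨r, 0, by simp⟩
  | add x y _ _ hx hy =>
    obtain ⟨a, b, rfl⟩ := hx
    obtain ⟨c, d, rfl⟩ := hy
    exact ⟨a + c, b + d, by push_cast; ring⟩
  | mul x y _ _ hx hy =>
    obtain ⟨a, b, rfl⟩ := hx
    obtain ⟨c, d, rfl⟩ := hy
    refine ⟨a * c - b * d, a * d + b * c - b * d, ?_⟩
    push_cast
    linear_combination (b * d : 𝓞 F) * hr

noncomputable def eisφ (F : Type*) [Field F] [NumberField F] : 𝓞 F →+* ℂ :=
  (Classical.arbitrary (F →+* ℂ)).comp (algebraMap (𝓞 F) F)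

theorem eisφ_norm (a b : ℤ) : ‖eisφ F (a + b * hz.toInteger)‖ ^ 2 = ((a ^ 2 - a * b + b ^ 2 : ℤ) : ℝ) := by
  have hr := congrArg (eisφ F) (eis_rel hz)
  simp only [map_pow, map_sub, map_neg, map_one] at hr
  rw [map_add, map_mul, map_intCast, map_intCast]
  set c := eisφ F hz.toInteger
  have h1 := congrArg Complex.re hr
  have h2 := congrArg Complex.im hr
  simp [pow_two] at h1 h2
  have him : c.im ≠ 0 := by
    intro h
    rw [h] at h1
    nlinarith [sq_nonneg (c.re + 1 / 2)]
  have hre : c.re = -1 / 2 := by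
    have : c.im * (2 * c.re + 1) = 0 := by linarith
    rcases mul_eq_zero.1 this with h | h
    · exact absurd h him
    · linarith
  have him2 : c.im * c.im = 3 / 4 := by rw [hre] at h1; linarith
  rw [Complex.sq_norm, Complex.normSq_apply]
  simp
  rw [hre]
  linear_combination (b : ℝ) ^ 2 * him2

theorem form_nonneg (a b : ℤ) : 0 ≤ a ^ 2 - a * b + b ^ 2 := by
  nlinarith [sq_nonneg (a - b), sq_nonneg a, sq_nonneg b]

theorem form_mod (a b : ℤ) : (a ^ 2 - a * b + b ^ 2) % 3 = 0 ∨ (a ^ 2 - a * b + b ^ 2) % 3 = 1 := by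
  have ha : a % 3 = 0 ∨ a % 3 = 1 ∨ a % 3 = 2 := by omega
  have hb : b % 3 = 0 ∨ b % 3 = 1 ∨ b % 3 = 2 := by omega
  rcases ha with h | h | h <;> rcases hb with h' | h' | h' <;>
    simp [Int.add_emod, Int.sub_emod, pow_two, Int.mul_emod, h, h']

noncomputable def eisN (x : 𝓞 F) : ℕ := ⌊‖eisφ F x‖ ^ 2⌋₊

theorem eisN_eq (a b : ℤ) : (eisN ((a : 𝓞 F) + (b : 𝓞 F) * hz.toInteger) : ℤ) = a ^ 2 - a * b + b ^ 2 := by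
  obtain ⟨n, hn⟩ := Int.eq_ofNat_of_zero_le (form_nonneg a b)
  rw [eisN, eisφ_norm hz, hn]
  simp

theorem eisN_norm (hz : IsPrimitiveRoot z 3) (x : 𝓞 F) : ‖eisφ F x‖ ^ 2 = (eisN x : ℝ) := by
  obtain ⟨a, b, rfl⟩ := eis_rep hz x
  rw [eisφ_norm, ← eisN_eq hz]; simp

theorem eisN_mul (hz : IsPrimitiveRoot z 3) (x y : 𝓞 F) : eisN (x * y) = eisN x * eisN y := by
  have := eisN_norm hz (x * y)
  rw [map_mul, norm_mul, mul_pow, eisN_norm hz, eisN_norm hz] at this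
  exact_mod_cast this.symm

theorem eisN_conj (a b : ℤ) : ((a : 𝓞 F) + b * hz.toInteger) * ((a - b : ℤ) + (-b : ℤ) * hz.toInteger)
    = ((a ^ 2 - a * b + b ^ 2 : ℤ) : 𝓞 F) := by
  push_cast
  linear_combination (- (b : 𝓞 F) ^ 2) * eis_rel hz

theorem eisN_zero (hz : IsPrimitiveRoot z 3) (x : 𝓞 F) (h : eisN x = 0) : x = 0 := by
  have := eisN_norm hz x
  rw [h] at this
  have h2 : eisφ F x = 0 := by simpa using this
  have h3 : Function.Injective (eisφ F) := by
    show Function.Injective ((Classical.arbitrary (F →+* ℂ)) ∘ (algebraMap (𝓞 F) F))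
    exact (RingHom.injective (Classical.arbitrary (F →+* ℂ))).comp
      (FaithfulSMul.algebraMap_injective (𝓞 F) F)
  exact (map_eq_zero_iff _ h3).1 h2

theorem form_bound (a b n : ℤ) (h : a ^ 2 - a * b + b ^ 2 ≤ n) : |a| ≤ 2 * n ∧ |b| ≤ 2 * n := by
  have h1 : 3 * a ^ 2 ≤ 4 * n := by nlinarith [sq_nonneg (a - 2 * b)]
  have h2 : 3 * b ^ 2 ≤ 4 * n := by nlinarith [sq_nonneg (2 * a - b)]
  constructor
  · rw [abs_le]; constructor <;> nlinarith
  · rw [abs_le]; constructor <;> nlinarith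

noncomputable def eisE (hz : IsPrimitiveRoot z 3) : EuclidData (𝓞 F) where
  φ := eisφ F
  nm := eisN
  hnm := eisN_norm hz
  h0 := eisN_zero hz
  h1 x h := by
    obtain ⟨a, b, rfl⟩ := eis_rep hz x
    have h1 := eisN_eq hz a b
    rw [h] at h1
    refine IsUnit.of_mul_eq_one _ ((eisN_conj hz a b).trans ?_)
    rw [← h1]; simp
  h2 x h := by
    obtain ⟨a, b, rfl⟩ := eis_rep hz x
    have h1 := eisN_eq hz a b
    rw [h] at h1
    have := form_mod a b
    rw [← h1] at this
    simp at this
  hdiv x y hy := by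
    obtain ⟨c, d, rfl⟩ := eis_rep hz y
    set y := (c : 𝓞 F) + d * hz.toInteger with hydef
    set n := c ^ 2 - c * d + d ^ 2 with hn
    set y' : 𝓞 F := ((c - d : ℤ) + (-d : ℤ) * hz.toInteger) with hy'
    have hyy : y * y' = (n : 𝓞 F) := eisN_conj hz c d
    have hNy : (eisN y : ℤ) = n := eisN_eq hz c d
    have hn0 : 0 < n := by
      rcases (form_nonneg c d).lt_or_eq with h | h
      · exact h
      · exact absurd (eisN_zero hz y (by have := hNy.trans h.symm; exact_mod_cast this)) hy
    have hNy' : (eisN y' : ℤ) = n := by rw [hy', eisN_eq]; rw [hn]; ring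
    obtain ⟨A, B, hAB⟩ := eis_rep hz (x * y')
    obtain ⟨i, j, hij⟩ := int_corner n (A % n) (B % n) (Int.emod_nonneg _ hn0.ne')
      (Int.emod_lt_of_pos _ hn0) (Int.emod_nonneg _ hn0.ne') (Int.emod_lt_of_pos _ hn0)
    have eA : A % n - n * i = A - n * (A / n + i) := by rw [Int.emod_def]; ring
    have eB : B % n - n * j = B - n * (B / n + j) := by rw [Int.emod_def]; ring
    rw [eA, eB] at hij
    set k := A / n + i
    set l := B / n + j
    refine ⟨x - y * (k + l * hz.toInteger), ⟨(k + l * hz.toInteger), by ring⟩, ?_⟩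
    set r := x - y * (k + l * hz.toInteger) with hr
    have e1 : r * y' = ((A - n * k : ℤ) : 𝓞 F) + (B - n * l : ℤ) * hz.toInteger := by
      rw [hr, sub_mul, hAB]
      push_cast
      linear_combination (- (k + l * hz.toInteger)) * hyy
    have e2 := eisN_mul hz r y'
    have e3 := eisN_eq hz (A - n * k) (B - n * l)
    rw [← e1, e2] at e3
    push_cast at e3
    rw [← e3, hNy'] at hij
    have : 3 * (eisN r : ℤ) ≤ n := by nlinarith
    rw [← hNy] at this
    exact_mod_cast this
  hfin n := by
    have hf : (⋃ p ∈ (Set.Icc (-(2 * n) : ℤ) (2 * n)) ×ˢ (Set.Icc (-(2 * n) : ℤ) (2 * n)),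
      {v : HeightOneSpectrum (𝓞 F) | ((p.1 : 𝓞 F) + p.2 * hz.toInteger) ≠ 0 ∧
        ((p.1 : 𝓞 F) + p.2 * hz.toInteger) ∈ v.asIdeal}).Finite := by
      refine Set.Finite.biUnion ((Set.finite_Icc _ _).prod (Set.finite_Icc _ _)) ?_
      intro p _
      by_cases h : ((p.1 : 𝓞 F) + p.2 * hz.toInteger) = 0
      · simp [h]
      · refine (Ideal.finite_factors (I := Ideal.span {(p.1 : 𝓞 F) + p.2 * hz.toInteger})
          (by simpa using h)).subset ?_
        rintro v ⟨-, hv⟩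
        exact Ideal.dvd_span_singleton.2 hv
    refine hf.subset ?_
    rintro v ⟨x, hx, hx0, hn⟩
    obtain ⟨a, b, rfl⟩ := eis_rep hz x
    have h1 : a ^ 2 - a * b + b ^ 2 ≤ (n : ℤ) := by rw [← eisN_eq hz]; exact_mod_cast hn
    obtain ⟨h2, h3⟩ := form_bound a b n h1
    simp only [Set.mem_iUnion]
    exact ⟨(a, b), ⟨abs_le.1 h2, abs_le.1 h3⟩, hx0, hx⟩
  hunit := by
    refine ⟨hz.toInteger, hz.toInteger_isPrimitiveRoot.isUnit (by norm_num), ?_⟩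
    rintro _ ⟨u, rfl⟩
    have := IsCyclotomicExtension.Rat.Three.Units.mem hz u
    simp only [List.mem_cons, List.not_mem_nil, or_false] at this
    rcases this with rfl | rfl | rfl | rfl | rfl | rfl
    · exact ⟨0, by simp⟩
    · exact ⟨0, by simp⟩
    · exact ⟨1, by simp⟩
    · exact ⟨1, by simp⟩
    · exact ⟨2, by simp⟩
    · exact ⟨2, by simp⟩

end eis
end

section
open IsDedekindDomain NumberField
set_option linter.unusedSectionVars false

section eisplaces
variable {F : Type*} [Field F] [NumberField F] [IsCyclotomicExtension {3} ℚ F] {z : F}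

theorem place_eq_of_prime [IsPrincipalIdealRing (𝓞 F)] (v : HeightOneSpectrum (𝓞 F)) (x : 𝓞 F)
    (hx : Irreducible x) (hv : x ∈ v.asIdeal) : v.asIdeal = Ideal.span {x} := by
  have h1 := PrincipalIdealRing.isMaximal_of_irreducible hx
  exact (h1.eq_of_le v.isPrime.ne_top ((Ideal.span_singleton_le_iff_mem _).2 hv)).symm

theorem irr_q [IsPrincipalIdealRing (𝓞 F)] (hz : IsPrimitiveRoot z 3) {q : ℕ} (hq : q.Prime) (hq3 : q % 3 = 2) :
    Irreducible (q : 𝓞 F) := by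
  have hN : eisN (q : 𝓞 F) = q ^ 2 := by
    have := eisN_eq hz q 0
    simp at this
    exact_mod_cast this
  have hu : ∀ x : 𝓞 F, eisN x = 1 → IsUnit x := (eisE hz).h1
  refine ⟨fun h => ?_, fun a b hab => ?_⟩
  · have := (eisE hz).nm_unit h
    change eisN (q : 𝓞 F) = 1 at this
    rw [hN] at this
    have := hq.one_lt
    nlinarith
  · have h1 := eisN_mul hz a b
    rw [← hab, hN] at h1
    obtain ⟨i, hi, h2⟩ := (Nat.dvd_prime_pow hq).1 ⟨_, h1⟩
    interval_cases i
    · left; exact hu a (by simpa using h2)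
    · exfalso
      obtain ⟨c, d, rfl⟩ := eis_rep hz a
      have h3 := eisN_eq hz c d
      have h4 := form_mod c d
      rw [← h3, h2, pow_one] at h4
      omega
    · right
      apply hu
      rw [h2] at h1
      have : 0 < q ^ 2 := pow_pos hq.pos 2
      nlinarith

theorem ord_gen (v : HeightOneSpectrum (𝓞 F)) (x : 𝓞 F) (h : v.asIdeal = Ideal.span {x}) (y : Fˣ)
    (hy : (y : F) = x) : ordZ v y = 1 := by
  have h0 : x ≠ 0 := by
    rintro rfl
    apply v.ne_bot
    rw [h]; simp
  refine ordZ_eq_one_of v y x x hy (by rw [h]; exact Ideal.mem_span_singleton_self x) ?_ (by simp)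
  rw [h, Ideal.span_singleton_pow, Ideal.mem_span_singleton]
  rintro ⟨c, hc⟩
  have : x * c = 1 := mul_left_cancel₀ h0 (by linear_combination - hc)
  apply v.isPrime.ne_top
  rw [h, Ideal.span_singleton_eq_top]
  exact IsUnit.of_mul_eq_one _ this

theorem coprime_not_mem {R : Type*} [CommRing R] [IsDedekindDomain R] (v : HeightOneSpectrum R) (a b : ℕ)
    (h : Nat.Coprime a b) (ha : (a : R) ∈ v.asIdeal) : (b : R) ∉ v.asIdeal := by
  intro hb
  obtain ⟨x, y, hxy⟩ := Int.isCoprime_iff_gcd_eq_one.2 (show Int.gcd a b = 1 from h)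
  apply v.isPrime.ne_top
  rw [Ideal.eq_top_iff_one]
  have : ((x * a + y * b : ℤ) : R) ∈ v.asIdeal := by
    push_cast
    exact add_mem (Ideal.mul_mem_left _ _ ha) (Ideal.mul_mem_left _ _ hb)
  rw [hxy] at this
  simpa using this

theorem lam_sq (hz : IsPrimitiveRoot z 3) : (hz.toInteger - 1) ^ 2 = - 3 * hz.toInteger := by
  linear_combination eis_rel hz

theorem lam_mem (hz : IsPrimitiveRoot z 3) (v : HeightOneSpectrum (𝓞 F)) (h3 : (3 : 𝓞 F) ∈ v.asIdeal) :
    hz.toInteger - 1 ∈ v.asIdeal := by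
  apply v.isPrime.mem_of_pow_mem 2
  rw [lam_sq]
  exact Ideal.mul_mem_right _ _ (neg_mem h3)

theorem lam_mem_iff (hz : IsPrimitiveRoot z 3) (v : HeightOneSpectrum (𝓞 F)) : hz.toInteger - 1 ∈ v.asIdeal
    ↔ (3 : 𝓞 F) ∈ v.asIdeal := by
  refine ⟨fun h => ?_, lam_mem hz v⟩
  have : (3 : 𝓞 F) = (hz.toInteger - 1) * (- (hz.toInteger - 1) * hz.toInteger ^ 2) := by
    have := eis_rel hz
    linear_combination (hz.toInteger ^ 2 - 3 * hz.toInteger + 3) * this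
  rw [this]
  exact Ideal.mul_mem_right _ _ h

theorem lam_asIdeal [IsPrincipalIdealRing (𝓞 F)] (hz : IsPrimitiveRoot z 3) (v : HeightOneSpectrum (𝓞 F))
    (h3 : (3 : 𝓞 F) ∈ v.asIdeal) : v.asIdeal = Ideal.span {hz.toInteger - 1} := by
  have : Fact (Nat.Prime 3) := ⟨Nat.prime_three⟩
  exact place_eq_of_prime v _ hz.zeta_sub_one_prime'.irreducible (lam_mem hz v h3)

theorem lam_ord3 [IsPrincipalIdealRing (𝓞 F)] (hz : IsPrimitiveRoot z 3) (v : HeightOneSpectrum (𝓞 F))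
    (h3 : (3 : 𝓞 F) ∈ v.asIdeal) (y : Fˣ) (hy : (y : F) = 3) : ordZ v y = 2 := by
  have h0 : z - 1 ≠ 0 := sub_ne_zero.2 (hz.ne_one (by norm_num))
  have h1 := ord_gen v _ (lam_asIdeal hz v h3) (Units.mk0 (z - 1) h0) (by simp; rfl)
  have hz0 : z ≠ 0 := hz.ne_zero (by norm_num)
  have e : Units.mk0 (z - 1) h0 ^ 2 = (- Units.mk0 z hz0) * y := by
    ext
    have := congrArg (algebraMap (𝓞 F) F) (lam_sq hz)
    have e0 : algebraMap (𝓞 F) F hz.toInteger = z := rfl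
    simp only [map_pow, map_sub, map_mul, map_neg, map_ofNat, map_one, e0] at this
    simp [hy]
    rw [this]; ring
  have h2 : ordZ v (- Units.mk0 z hz0) = 0 := by
    rw [ordZ_neg, ordZ_alg_eq_zero v _ hz.toInteger rfl]
    intro h
    apply v.isPrime.ne_top
    exact Ideal.eq_top_of_isUnit_mem _ h (hz.toInteger_isPrimitiveRoot.isUnit (by norm_num))
  have h3 := congrArg (ordZ v) e
  rw [ordZ_pow, ordZ_mul, h1, h2] at h3
  simp at h3
  omega

theorem lam_cube (hz : IsPrimitiveRoot z 3) (v : HeightOneSpectrum (𝓞 F)) (h3 : (3 : 𝓞 F) ∈ v.asIdeal)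
    (u : (𝓞 F ⧸ v.asIdeal)ˣ) : u = u ^ 3 := by
  obtain ⟨x, hx⟩ := Ideal.Quotient.mk_surjective (u : 𝓞 F ⧸ v.asIdeal)
  obtain ⟨a, b, rfl⟩ := eis_rep hz x
  ext
  rw [Units.val_pow_eq_pow_val, ← hx, ← map_pow, Ideal.Quotient.eq]
  have h := lam_mem hz v h3
  have h4 : (3 : ℤ) ∣ (a + b) ^ 3 - (a + b) := by
    have hc : (a + b) % 3 = 0 ∨ (a + b) % 3 = 1 ∨ (a + b) % 3 = 2 := by omega
    apply Int.dvd_of_emod_eq_zero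
    rcases hc with h | h | h <;> simp [Int.sub_emod, pow_succ, Int.mul_emod, h]
  obtain ⟨k, hk⟩ := h4
  have hk' : ((a : 𝓞 F) + b) ^ 3 - (a + b) = 3 * k := by exact_mod_cast congrArg (Int.cast (R := 𝓞 F)) hk
  set w := hz.toInteger
  have : (a : 𝓞 F) + b * w - (a + b * w) ^ 3 = (w - 1) * (b - b * ((a + b * w) ^ 2 + (a + b * w) * (a + b) + (a + b) ^ 2))
     - 3 * k := by
    linear_combination - hk'
  rw [this]
  exact sub_mem (Ideal.mul_mem_right _ _ h) (Ideal.mul_mem_right _ _ h3)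

theorem q_card [IsPrincipalIdealRing (𝓞 F)] (hz : IsPrimitiveRoot z 3) {q : ℕ} (hq : q.Prime) (hq3 : q % 3 = 2)
    (v : HeightOneSpectrum (𝓞 F)) (h : (q : 𝓞 F) ∈ v.asIdeal) : Nat.card (𝓞 F ⧸ v.asIdeal)ˣ = q ^ 2 - 1 := by
  let _ := Ideal.Quotient.field v.asIdeal
  rw [Nat.card_units, place_eq_of_prime v _ (irr_q hz hq hq3) h]
  have h1 : Ideal.absNorm (Ideal.span {(q : 𝓞 F)}) = q ^ 2 := by
    rw [Ideal.absNorm_span_singleton]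
    have : (q : 𝓞 F) = algebraMap ℤ (𝓞 F) q := by simp
    rw [this, Algebra.norm_algebraMap, RingOfIntegers.rank, IsCyclotomicExtension.finrank (n := 3) F (Polynomial.cyclotomic.irreducible_rat (by norm_num))]
    have : Nat.totient 3 = 2 := by decide
    rw [this, Int.natAbs_pow]; simp
  rw [← h1]; rfl

theorem z_resid (hz : IsPrimitiveRoot z 3) {q : ℕ} (hq : q.Prime) (hq3 : q % 3 = 2)
    (v : HeightOneSpectrum (𝓞 F)) (h : (q : 𝓞 F) ∈ v.asIdeal) :
    Ideal.Quotient.mk v.asIdeal hz.toInteger ≠ 1 := by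
  rw [← map_one (Ideal.Quotient.mk v.asIdeal), Ne, Ideal.Quotient.eq, lam_mem_iff]
  have : Nat.Coprime q 3 := (Nat.coprime_primes hq Nat.prime_three).2 (by omega)
  exact_mod_cast coprime_not_mem v q 3 this h

theorem z_cube_iff [IsPrincipalIdealRing (𝓞 F)] (hz : IsPrimitiveRoot z 3) {q : ℕ} (hq : q.Prime) (hq3 : q % 3 = 2)
    (v : HeightOneSpectrum (𝓞 F)) (h : (q : 𝓞 F) ∈ v.asIdeal) (u : (𝓞 F ⧸ v.asIdeal)ˣ)
    (hu : (u : 𝓞 F ⧸ v.asIdeal) = Ideal.Quotient.mk v.asIdeal hz.toInteger) : (∃ c, u = c ^ 3) ↔ q % 9 = 8 := by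
  let _ := Ideal.Quotient.field v.asIdeal
  have hc := q_card hz hq hq3 v h
  have hq1 : 1 < q := hq.one_lt
  have hq2 : 1 < q ^ 2 := by nlinarith
  have : Finite (𝓞 F ⧸ v.asIdeal)ˣ := Nat.finite_of_card_ne_zero (by omega)
  have h9 : 9 ∣ q ^ 2 - 1 ↔ q % 9 = 8 := by
    rw [← Nat.modEq_iff_dvd' hq2.le, Nat.ModEq]
    have : q % 9 = 2 ∨ q % 9 = 5 ∨ q % 9 = 8 := by omega
    rcases this with h | h | h <;> simp [Nat.pow_mod, h]
  have hu1 : u ≠ 1 := by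
    intro h1
    rw [h1] at hu
    exact z_resid hz hq hq3 v h (by rw [← hu]; simp)
  have hu3 : u ^ 3 = 1 := by
    ext
    rw [Units.val_pow_eq_pow_val, hu, ← map_pow, hz.toInteger_isPrimitiveRoot.pow_eq_one]; simp
  rw [← h9, ← hc]
  constructor
  · rintro ⟨c, rfl⟩
    have h1 : orderOf c = 3 ^ (1 + 1) := by
      have : Fact (Nat.Prime 3) := ⟨Nat.prime_three⟩
      apply orderOf_eq_prime_pow
      · simpa using hu1
      · rw [← hu3, ← pow_mul]; norm_num
    have := orderOf_dvd_natCard c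
    rw [h1] at this
    simpa using this
  · rintro ⟨k, hk⟩
    obtain ⟨g, hg⟩ := IsCyclic.exists_generator (α := (𝓞 F ⧸ v.asIdeal)ˣ)
    have ho := orderOf_eq_card_of_forall_mem_zpowers hg
    obtain ⟨i, rfl⟩ := hg u
    rw [← zpow_natCast, ← zpow_mul, ← orderOf_dvd_iff_zpow_eq_one, ho, hk] at hu3
    have : (3 : ℤ) ∣ i := by
      obtain ⟨l, hl⟩ := hu3
      push_cast at hl
      exact ⟨k * l, by linarith⟩
    obtain ⟨j, rfl⟩ := this
    exact ⟨g ^ j, by rw [← zpow_natCast, ← zpow_mul]; congr 1; push_cast; ring⟩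

/-- rational elements have residue `resid q ^ k` times a cube -/
def QGood (v : HeightOneSpectrum (𝓞 F)) (u x : Fˣ) : Prop :=
  ∃ c, resid F v x = resid F v u ^ ordZ v x * c ^ 3

theorem qgood_int {q : ℕ} (hq : q.Prime) (hq3 : q % 3 = 2)
    (v : HeightOneSpectrum (𝓞 F)) (h : (q : 𝓞 F) ∈ v.asIdeal) (u : Fˣ) (hu : (u : F) = q) (hu1 : ordZ v u = 1)
    (n : ℤ) (x : Fˣ) (hx : (x : F) = n) : QGood v u x := by
  have hn : n ≠ 0 := by rintro rfl; exact x.ne_zero (by simp [hx])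
  have hfin : FiniteMultiplicity (q : ℤ) n :=
    Int.finiteMultiplicity_iff.2 ⟨by simpa using hq.ne_one, hn⟩
  obtain ⟨n', hn', hnd⟩ := hfin.exists_eq_pow_mul_and_not_dvd
  set k := multiplicity (q : ℤ) n
  have hn'0 : (n' : F) ≠ 0 := by
    intro h0
    apply hnd
    rw [Int.cast_eq_zero.1 h0]; simp
  have hqi : ∀ a : ℤ, (q : ℤ) ∣ a → (a : 𝓞 F) ∈ v.asIdeal := by
    rintro _ ⟨b, rfl⟩
    push_cast
    exact Ideal.mul_mem_right _ _ h
  have hcop : IsCoprime (q : ℤ) n' := (Nat.prime_iff_prime_int.1 hq).coprime_iff_not_dvd.2 hnd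
  have hnm : (n' : 𝓞 F) ∉ v.asIdeal := by
    intro hb
    obtain ⟨x, y, hxy⟩ := hcop
    apply v.isPrime.ne_top
    rw [Ideal.eq_top_iff_one]
    have : ((x * q + y * n' : ℤ) : 𝓞 F) ∈ v.asIdeal := by
      push_cast
      exact add_mem (Ideal.mul_mem_left _ _ h) (Ideal.mul_mem_left _ _ hb)
    rw [hxy] at this
    simpa using this
  set y := Units.mk0 (n' : F) hn'0 with hy
  have hxy : x = u ^ k * y := by ext; simp [hx, hu, hy, hn']
  have hy0 : ordZ v y = 0 := (ordZ_alg_eq_zero v y (n' : 𝓞 F) (by simp [hy])).2 hnm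
  have hr := resid_alg v y _ hnm (by simp [hy])
  have hp : resid F v y ^ (q - 1) = 1 := by
    have := Int.ModEq.pow_card_sub_one_eq_one hq hcop.symm
    ext
    rw [Units.val_pow_eq_pow_val, hr, ← map_pow, Units.val_one, ← map_one (Ideal.Quotient.mk v.asIdeal), Ideal.Quotient.eq]
    have := hqi _ this.symm.dvd
    simpa using this
  have hord : ordZ v x = k := by rw [hxy, ordZ_mul, ordZ_pow, hy0, hu1]; simp
  refine ⟨resid F v y ^ ((2 * q - 1) / 3), ?_⟩
  rw [hord, hxy, map_mul, map_pow, zpow_natCast, ← pow_mul]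
  congr 1
  have : (2 * q - 1) / 3 * 3 = (q - 1) * 2 + 1 := by omega
  rw [this, pow_succ, pow_mul, hp]; simp

theorem qgood_div (v : HeightOneSpectrum (𝓞 F)) (u x y : Fˣ) (hx : QGood v u x) (hy : QGood v u y) :
    QGood v u (x / y) := by
  obtain ⟨c, hc⟩ := hx
  obtain ⟨d, hd⟩ := hy
  refine ⟨c / d, ?_⟩
  rw [map_div, hc, hd, ordZ_div, zpow_sub, div_pow, mul_div_mul_comm, div_eq_mul_inv (_ ^ _) (_ ^ ordZ v y)]

theorem qgood_tame (v : HeightOneSpectrum (𝓞 F)) (u x y : Fˣ) (hx : QGood v u x) (hy : QGood v u y) :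
    TameTriv v x y := by
  obtain ⟨c, hc⟩ := hx
  obtain ⟨d, hd⟩ := hy
  refine ⟨c ^ ordZ v y / d ^ ordZ v x, ?_⟩
  rw [hc, hd, mul_zpow, mul_zpow, mul_div_mul_comm, ← zpow_mul, ← zpow_mul, mul_comm (ordZ v x), div_self',
    one_mul, div_pow, ← zpow_natCast, ← zpow_natCast, ← zpow_natCast, ← zpow_natCast, ← zpow_mul, ← zpow_mul,
    ← zpow_mul, ← zpow_mul, mul_comm (ordZ v y), mul_comm (ordZ v x)]

end eisplaces
end

section
open IsDedekindDomain NumberField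
set_option linter.unusedSectionVars false

namespace CubicData
variable {F K : Type*} [Field F] [NumberField F] [Field K] [NumberField K] [Algebra F K]
  (C : CubicData F K)

theorem val_σ (w) (h : C.s w = w) (x : K) : w.valuation K (C.σ x) = w.valuation K x := by
  by_cases hx : x = 0
  · simp [hx]
  · have h1 := C.ordZ_s w (Units.mk0 x hx)
    rw [h] at h1
    have h2 := valuation_eq_ordZ w (C.sg (Units.mk0 x hx))
    have h3 := valuation_eq_ordZ w (Units.mk0 x hx)
    rw [h1, ← h3] at h2
    exact h2

theorem val_F3 (w : HeightOneSpectrum (𝓞 K)) (h : ram F w = 3) (a : F)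
    (ha : w.valuation K (algebraMap F K a) ≤ WithZero.exp (-1)) :
    w.valuation K (algebraMap F K a) ≤ WithZero.exp (-3) := by
  by_cases hx : a = 0
  · simp [hx]
  · have h1 := ordZ_ram w (Units.mk0 a hx)
    have h2 := valuation_eq_ordZ w (Fm F K (Units.mk0 a hx))
    change w.valuation K (algebraMap F K a) = _ at h2
    rw [h2, WithZero.exp_le_exp] at ha ⊢
    rw [h1, h] at ha ⊢
    omega

theorem ram_one_of (w) (h : C.s w = w) (θ : K) (h1 : w.valuation K θ ≤ 1)
    (h2 : w.valuation K (C.σ θ - θ) = 1) : ram F w = 1 := by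
  rcases C.ram_13 w with hr | hr
  · exact hr
  exfalso
  obtain ⟨y, hy⟩ := exists_unif (K := K) w
  have hy1 := valuation_eq_ordZ w y
  rw [hy] at hy1
  have hσ := C.val_σ w h
  set V := w.valuation K with hV
  have h3 : V (C.σ (C.σ θ) - C.σ θ) = 1 := by rw [← map_sub, hσ, h2]
  have h4 : V (C.σ (C.σ θ) - θ) = 1 := by
    rw [← hσ, map_sub, C.σ3, Valuation.map_sub_swap, h2]
  have n2 : C.σ θ - θ ≠ 0 := by intro h0; rw [h0, map_zero] at h2; exact zero_ne_one h2
  have n3 : C.σ (C.σ θ) - C.σ θ ≠ 0 := by intro h0; rw [h0, map_zero] at h3; exact zero_ne_one h3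
  have n4 : C.σ (C.σ θ) - θ ≠ 0 := by intro h0; rw [h0, map_zero] at h4; exact zero_ne_one h4
  have hd : V ((θ - C.σ θ) * (θ - C.σ (C.σ θ))) = 1 := by
    rw [map_mul, Valuation.map_sub_swap, h2, Valuation.map_sub_swap, h4, one_mul]
  have key : ∀ c : K, V c ≤ 1 → ∃ a : F, V (algebraMap F K a) ≤ WithZero.exp (-3) ∧
      algebraMap F K a = y * c / ((θ - C.σ θ) * (θ - C.σ (C.σ θ))) +
        C.σ y * C.σ c / ((C.σ θ - C.σ (C.σ θ)) * (C.σ θ - θ)) +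
        C.σ (C.σ y) * C.σ (C.σ c) / ((C.σ (C.σ θ) - θ) * (C.σ (C.σ θ) - C.σ θ)) := by
    intro c hc
    obtain ⟨a, ha⟩ := C.tr_mem (y * c / ((θ - C.σ θ) * (θ - C.σ (C.σ θ))))
    refine ⟨a, ?_, by rw [ha]; simp only [map_div₀, map_mul, map_sub, C.σ3]⟩
    apply val_F3 w hr
    rw [ha]
    have hu : V (y * c / ((θ - C.σ θ) * (θ - C.σ (C.σ θ)))) ≤ WithZero.exp (-1) := by
      rw [map_div₀, hd, div_one, map_mul, hy1]
      exact mul_le_of_le_one_right' hc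
    refine Valuation.map_add_le _ (Valuation.map_add_le _ hu ?_) ?_
    · rw [hσ]; exact hu
    · rw [hσ, hσ]; exact hu
  have hθ1 : V (C.σ θ) ≤ 1 := by rw [hσ]; exact h1
  have hθ2 : V (C.σ (C.σ θ)) ≤ 1 := by rw [hσ, hσ]; exact h1
  obtain ⟨a, ha, ea⟩ := key 1 (by simp)
  obtain ⟨b, hb, eb⟩ := key (-(C.σ θ + C.σ (C.σ θ))) (by
    rw [Valuation.map_neg]; exact Valuation.map_add_le _ hθ1 hθ2)
  obtain ⟨c, hc, ec⟩ := key (C.σ θ * C.σ (C.σ θ)) (by rw [map_mul]; exact mul_le_one' hθ1 hθ2)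
  have e : (y : K) = algebraMap F K c + algebraMap F K b * θ + algebraMap F K a * (θ * θ) := by
    rw [ea, eb, ec]
    simp only [map_mul, map_add, map_neg, map_one, C.σ3]
    generalize C.σ (C.σ θ) = θ2 at *
    generalize C.σ θ = θ1 at *
    have n2' : θ - θ1 ≠ 0 := by rw [← neg_sub]; exact neg_ne_zero.2 n2
    have n3' : θ1 - θ2 ≠ 0 := by rw [← neg_sub]; exact neg_ne_zero.2 n3
    have n4' : θ - θ2 ≠ 0 := by rw [← neg_sub]; exact neg_ne_zero.2 n4
    have e2 : C.σ y * 1 / ((θ1 - θ2) * (θ1 - θ)) = - (C.σ y) / ((θ1 - θ2) * (θ - θ1)) := by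
      rw [← neg_sub θ θ1]; field_simp
    field_simp
    ring
  have hf : V (y : K) ≤ WithZero.exp (-3) := by
    rw [e]
    refine Valuation.map_add_le _ (Valuation.map_add_le _ hc ?_) ?_
    · rw [map_mul]; exact (mul_le_of_le_one_right' h1).trans hb
    · rw [map_mul, map_mul]; exact (mul_le_of_le_one_right' (mul_le_one' h1 h1)).trans ha
  rw [hy1, WithZero.exp_le_exp] at hf
  omega

theorem α_int : ∃ a : 𝓞 K, algebraMap (𝓞 K) K a = C.α := by
  have : IsIntegral ℤ C.α := by
    refine IsIntegral.of_pow (n := 3) (by norm_num) ?_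
    rw [C.hα]
    have h := isIntegral_algebraMap (R := ℤ) (A := K) (x := (C.m : ℤ))
    simpa using h
  exact ⟨⟨C.α, this⟩, rfl⟩

noncomputable def αU : Kˣ := Units.mk0 C.α C.hα0

theorem m0 : C.m ≠ 0 := by
  intro h
  apply C.hα0
  have := C.hα
  rw [h] at this
  simpa using this

noncomputable def mU : Fˣ := Units.mk0 (C.m : F) (by exact_mod_cast C.m0)

theorem αU3 : C.αU ^ 3 = Fm F K C.mU := by
  ext; simp [αU, mU, C.hα]

theorem ord_α (w : HeightOneSpectrum (𝓞 K)) : 3 * ordZ w C.αU = ram F w * ordZ (und F w) C.mU := by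
  have := congrArg (ordZ w) C.αU3
  rw [ordZ_pow, ordZ_ram] at this
  exact_mod_cast this

theorem natCast_und (w : HeightOneSpectrum (𝓞 K)) (n : ℕ) : (n : 𝓞 F) ∈ (und F w).asIdeal ↔ (n : 𝓞 K) ∈ w.asIdeal := by
  rw [mem_und, map_natCast]

variable [IsCyclotomicExtension {3} ℚ F]

theorem val_lam (v : HeightOneSpectrum (𝓞 F)) (h3 : (3 : 𝓞 F) ∉ v.asIdeal) (x : Fˣ)
    (hx : (x : F) = C.z - 1) : ordZ v x = 0 := by
  rw [ordZ_alg_eq_zero v x (C.hz.toInteger - 1) (by rw [hx]; simp; rfl), lam_mem_iff]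
  exact h3

theorem lam_ne : C.z - 1 ≠ 0 := sub_ne_zero.2 (C.hz.ne_one (by norm_num))

theorem ram_unram (w : HeightOneSpectrum (𝓞 K)) (h3 : (3 : 𝓞 K) ∉ w.asIdeal)
    (hm : (C.m : 𝓞 K) ∉ w.asIdeal) : ram F w = 1 := by
  by_cases h : C.s w = w
  swap
  · exact C.ram_nonfixed w h
  have hmo : ordZ (und F w) C.mU = 0 := (ordZ_alg_eq_zero _ _ (C.m : 𝓞 F) (by simp [mU])).2
    (by rw [natCast_und]; exact hm)
  have hα : w.valuation K C.α = 1 := by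
    have := valuation_eq_ordZ w C.αU
    have h2 := C.ord_α w
    rw [hmo] at h2
    rw [show ordZ w C.αU = 0 by omega] at this
    simpa [αU] using this
  apply C.ram_one_of w h C.α hα.le
  have e : C.σ C.α - C.α = algebraMap F K (C.z - 1) * C.α := by rw [C.hσ]; simp; ring
  rw [e, map_mul, hα, mul_one]
  have h1 := valuation_eq_ordZ w (Fm F K (Units.mk0 _ C.lam_ne))
  rw [ordZ_ram, C.val_lam (und F w) (by
    have := natCast_und (F := F) w 3
    push_cast at this
    rwa [this]) _ rfl] at h1
  simpa using h1

theorem ram_lam1 (w : HeightOneSpectrum (𝓞 K)) (h3 : (3 : 𝓞 K) ∈ w.asIdeal)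
    (ε k : ℤ) (hε : ε ^ 2 = 1) (hm : (C.m : ℤ) = ε + 9 * k) : ram F w = 1 := by
  by_cases h : C.s w = w
  swap
  · exact C.ram_nonfixed w h
  have hnd : ¬ 3 ∣ C.m := by
    intro hd
    have h1 : (3 : ℤ) ∣ ε := by
      have : (3 : ℤ) ∣ C.m := by exact_mod_cast hd
      omega
    obtain ⟨j, rfl⟩ := h1
    have : (3 : ℤ) * (3 * j ^ 2) = 1 := by linarith
    omega
  have hmo : (C.m : 𝓞 K) ∉ w.asIdeal :=
    coprime_not_mem w 3 C.m ((Nat.Prime.coprime_iff_not_dvd Nat.prime_three).2 hnd) (by exact_mod_cast h3)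
  have hα : w.valuation K C.α = 1 := by
    have := valuation_eq_ordZ w C.αU
    have h2 := C.ord_α w
    rw [(ordZ_alg_eq_zero _ _ (C.m : 𝓞 F) (by simp [mU])).2 (by rw [natCast_und]; exact hmo)] at h2
    rw [show ordZ w C.αU = 0 by omega] at this
    simpa [αU] using this
  have hzs := C.zsumK
  have hz3 := C.zK3
  have hl0 : 1 - algebraMap F K C.z ≠ 0 := by
    have := C.lam_ne
    rw [← map_one (algebraMap F K), ← map_sub, Ne, map_eq_zero]
    intro h0; apply this; linear_combination - h0
  obtain ⟨ζ, hζ⟩ : ∃ ζ : 𝓞 K, algebraMap (𝓞 K) K ζ = algebraMap F K C.z :=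
    ⟨algebraMap (𝓞 F) (𝓞 K) C.hz.toInteger, rfl⟩
  set Z := algebraMap F K C.z with hZ
  set θ := (C.α - ε) / (1 - Z) with hθ
  have hint : ∃ y : 𝓞 K, algebraMap (𝓞 K) K y = θ := by
    apply IsIntegrallyClosed.isIntegral_iff.1
    let p : Polynomial (𝓞 K) := Polynomial.X ^ 3 + Polynomial.C (- ζ ^ 2 * ε * (1 - ζ)) * Polynomial.X ^ 2
      + Polynomial.C (- ζ ^ 2) * Polynomial.X + Polynomial.C (- ζ * (1 - ζ) * k)
    refine ⟨p, ?_, ?_⟩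
    · show p.Monic
      unfold p
      monicity!
    · have hα : C.α = ε + (1 - Z) * θ := by rw [hθ]; field_simp; ring
      have h1 := C.hα
      have h2 : (C.m : K) = ε + 9 * k := by exact_mod_cast congrArg (Int.cast (R := K)) hm
      have hε' : (ε : K) ^ 2 = 1 := by exact_mod_cast congrArg (Int.cast (R := K)) hε
      rw [hα, h2] at h1
      have h3 : (1 - Z) ^ 3 * (θ ^ 3 + (- Z ^ 2 * ε * (1 - Z)) * θ ^ 2 + (- Z ^ 2) * θ + (- Z * (1 - Z) * k)) = 0 := by
        have a1 : Z ^ 2 * (1 - Z) ^ 2 = - 3 := by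
          linear_combination (Z ^ 2 - 3 * Z + 3) * hzs
        have a2 : Z * (1 - Z) ^ 4 = 9 := by
          linear_combination (Z ^ 3 - 5 * Z ^ 2 + 10 * Z - 9 + Z * 0) * hzs
        linear_combination h1 - (1 - Z) * θ * a1 - (1 - Z) ^ 2 * ε * θ ^ 2 * a1 - k * a2
          - ε * hε' - 3 * (1 - Z) * θ * hε'
      have h4 := (mul_eq_zero.1 h3).resolve_left (pow_ne_zero 3 hl0)
      simp only [p, Polynomial.eval₂_add, Polynomial.eval₂_mul, Polynomial.eval₂_pow, Polynomial.eval₂_X,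
        Polynomial.eval₂_C]
      simp only [map_mul, map_neg, map_pow, map_sub, map_one, map_intCast, hζ]
      exact h4
  obtain ⟨y, hy⟩ := hint
  apply C.ram_one_of w h θ
  · rw [← hy]; exact w.valuation_le_one y
  · have e : C.σ θ - θ = - C.α := by
      have : C.σ Z = Z := C.σ.commutes _
      rw [hθ, map_div₀, map_sub, map_sub, this, C.hσ, map_one, map_intCast]
      field_simp
      ring
    rw [e, Valuation.map_neg, hα]

variable [IsPrincipalIdealRing (𝓞 F)]

theorem ram3_of_not_dvd (w : HeightOneSpectrum (𝓞 K)) (h : ¬ 3 ∣ ordZ (und F w) C.mU) : ram F w = 3 := by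
  rcases C.ram_13 w with h1 | h1
  · have := C.ord_α w
    rw [h1] at this
    omega
  · exact h1

theorem ordZ_nat (v : HeightOneSpectrum (𝓞 F)) (p : ℕ) (n t : ℕ) (m m' : ℕ) (hp : p.Prime) (hm : m = p ^ t * m') (hm' : ¬ p ∣ m')
    (u x : Fˣ) (hu : (u : F) = p) (hx : (x : F) = m) (hv : (p : 𝓞 F) ∈ v.asIdeal) (hn : ordZ v u = n) :
    ordZ v x = n * t := by
  have h0 : (m' : F) ≠ 0 := by
    intro h; apply hm'
    rw [Nat.cast_eq_zero.1 h]; simp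
  have e : x = u ^ t * Units.mk0 _ h0 := by
    ext; simp [hu, hx, hm]
  rw [e, ordZ_mul, ordZ_pow, hn, (ordZ_alg_eq_zero v (Units.mk0 _ h0) (m' : 𝓞 F) (by simp)).2
    (coprime_not_mem v p m' ((Nat.Prime.coprime_iff_not_dvd hp).2 hm') hv)]
  ring

theorem ram_q (w : HeightOneSpectrum (𝓞 K)) (q t m' : ℕ) (hq : q.Prime) (hq3 : q % 3 = 2) (ht : t = 1 ∨ t = 2)
    (hm : C.m = q ^ t * m') (hm' : ¬ q ∣ m') (hw : (q : 𝓞 K) ∈ w.asIdeal) : ram F w = 3 := by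
  apply C.ram3_of_not_dvd
  rw [← natCast_und (F := F)] at hw
  have hq0 : (q : F) ≠ 0 := by exact_mod_cast hq.ne_zero
  rw [ordZ_nat (und F w) q 1 t C.m m' hq hm hm' (Units.mk0 _ hq0) C.mU rfl rfl hw
    (ord_gen _ _ (place_eq_of_prime _ _ (irr_q C.hz hq hq3) hw) _ (by simp))]
  omega

theorem ram_3 (w : HeightOneSpectrum (𝓞 K)) (s m' : ℕ) (hs : s = 1 ∨ s = 2)
    (hm : C.m = 3 ^ s * m') (hm' : ¬ 3 ∣ m') (hw : (3 : 𝓞 K) ∈ w.asIdeal) : ram F w = 3 := by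
  apply C.ram3_of_not_dvd
  have hw' : ((3 : ℕ) : 𝓞 F) ∈ (und F w).asIdeal := by
    rw [natCast_und]; exact_mod_cast hw
  rw [ordZ_nat (und F w) 3 2 s C.m m' Nat.prime_three hm hm' (Units.mk0 3 (by norm_num)) C.mU (by simp) rfl hw'
    (lam_ord3 C.hz _ (by exact_mod_cast hw') _ (by simp))]
  omega

theorem ram_3' (w : HeightOneSpectrum (𝓞 K)) (hm3 : ¬ 3 ∣ C.m) (hm9 : ¬ (C.m % 9 = 1 ∨ C.m % 9 = 8))
    (hw : (3 : 𝓞 K) ∈ w.asIdeal) : ram F w = 3 := by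
  rcases C.ram_13 w with h1 | h1
  swap
  · exact h1
  exfalso
  have hw' : ((3 : ℕ) : 𝓞 F) ∈ (und F w).asIdeal := by
    rw [natCast_und]; exact_mod_cast hw
  have hm1 : 1 ≤ C.m := Nat.one_le_iff_ne_zero.2 C.m0
  have hm0 : (C.m : F) ≠ 0 := by exact_mod_cast C.m0
  have hmle : C.m ≤ C.m ^ 3 := Nat.le_self_pow (by norm_num) _
  obtain ⟨m', hm'⟩ : 3 ∣ C.m ^ 3 - C.m := by
    apply (Nat.modEq_iff_dvd' hmle).1
    rw [Nat.ModEq]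
    have : C.m % 3 = 1 ∨ C.m % 3 = 2 := by omega
    rcases this with h | h <;> simp [Nat.pow_mod, h]
  have hm'2 : ¬ 3 ∣ m' := by
    rintro ⟨k, rfl⟩
    have h9 : 9 ∣ C.m ^ 3 - C.m := ⟨k, by omega⟩
    rw [← Nat.modEq_iff_dvd' hmle, Nat.ModEq] at h9
    have : C.m % 9 = 2 ∨ C.m % 9 = 4 ∨ C.m % 9 = 5 ∨ C.m % 9 = 7 := by omega
    rcases this with h | h | h | h <;> simp [Nat.pow_mod, h] at h9
  have hx0 : ((C.m ^ 3 - C.m : ℕ) : F) ≠ 0 := by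
    intro h
    rw [Nat.cast_eq_zero.1 h] at hm'
    apply hm'2
    rw [show m' = 0 by omega]; simp
  have ho3 := lam_ord3 C.hz _ (by exact_mod_cast hw') (Units.mk0 (3 : F) (by norm_num)) (by simp)
  have hox := ordZ_nat (und F w) 3 2 1 _ m' Nat.prime_three (by rw [pow_one]; exact hm') hm'2 (Units.mk0 3 (by norm_num)) (Units.mk0 _ hx0)
    (by simp) rfl hw' ho3
  obtain ⟨a, ha⟩ := C.α_int
  have hβe : (a - C.m) ^ 3 = - (3 * m') - 3 * C.m * a * (a - C.m) := by
    have h2 : a ^ 3 = (C.m : 𝓞 K) := by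
      apply FaithfulSMul.algebraMap_injective (𝓞 K) K
      rw [map_pow, ha, C.hα]; simp
    have h3 : (C.m : 𝓞 K) ^ 3 = C.m + 3 * m' := by
      have : C.m ^ 3 = C.m + 3 * m' := by omega
      exact_mod_cast this
    linear_combination h2 - h3
  have hβw : a - C.m ∈ w.asIdeal := by
    apply w.isPrime.mem_of_pow_mem 3
    rw [hβe]
    exact sub_mem (neg_mem (Ideal.mul_mem_right _ _ hw)) (by
      rw [mul_assoc, mul_assoc]; exact Ideal.mul_mem_right _ _ hw)
  have hβ0 : algebraMap (𝓞 K) K (a - C.m) ≠ 0 := by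
    intro h0
    have h2 : a - C.m = 0 := FaithfulSMul.algebraMap_injective (𝓞 K) K (by rw [h0, map_zero])
    rw [h2] at hβe
    have h3 : (3 * m' : 𝓞 K) = 0 := by linear_combination hβe
    have h4 : 3 * m' = 0 := by exact_mod_cast h3
    rw [← hm'] at h4
    apply hx0; rw [h4]; simp
  set β := Units.mk0 _ hβ0 with hβ
  have hb1 : 0 < ordZ w β := (ordZ_alg_pos w β (a - C.m) rfl).2 hβw
  have hmo := (ordZ_alg_eq_zero (und F w) C.mU (C.m : 𝓞 F) (by simp [mU])).2
    (coprime_not_mem _ 3 C.m ((Nat.Prime.coprime_iff_not_dvd Nat.prime_three).2 hm3) hw')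
  have hαo := C.ord_α w
  rw [hmo] at hαo
  have e3 : ((Fm F K (Units.mk0 _ hx0) : Kˣ) : K) = 3 * m' := by
    show algebraMap F K ((C.m ^ 3 - C.m : ℕ) : F) = _
    rw [map_natCast, hm']; push_cast; rfl
  have hsum := ordZ_add_lt w (- Fm F K (Units.mk0 _ hx0)) (- (Fm F K (Units.mk0 (3 : F) (by norm_num)) * Fm F K C.mU * C.αU * β))
    (β ^ 3) (by
      have := congrArg (algebraMap (𝓞 K) K) hβe
      rw [Units.val_neg, e3]
      simp only [map_pow, map_sub, map_mul, map_neg, map_ofNat, map_natCast, ha] at this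
      simp only [Units.val_neg, Units.val_mul, Units.val_pow_eq_pow_val, hβ, Units.val_mk0, map_sub, map_natCast, ha]
      rw [this]
      simp [mU, αU]
      rw [map_ofNat]; ring)
  rw [ordZ_neg, ordZ_neg, ordZ_mul, ordZ_mul, ordZ_mul, ordZ_ram, ordZ_ram, ordZ_ram, ordZ_pow, h1, ho3, hox, hmo] at hsum
  omega
end CubicData
end

section
open IsDedekindDomain NumberField
set_option linter.unusedSectionVars false

structure AD {F K : Type*} [Field F] [NumberField F] [Field K] [NumberField K] [Algebra F K]
    (C : CubicData F K) where
  J : ℕ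
  q : Fin J → ℕ
  hp : ∀ i, (q i).Prime
  hinj : Function.Injective q
  h3 : ∀ i, q i % 3 = 2
  t : Fin J → ℕ
  ht : ∀ i, t i = 1 ∨ t i = 2
  s : ℕ
  hs : s ≤ 2
  hm : C.m = 3 ^ s * ∏ i, q i ^ t i

namespace AD
variable {F K : Type*} [Field F] [NumberField F] [Field K] [NumberField K] [Algebra F K]
  [IsCyclotomicExtension {3} ℚ F] [IsPrincipalIdealRing (𝓞 F)] {C : CubicData F K} (A : AD C)

theorem fact3 : ¬ 3 ∣ ∏ i, A.q i ^ A.t i := by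
  intro h
  obtain ⟨i, -, hi⟩ := (Prime.dvd_finsetProd_iff Nat.prime_three.prime _).1 h
  have h1 := (Nat.prime_dvd_prime_iff_eq Nat.prime_three (A.hp i)).1 (Nat.prime_three.dvd_of_dvd_pow hi)
  have := A.h3 i
  omega

theorem factq (i) : ∃ m', C.m = A.q i ^ A.t i * m' ∧ ¬ A.q i ∣ m' := by
  refine ⟨3 ^ A.s * ∏ j ∈ Finset.univ.erase i, A.q j ^ A.t j, ?_, ?_⟩
  · rw [A.hm, ← Finset.mul_prod_erase Finset.univ _ (Finset.mem_univ i)]; ring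
  · intro h
    rcases (A.hp i).dvd_mul.1 h with h | h
    · have h1 := (Nat.prime_dvd_prime_iff_eq (A.hp i) Nat.prime_three).1 ((A.hp i).dvd_of_dvd_pow h)
      have := A.h3 i
      omega
    · obtain ⟨j, hj, hd⟩ := (Prime.dvd_finsetProd_iff (A.hp i).prime _).1 h
      have h1 := (Nat.prime_dvd_prime_iff_eq (A.hp i) (A.hp j)).1 ((A.hp i).dvd_of_dvd_pow hd)
      exact (Finset.mem_erase.1 hj).1 (A.hinj h1).symm

open Classical in
noncomputable def P (A : AD C) : Finset ℕ :=
  Finset.univ.image A.q ∪ (if C.m % 9 = 1 ∨ C.m % 9 = 8 then ∅ else {3})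

open Classical in
theorem P_card : A.P.card = A.J + if C.m % 9 = 1 ∨ C.m % 9 = 8 then 0 else 1 := by
  unfold P
  rw [Finset.card_union_of_disjoint, Finset.card_image_of_injective _ A.hinj]
  · split_ifs <;> simp
  · rw [Finset.disjoint_left]
    intro a ha hb
    obtain ⟨i, -, rfl⟩ := Finset.mem_image.1 ha
    have := A.h3 i
    split_ifs at hb
    · simp at hb
    · rw [Finset.mem_singleton] at hb
      omega

theorem mem_P (p : ℕ) : p ∈ A.P ↔ (∃ i, p = A.q i) ∨ (p = 3 ∧ ¬ (C.m % 9 = 1 ∨ C.m % 9 = 8)) := by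
  unfold P
  rw [Finset.mem_union, Finset.mem_image]
  apply or_congr
  · simp [eq_comm]
  · split_ifs with h <;> simp [h]

theorem P_prime (p : ℕ) (h : p ∈ A.P) : p.Prime := by
  rcases (A.mem_P p).1 h with ⟨i, rfl⟩ | ⟨rfl, -⟩
  exacts [A.hp i, Nat.prime_three]

theorem ram_of_P (w : HeightOneSpectrum (𝓞 K)) (p : ℕ) (h : p ∈ A.P) (hw : (p : 𝓞 K) ∈ w.asIdeal) :
    ram F w = 3 := by
  rcases (A.mem_P p).1 h with ⟨i, rfl⟩ | ⟨rfl, h9⟩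
  · obtain ⟨m', h1, h2⟩ := A.factq i
    exact C.ram_q w (A.q i) (A.t i) m' (A.hp i) (A.h3 i) (A.ht i) h1 h2 hw
  · have hw' : (3 : 𝓞 K) ∈ w.asIdeal := by exact_mod_cast hw
    by_cases hs : A.s = 0
    · have := A.hm
      rw [hs, pow_zero, one_mul] at this
      exact C.ram_3' w (by rw [this]; exact A.fact3) h9 hw'
    · exact C.ram_3 w A.s _ (by have := A.hs; omega) A.hm A.fact3 hw'

theorem ram_P (w : HeightOneSpectrum (𝓞 K)) (hr : ram F w = 3) : ∃ p ∈ A.P, (p : 𝓞 K) ∈ w.asIdeal := by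
  by_cases h3 : (3 : 𝓞 K) ∈ w.asIdeal
  · by_cases h9 : C.m % 9 = 1 ∨ C.m % 9 = 8
    · exfalso
      have h1 : ram F w = 1 := by
        rcases h9 with h | h
        · exact C.ram_lam1 w h3 1 ((C.m : ℤ) / 9) (by norm_num) (by omega)
        · exact C.ram_lam1 w h3 (-1) ((C.m : ℤ) / 9 + 1) (by norm_num) (by omega)
      omega
    · exact ⟨3, (A.mem_P 3).2 (Or.inr ⟨rfl, h9⟩), by exact_mod_cast h3⟩
  · by_cases hm : (C.m : 𝓞 K) ∈ w.asIdeal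
    · rw [A.hm] at hm
      push_cast at hm
      rcases w.isPrime.mem_or_mem hm with h | h
      · exact absurd (w.isPrime.mem_of_pow_mem _ h) h3
      · obtain ⟨i, -, hi⟩ := (Ideal.IsPrime.prod_mem_iff (p := w.asIdeal)).1 h
        exact ⟨A.q i, (A.mem_P _).2 (Or.inl ⟨i, rfl⟩), w.isPrime.mem_of_pow_mem _ hi⟩
    · have := C.ram_unram w h3 hm
      omega

theorem P_uniq (w w' : HeightOneSpectrum (𝓞 K)) (p : ℕ) (h : p ∈ A.P) (hw : (p : 𝓞 K) ∈ w.asIdeal)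
    (hw' : (p : 𝓞 K) ∈ w'.asIdeal) : w' = w := by
  have hu : und F w = und F w' := by
    rw [← CubicData.natCast_und (F := F)] at hw hw'
    apply HeightOneSpectrum.ext
    rcases (A.mem_P p).1 h with ⟨i, rfl⟩ | ⟨rfl, h9⟩
    · rw [place_eq_of_prime _ _ (irr_q C.hz (A.hp i) (A.h3 i)) hw,
        place_eq_of_prime _ _ (irr_q C.hz (A.hp i) (A.h3 i)) hw']
    · rw [lam_asIdeal C.hz _ (by exact_mod_cast hw), lam_asIdeal C.hz _ (by exact_mod_cast hw')]
  have hf := C.fixed_of_ram w (A.ram_of_P w p h hw)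
  have := C.trans_over w w' hu
  rw [hf, hf] at this
  tauto

theorem P_exists (p : A.P) : ∃ w : HeightOneSpectrum (𝓞 K), ((p : ℕ) : 𝓞 K) ∈ w.asIdeal := by
  have hp := A.P_prime p p.2
  have hnu : ¬ IsUnit ((p : ℕ) : 𝓞 K) := by
    intro h
    have h1 := h.map (Algebra.norm ℤ)
    have : ((p : ℕ) : 𝓞 K) = algebraMap ℤ (𝓞 K) (p : ℕ) := by simp
    rw [this, Algebra.norm_algebraMap] at h1
    have h2 := (isUnit_pow_iff (Module.finrank_pos (R := ℤ) (M := 𝓞 K)).ne').1 h1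
    rw [Int.isUnit_iff] at h2
    have := hp.one_lt
    omega
  obtain ⟨M, hM, hmem⟩ := exists_max_ideal_of_mem_nonunits hnu
  refine ⟨⟨M, hM.isPrime, ?_⟩, hmem⟩
  rintro rfl
  rw [Ideal.mem_bot] at hmem
  exact hp.ne_zero (by exact_mod_cast hmem)

noncomputable def wP (p : A.P) : HeightOneSpectrum (𝓞 K) := (A.P_exists p).choose
theorem wP_mem (p : A.P) : ((p : ℕ) : 𝓞 K) ∈ (A.wP p).asIdeal := (A.P_exists p).choose_spec
theorem wP_inj : Function.Injective A.wP := by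
  intro p p' h
  by_contra hne
  have h1 := A.wP_mem p
  have h2 := A.wP_mem p'
  rw [h] at h1
  exact coprime_not_mem _ _ _ ((Nat.coprime_primes (A.P_prime p p.2) (A.P_prime p' p'.2)).2
    (fun e => hne (Subtype.ext e))) h1 h2

theorem wP_ram (p : A.P) : ram F (A.wP p) = 3 := A.ram_of_P _ p p.2 (A.wP_mem p)

theorem wP_surj (A : AD C) (w : HeightOneSpectrum (𝓞 K)) (hr : ram F w = 3) : ∃ p, w = A.wP p := by
  obtain ⟨p, hp, h⟩ := A.ram_P w hr
  exact ⟨⟨p, hp⟩, A.P_uniq _ _ p hp (A.wP_mem ⟨p, hp⟩) h⟩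

theorem t_fixed (A : AD C) (w : HeightOneSpectrum (𝓞 K)) (hr : ram F w = 3) : C.t w = w := by
  obtain ⟨p, hp, h⟩ := A.ram_P w hr
  refine A.P_uniq _ _ p hp h ?_
  exact (mem_gal C.τ w (p : 𝓞 K) (p : 𝓞 K) (by simp)).2 h

theorem dOp_ker_iff {I : Type*} [AddCommGroup I] (S : I →+ I) (x : I) : x ∈ (dOp S).ker ↔ S x = x := by
  rw [AddMonoidHom.mem_ker, dOp_apply, sub_eq_zero, eq_comm]

theorem unitH_fix (x : Additive Kˣ) : unitH (C.σ : K ≃+* K) x = x ↔ ∃ f : Fˣ, x = Additive.ofMul (CubicData.Fm F K f) := by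
  constructor
  · intro h
    have h1 : C.σ ((x.toMul : Kˣ) : K) = (x.toMul : Kˣ) := by
      conv_rhs => rw [← h]
      rfl
    obtain ⟨a, ha⟩ := C.fixed_mem h1
    have h0 : a ≠ 0 := by
      rintro rfl
      rw [map_zero] at ha
      exact x.toMul.ne_zero ha.symm
    refine ⟨Units.mk0 a h0, ?_⟩
    apply Additive.toMul.injective
    ext
    exact ha.symm
  · rintro ⟨f, rfl⟩
    exact congrArg Additive.ofMul (C.sg_Fm f)

theorem dv_fix (D : Dv (𝓞 K)) (h1 : permH C.s D = D) (h2 : ∀ w, ram F w = 3 → 3 ∣ D w) :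
    ∃ f, unitH (C.σ : K ≃+* K) f = f ∧ dvH (𝓞 K) K f = D := by
  obtain ⟨f, hf⟩ := C.descend D ((C.D_fixed_iff D).1 h1) h2
  exact ⟨_, (unitH_fix _).2 ⟨f, rfl⟩, hf⟩

theorem hN (C : CubicData F K) (D : Dv (𝓞 K)) : ∃ f, unitH (C.σ : K ≃+* K) f = f ∧ nOp (permH C.s) D = dvH (𝓞 K) K f := by
  obtain ⟨f, h1, h2⟩ := dv_fix (C := C) (nOp (permH C.s) D) (by
    rw [nOp_apply, map_add, map_add]
    have : permH C.s (permH C.s (permH C.s D)) = D := by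
      ext w
      rw [permH_apply, permH_apply, permH_apply]
      congr 1
      rw [Equiv.symm_apply_eq, Equiv.symm_apply_eq, Equiv.symm_apply_eq, C.s3]
    rw [this]; abel) (by
    intro w hw
    have hf := C.fixed_of_ram w hw
    have hf' : C.s.symm w = w := by rw [Equiv.symm_apply_eq, hf]
    rw [nOp_apply, Finsupp.add_apply, Finsupp.add_apply, permH_apply, permH_apply, hf', permH_apply, hf']
    exact ⟨D w, by ring⟩)
  exact ⟨f, h1, h2.symm⟩

theorem hfix (A : AD C) (hTS : ∀ x : Dv (𝓞 K), permH C.t (permH C.s x) = permH C.s (permH C.s (permH C.t x)))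
    (D : Dv (𝓞 K)) (h : permH C.s D = D) : permH C.t D - D ∈ (dvH (𝓞 K) K).range := by
  have hs3 : ∀ D : Dv (𝓞 K), permH C.s (permH C.s (permH C.s D)) = D := by
      intro D
      ext w
      rw [permH_apply, permH_apply, permH_apply]
      congr 1
      rw [Equiv.symm_apply_eq, Equiv.symm_apply_eq, Equiv.symm_apply_eq, C.s3]
  have h1 : permH C.s (permH C.t D) = permH C.t D := by
    have := hTS D
    rw [h] at this
    conv_lhs => rw [this]
    rw [hs3]
  obtain ⟨f, -, hf⟩ := dv_fix (C := C) (permH C.t D - D) (by rw [map_sub, h1, h]) (by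
    intro w hw
    have hf := A.t_fixed w hw
    have hf' : C.t.symm w = w := by rw [Equiv.symm_apply_eq, hf]
    rw [Finsupp.sub_apply, permH_apply, hf']
    simp)
  exact ⟨f, hf⟩

noncomputable def φ (A : AD C) : Dv (𝓞 K) →+ (A.P → ZMod 3) where
  toFun D p := ((D (A.wP p) : ℤ) : ZMod 3)
  map_zero' := by ext; simp
  map_add' x y := by ext; simp

theorem hT : (((dOp (unitH (C.σ : K ≃+* K))).ker).map (dvH (𝓞 K) K)).relIndex (dOp (permH C.s)).ker = 3 ^ A.P.card := by
  have h1 : ((dOp (unitH (C.σ : K ≃+* K))).ker).map (dvH (𝓞 K) K) = A.φ.ker ⊓ (dOp (permH C.s)).ker := by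
    ext D
    rw [AddSubgroup.mem_map, AddSubgroup.mem_inf, dOp_ker_iff]
    constructor
    · rintro ⟨x, hx, rfl⟩
      rw [dOp_ker_iff] at hx
      constructor
      · obtain ⟨f, rfl⟩ := (unitH_fix x).1 hx
        rw [AddMonoidHom.mem_ker]
        ext p
        show ((ordZ (A.wP p) (CubicData.Fm F K f) : ℤ) : ZMod 3) = 0
        rw [ordZ_ram, A.wP_ram]
        rw [ZMod.intCast_zmod_eq_zero_iff_dvd]
        exact dvd_mul_right _ _
      · conv_rhs => rw [← hx]
        exact (dvH_gal _ _).symm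
    · rintro ⟨hk, hs⟩
      rw [AddMonoidHom.mem_ker] at hk
      obtain ⟨f, hf, hd⟩ := dv_fix (C := C) D hs (by
        intro w hw
        obtain ⟨p, rfl⟩ := A.wP_surj w hw
        have := congrFun hk p
        exact (ZMod.intCast_zmod_eq_zero_iff_dvd _ 3).1 this)
      exact ⟨f, (dOp_ker_iff _ _).2 hf, hd⟩
  rw [h1, AddSubgroup.inf_relIndex_right, AddSubgroup.relIndex_ker]
  have h2 : ((dOp (permH C.s)).ker).map A.φ = ⊤ := by
    rw [eq_top_iff]
    intro a _
    classical
    refine ⟨∑ p : A.P, Finsupp.single (A.wP p) ((a p).val : ℤ), ?_, ?_⟩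
    · rw [SetLike.mem_coe, dOp_ker_iff, map_sum]
      refine Finset.sum_congr rfl fun p _ => ?_
      rw [permH_single, C.fixed_of_ram _ (A.wP_ram p)]
    · ext p
      show (((∑ p : A.P, Finsupp.single (A.wP p) ((a p).val : ℤ) : Dv (𝓞 K)) (A.wP p) : ℤ) : ZMod 3) = a p
      rw [Finsupp.finsetSum_apply, Finset.sum_eq_single p]
      · rw [Finsupp.single_eq_same]; simp
      · intro p' _ hne
        exact Finsupp.single_eq_of_ne (fun e => hne (A.wP_inj e).symm)
      · simp
  rw [h2, Nat.card_congr AddSubgroup.topEquiv.toEquiv]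
  simp
end AD
end

section
open NumberField
set_option linter.unusedSectionVars false

theorem idx_three {M : Type*} [AddCommGroup M] (b : Module.Basis (Fin 2) ℤ M) :
    (zsmulAddGroupHom (3 : ℤ) : M →+ M).range.index = 9 := by
  let φ : M →+ (Fin 2 → ZMod 3) :=
    { toFun := fun x i => ((b.repr x i : ℤ) : ZMod 3)
      map_zero' := by ext; simp
      map_add' := fun x y => by ext; simp }
  have hk : (zsmulAddGroupHom (3 : ℤ) : M →+ M).range = φ.ker := by
    ext x
    rw [AddMonoidHom.mem_ker]
    constructor
    · rintro ⟨y, rfl⟩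
      ext i
      show ((b.repr ((3 : ℤ) • y) i : ℤ) : ZMod 3) = 0
      rw [map_zsmul, Finsupp.smul_apply, ZMod.intCast_zmod_eq_zero_iff_dvd]
      exact dvd_mul_right _ _
    · intro h
      have h1 : ∀ i, (3 : ℤ) ∣ b.repr x i := fun i =>
        (ZMod.intCast_zmod_eq_zero_iff_dvd _ 3).1 (congrFun h i)
      choose c hc using h1
      refine ⟨∑ i, c i • b i, ?_⟩
      show (3 : ℤ) • ∑ i, c i • b i = x
      conv_rhs => rw [← b.sum_repr x]
      rw [Finset.smul_sum]
      exact Finset.sum_congr rfl fun i _ => by rw [hc, smul_smul]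
  have hs : Function.Surjective φ := by
    intro a
    refine ⟨∑ i, ((a i).val : ℤ) • b i, ?_⟩
    ext i
    show ((b.repr (∑ i, ((a i).val : ℤ) • b i) i : ℤ) : ZMod 3) = a i
    rw [b.repr_sum_self]
    simp
  rw [hk, AddSubgroup.index_ker, AddMonoidHom.range_eq_top.2 hs, Nat.card_congr AddSubgroup.topEquiv.toEquiv]
  simp

theorem idx_g {M : Type*} [AddCommGroup M] (b : Module.Basis (Fin 2) ℤ M) (g σ : M →+ M)
    (hσ : ∀ x, σ (σ (σ x)) = x) (hg : ∀ x, g (g x) = - ((3 : ℤ) • σ x)) : g.range.index = 3 := by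
  have : Module.Free ℤ M := Module.Free.of_basis b
  have hinj : Function.Injective g := by
    rw [injective_iff_map_eq_zero]
    intro x hx
    have := hg x
    rw [hx, map_zero] at this
    have h2 : (3 : ℤ) • σ x = 0 := by rw [← neg_eq_zero, ← this]
    have h3 : σ x = 0 := (smul_eq_zero.1 h2).resolve_left (by norm_num)
    rw [← hσ x, h3, map_zero, map_zero]
  have h1 : (g.range.map g) = (zsmulAddGroupHom (3 : ℤ) : M →+ M).range := by
    ext x
    constructor
    · rintro ⟨_, ⟨y, rfl⟩, rfl⟩
      exact ⟨- σ y, by rw [hg]; simp⟩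
    · rintro ⟨y, rfl⟩
      refine ⟨g (- σ (σ y)), ⟨_, rfl⟩, ?_⟩
      rw [hg, map_neg, hσ]; simp
  have h2 := AddSubgroup.relIndex_mul_index (AddMonoidHom.map_range g g ▸ AddSubgroup.map_le_range g g.range : g.range.map g ≤ g.range)
  have h3 := AddSubgroup.relIndex_map_map_of_injective g.range ⊤ hinj
  rw [AddSubgroup.relIndex_top_right, ← AddMonoidHom.range_eq_map] at h3
  rw [h3, h1, idx_three b] at h2
  nlinarith

theorem card_rel_aux {U : Type*} [CommGroup U] {H T : Subgroup U} (h : H ≤ T) :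
    Nat.card H * H.relIndex T = Nat.card T := by
  rw [← Subgroup.relIndex_bot_left, ← Subgroup.relIndex_bot_left]
  exact Subgroup.relIndex_mul_relIndex _ _ _ bot_le h

theorem div_aux {U : Type*} [CommGroup U] (a b c : U) : (a / b) / (b / c) = a * b * c / b ^ 3 := by
  have : ∀ x y w : Additive U, (x - y) - (y - w) = x + y + w - 3 • y := by intro x y w; abel
  exact this (Additive.ofMul a) (Additive.ofMul b) (Additive.ofMul c)

theorem idx_abs {U : Type*} [CommGroup U] (T : Subgroup U) [Finite T] (f : U →* U)
    (hT : ∀ x, f x ∈ T ↔ x ∈ T) (hk : Nat.card f.ker = 6)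
    (hΛ : (QuotientGroup.map T T f (fun x hx => (hT x).2 hx)).range.index = 3) : f.range.index = 18 := by
  have h1 : (QuotientGroup.map T T f (fun x hx => (hT x).2 hx)).range.comap (QuotientGroup.mk' T) = f.range ⊔ T := by
    ext x
    rw [Subgroup.mem_comap, Subgroup.mem_sup]
    constructor
    · rintro ⟨y, hy⟩
      obtain ⟨y, rfl⟩ := QuotientGroup.mk'_surjective T y
      have h2 : (f y)⁻¹ * x ∈ T := QuotientGroup.eq.1 hy
      exact ⟨f y, ⟨y, rfl⟩, _, h2, by simp⟩
    · rintro ⟨_, ⟨y, rfl⟩, u, hu, rfl⟩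
      refine ⟨QuotientGroup.mk' T y, ?_⟩
      show QuotientGroup.mk' T (f y) = QuotientGroup.mk' T (f y * u)
      apply QuotientGroup.eq.2
      simpa using hu
  have h2 : (f.range ⊔ T).index = 3 := by
    rw [← h1, Subgroup.index_comap_of_surjective _ (QuotientGroup.mk'_surjective T), hΛ]
  have h3 : f.range.relIndex (f.range ⊔ T) = 6 := by
    rw [sup_comm, Subgroup.relIndex_sup_right, ← Subgroup.inf_relIndex_right]
    have e : f.range ⊓ T = T.map f := by
      ext x
      constructor
      · rintro ⟨⟨y, rfl⟩, hx⟩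
        exact ⟨y, (hT y).1 hx, rfl⟩
      · rintro ⟨y, hy, rfl⟩
        exact ⟨⟨y, rfl⟩, (hT y).2 hy⟩
    have hle : T.map f ≤ T := by rw [← e]; exact inf_le_right
    rw [e]
    have a1 := card_rel_aux hle
    have a2 := Subgroup.relIndex_ker T f
    have hle2 : f.ker ≤ T := fun x hx => (hT x).1 (by rw [MonoidHom.mem_ker] at hx; rw [hx]; exact T.one_mem)
    have a3 := card_rel_aux hle2
    rw [a2, hk, ← a1, mul_comm] at a3
    exact (Nat.eq_of_mul_eq_mul_left (Nat.pos_of_ne_zero (by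
      have : Finite (T.map f) := Finite.Set.subset (T : Set U) hle
      exact Nat.card_pos.ne')) a3).symm
  have h4 := Subgroup.relIndex_mul_index (le_sup_left : f.range ≤ f.range ⊔ T)
  rw [h3, h2] at h4
  exact h4.symm

theorem rank_two {K : Type*} [Field K] [NumberField K] (ζ : K) (hζ : IsPrimitiveRoot ζ 3) (h6 : Module.finrank ℚ K = 6) :
    Units.rank K = 2 := by
  have h1 := InfinitePlace.card_add_two_mul_card_eq_rank K
  have h2 := InfinitePlace.IsPrimitiveRoot.nrRealPlaces_eq_zero_of_two_lt (by norm_num) hζ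
  have h3 := InfinitePlace.card_eq_nrRealPlaces_add_nrComplexPlaces K
  unfold Units.rank
  omega

theorem idx_units {K : Type*} [Field K] [NumberField K] (hr : Units.rank K = 2) (σ : (𝓞 K)ˣ →* (𝓞 K)ˣ)
    (hσ : ∀ x, σ (σ (σ x)) = x) (hN : ∀ x, x * σ x * σ (σ x) ∈ Units.torsion K) (f : (𝓞 K)ˣ →* (𝓞 K)ˣ)
    (hf : ∀ x, f x = x / σ x) (hk : Nat.card f.ker = 6) : f.range.index = 18 := by
  have hσT : ∀ x, x ∈ Units.torsion K → σ x ∈ Units.torsion K := by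
    intro x hx
    rw [Units.torsion, CommGroup.mem_torsion] at hx ⊢
    exact σ.isOfFinOrder hx
  have hff : ∀ x, f (f x) = (x * σ x * σ (σ x)) / (σ x) ^ 3 := by
    intro x
    rw [hf, hf, map_div]; exact div_aux _ _ _
  have hfT : ∀ x, f x ∈ Units.torsion K ↔ x ∈ Units.torsion K := by
    intro x
    constructor
    · intro h
      have h2 : f (f x) ∈ Units.torsion K := by
        rw [hf]; exact Subgroup.div_mem _ h (hσT _ h)
      rw [hff] at h2
      have h3 : (σ x) ^ 3 ∈ Units.torsion K := by
        have := Subgroup.div_mem _ (hN x) h2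
        simpa using this
      have h4 : σ x ∈ Units.torsion K := by
        rw [Units.torsion, CommGroup.mem_torsion] at h3 ⊢
        exact h3.of_pow (by norm_num)
      have := hσT _ (hσT _ h4)
      rwa [hσ] at this
    · intro h
      rw [hf]; exact Subgroup.div_mem _ h (hσT _ h)
  apply idx_abs (Units.torsion K) f hfT hk
  let g := QuotientGroup.map (Units.torsion K) (Units.torsion K) f (fun x hx => (hfT x).2 hx)
  let σ' := QuotientGroup.map (Units.torsion K) (Units.torsion K) σ (fun x hx => hσT x hx)
  have h1 : ∀ x, σ' (σ' (σ' x)) = x := by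
    intro x
    obtain ⟨x, rfl⟩ := QuotientGroup.mk'_surjective _ x
    show QuotientGroup.mk' _ (σ (σ (σ x))) = _
    rw [hσ]
  have h2 : ∀ x, g (g x) = (σ' x ^ (3 : ℤ))⁻¹ := by
    intro x
    obtain ⟨x, rfl⟩ := QuotientGroup.mk'_surjective _ x
    show QuotientGroup.mk' _ (f (f x)) = (QuotientGroup.mk' _ (σ x) ^ (3 : ℤ))⁻¹
    rw [hff, map_div, show QuotientGroup.mk' (Units.torsion K) (x * σ x * σ (σ x)) = 1 from (QuotientGroup.eq_one_iff _).2 (hN x), one_div, map_pow]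
    norm_cast
  let _ : AddCommGroup (Additive ((𝓞 K)ˣ ⧸ Units.torsion K)) := Additive.addCommGroup
  have := idx_g (M := Additive ((𝓞 K)ˣ ⧸ Units.torsion K)) ((Units.basisModTorsion K).reindex (finCongr hr)) g.toAdditive σ'.toAdditive
    (fun x => h1 (Additive.toMul x)) (fun x => h2 (Additive.toMul x))
  exact this
end

section
open IsDedekindDomain NumberField
set_option linter.unusedSectionVars false

namespace CubicData
variable {F K : Type*} [Field F] [NumberField F] [Field K] [NumberField K] [Algebra F K]
  (C : CubicData F K)

theorem uext {x y : Additive Kˣ} (h : ((x.toMul : Kˣ) : K) = (y.toMul : Kˣ)) : x = y :=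
  Additive.toMul.injective (Units.ext h)

theorem us3 (x : Additive Kˣ) : unitH (C.σ : K ≃+* K) (unitH (C.σ : K ≃+* K) (unitH (C.σ : K ≃+* K) x)) = x :=
  uext (C.σ3 _)

theorem ps3 (D : Dv (𝓞 K)) : permH C.s (permH C.s (permH C.s D)) = D := by
  ext w
  rw [permH_apply, permH_apply, permH_apply]
  congr 1
  rw [Equiv.symm_apply_eq, Equiv.symm_apply_eq, Equiv.symm_apply_eq, C.s3]

theorem nOp_coe (x : Additive Kˣ) : (((nOp (unitH (C.σ : K ≃+* K)) x).toMul : Kˣ) : K) =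
    (x.toMul : Kˣ) * C.σ (x.toMul : Kˣ) * C.σ (C.σ (x.toMul : Kˣ)) := rfl

theorem h90L (x : Additive Kˣ) (hx : nOp (unitH (C.σ : K ≃+* K)) x = 0) :
    ∃ y, x = dOp (unitH (C.σ : K ≃+* K)) y := by
  have hN := C.nOp_coe x
  rw [hx] at hN
  set u : K := ((x.toMul : Kˣ) : K) with hu
  have hN : u * C.σ u * C.σ (C.σ u) = 1 := hN.symm
  let y : K → K := fun c => c + u * C.σ c + u * C.σ u * C.σ (C.σ c)
  have hy : ∀ c, u * C.σ (y c) = y c := by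
    intro c
    simp only [y, map_add, map_mul, C.σ3]
    linear_combination c * hN
  have hex : ∃ c, y c ≠ 0 := by
    by_contra hall
    push Not at hall
    have h1 := hall 1
    have h2 := hall C.α
    have h3 := hall (C.α ^ 2)
    simp only [y, map_one, map_pow, map_mul, C.hσ, AlgEquiv.commutes] at h1 h2 h3
    set Z := algebraMap F K C.z
    have hz := C.zsumK
    have ha := C.hα0
    have hz3 := C.zK3
    have e2 : 1 + u * Z + u * C.σ u * Z ^ 2 = 0 := by
      have : C.α * (1 + u * Z + u * C.σ u * Z ^ 2) = 0 := by linear_combination h2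
      exact (mul_eq_zero.1 this).resolve_left ha
    have e3 : 1 + u * Z ^ 2 + u * C.σ u * Z ^ 4 = 0 := by
      have : C.α ^ 2 * (1 + u * Z ^ 2 + u * C.σ u * Z ^ 4) = 0 := by linear_combination h3
      exact (mul_eq_zero.1 this).resolve_left (pow_ne_zero 2 ha)
    have : (3 : K) = 0 := by
      linear_combination h1 + e2 + e3 - u * hz - u * C.σ u * (Z ^ 2 - Z + 1) * hz + 0 * hz3
    norm_num at this
  obtain ⟨c, hc⟩ := hex
  refine ⟨Additive.ofMul (Units.mk0 _ hc), ?_⟩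
  rw [dOp_apply, eq_sub_iff_add_eq]
  apply uext
  exact hy c

variable [IsCyclotomicExtension {3} ℚ F]

theorem frep (a : F) : ∃ p q : ℚ, a = p + q * C.z := by
  obtain ⟨x, y, hy, rfl⟩ := IsFractionRing.div_surjective (A := 𝓞 F) a
  have hy0 : y ≠ 0 := nonZeroDivisors.ne_zero hy
  obtain ⟨a, b, rfl⟩ := eis_rep C.hz x
  obtain ⟨c, d, rfl⟩ := eis_rep C.hz y
  have hz := C.zsum
  have hi : algebraMap (𝓞 F) F C.hz.toInteger = C.z := rfl
  have hN : c ^ 2 - c * d + d ^ 2 ≠ 0 := by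
    intro h
    apply hy0
    have h1 : (2 * c - d) ^ 2 + 3 * d ^ 2 = 0 := by linear_combination 4 * h
    have hd : d = 0 := by nlinarith [sq_nonneg (2 * c - d), sq_nonneg d]
    have hc : c = 0 := by rw [hd] at h; simpa using h
    simp [hd, hc]
  have hNF : (c : F) ^ 2 - c * d + d ^ 2 ≠ 0 := by exact_mod_cast hN
  have hy1 : (c : F) + d * C.z ≠ 0 := by
    intro h
    apply hy0
    apply FaithfulSMul.algebraMap_injective (𝓞 F) F
    simpa [hi] using h
  refine ⟨((a : ℚ) * (c - d) + b * d) / (c ^ 2 - c * d + d ^ 2), (b * c - a * d) / (c ^ 2 - c * d + d ^ 2), ?_⟩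
  push_cast
  simp only [map_add, map_mul, map_intCast, hi]
  rw [div_mul_eq_mul_div, ← add_div, div_eq_div_iff hy1 hNF]
  linear_combination ((a : F) * d ^ 2 - b * c * d) * hz

theorem τF (p q : ℚ) : C.τ (algebraMap F K (p + q * C.z)) = algebraMap F K (p + q * C.z ^ 2) := by
  simp [C.hτz]

theorem τF' (a : F) : ∃ b : F, C.τ (algebraMap F K a) = algebraMap F K b ∧ C.τ (algebraMap F K b) = algebraMap F K a := by
  obtain ⟨p, q, rfl⟩ := C.frep a
  refine ⟨_, C.τF p q, ?_⟩
  have := C.zK3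
  simp only [map_add, map_mul, map_ratCast, map_pow, C.hτz]
  linear_combination (q : K) * algebraMap F K C.z * this

theorem τσ (x : K) : C.τ (C.σ x) = C.σ (C.σ (C.τ x)) := by
  have hF : ∀ a : F, C.σ (C.τ (algebraMap F K a)) = C.τ (algebraMap F K a) := by
    intro a
    obtain ⟨b, hb, -⟩ := C.τF' a
    rw [hb, AlgEquiv.commutes]
  obtain ⟨a, b, c, rfl⟩ := C.rep x
  rw [C.σrep]
  simp only [map_add, map_mul, map_pow, C.hτα, C.hτz, C.hσ, hF, AlgEquiv.commutes]
  ring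

theorem ττ (x : K) : C.τ (C.τ x) = x := by
  have hF : ∀ a : F, C.τ (C.τ (algebraMap F K a)) = algebraMap F K a := by
    intro a
    obtain ⟨b, hb, h2⟩ := C.τF' a
    rw [hb, h2]
  obtain ⟨a, b, c, rfl⟩ := C.rep x
  simp only [map_add, map_mul, map_pow, C.hτα, hF]

theorem hts (x : Additive Kˣ) : unitH C.τ (unitH (C.σ : K ≃+* K) x) =
    unitH (C.σ : K ≃+* K) (unitH (C.σ : K ≃+* K) (unitH C.τ x)) := uext (C.τσ _)

theorem t2 (w) : C.t (C.t w) = w := by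
  rw [t, gal_comp, gal_eq _ (RingEquiv.refl K) (fun x => C.ττ x), gal_refl]

theorem ts (w) : C.t (C.s w) = C.s (C.s (C.t w)) := by
  rw [t, s, gal_comp, gal_comp, gal_comp]
  exact congrArg (fun g : Equiv.Perm (HeightOneSpectrum (𝓞 K)) => g w) (gal_eq _ _ (fun x => C.τσ x))

theorem T2 (D : Dv (𝓞 K)) : permH C.t (permH C.t D) = D := by
  ext w
  rw [permH_apply, permH_apply]
  congr 1
  rw [Equiv.symm_apply_eq, Equiv.symm_apply_eq, C.t2]

theorem hTS (D : Dv (𝓞 K)) : permH C.t (permH C.s D) = permH C.s (permH C.s (permH C.t D)) := by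
  ext w
  rw [permH_apply, permH_apply, permH_apply, permH_apply, permH_apply]
  congr 1
  rw [Equiv.symm_apply_eq, Equiv.symm_apply_eq, C.ts, Equiv.apply_symm_apply, Equiv.apply_symm_apply, Equiv.apply_symm_apply]

theorem unitF (f : Fˣ) (h : dvH (𝓞 K) K (Additive.ofMul (Fm F K f)) = 0) : 
    ∃ i : ℕ, (f : F) = C.z ^ i ∨ (f : F) = - C.z ^ i := by
  have h1 : ∀ v : HeightOneSpectrum (𝓞 F), ordZ v f = 0 := by
    intro v
    obtain ⟨w, rfl⟩ := exists_over (K := K) v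
    have h2 : ordZ w (Fm F K f) = 0 := DFunLike.congr_fun h w
    rw [ordZ_ram] at h2
    exact (mul_eq_zero.1 h2).resolve_left (ram_pos w).ne'
  obtain ⟨r, hr⟩ := exists_unit_of_ordZ f h1
  have := IsCyclotomicExtension.Rat.Three.Units.mem C.hz r
  have e : (f : F) = algebraMap (𝓞 F) F r := hr.symm
  have hi : algebraMap (𝓞 F) F C.hz.toInteger = C.z := rfl
  simp only [List.mem_cons, List.not_mem_nil, or_false] at this
  rw [e]
  rcases this with h | h | h | h | h | h <;> rw [h]
  · exact ⟨0, Or.inl (by simp)⟩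
  · exact ⟨0, Or.inr (by simp)⟩
  · exact ⟨1, Or.inl (by simp [hi])⟩
  · exact ⟨1, Or.inr (by simp [hi])⟩
  · exact ⟨2, Or.inl (by simp [hi])⟩
  · exact ⟨2, Or.inr (by simp [hi])⟩

theorem hEsq [IsPrincipalIdealRing (𝓞 F)] (x : Additive Kˣ) (h : dvH (𝓞 K) K x = 0) (hs : unitH (C.σ : K ≃+* K) x = x) : unitH C.τ x = - x := by
  obtain ⟨f, rfl⟩ := (AD.unitH_fix x).1 hs
  rw [eq_neg_iff_add_eq_zero]
  apply uext
  show C.τ (algebraMap F K f) * algebraMap F K f = 1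
  have h3 := C.zK3
  obtain ⟨i, hi | hi⟩ := C.unitF f h <;> rw [hi] <;> simp only [map_neg, map_pow, C.hτz]
  · rw [← mul_pow]
    have : algebraMap F K C.z ^ 2 * algebraMap F K C.z = 1 := by linear_combination h3
    rw [this, one_pow]
  · rw [neg_mul_neg, ← mul_pow]
    have : algebraMap F K C.z ^ 2 * algebraMap F K C.z = 1 := by linear_combination h3
    rw [this, one_pow]
end CubicData
end

section
open IsDedekindDomain NumberField
set_option linter.unusedSectionVars false

theorem prim6 {K : Type*} [Field K] [CharZero K] (Z : K) (h : 1 + Z + Z ^ 2 = 0) : IsPrimitiveRoot (-Z) 6 := by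
  have h3 : Z ^ 3 = 1 := by linear_combination (Z - 1) * h
  apply IsPrimitiveRoot.mk_of_lt _ (by norm_num)
  · linear_combination (Z ^ 3 + 1) * h3
  · intro l h0 h6 hl
    interval_cases l
    · exact one_ne_zero (α := K) (by linear_combination h + Z * hl)
    · have : (3 : K) = 0 := by linear_combination (2 - Z) * h - (2 - (1 + Z)) * hl
      norm_num at this
    · have : (2 : K) = 0 := by linear_combination -hl - h3
      norm_num at this
    · have : (3 : K) = 0 := by linear_combination (-Z - 2) * hl + (Z + 2) * Z * h3 + h
      norm_num at this
    · have : (1 : K) = 0 := by linear_combination -h3 + Z^2*(h+hl+Z^2*h3)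
      norm_num at this

namespace CubicData
variable {F K : Type*} [Field F] [NumberField F] [Field K] [NumberField K] [Algebra F K]
  (C : CubicData F K) [IsCyclotomicExtension {3} ℚ F]

theorem fix6 (x : K) (h : x ^ 6 = 1) : C.σ x = x ∧ ∃ i : ℕ, x = algebraMap F K (-C.z) ^ i := by
  obtain ⟨i, -, rfl⟩ := (prim6 _ C.zsumK).eq_pow_of_pow_eq_one h
  refine ⟨by rw [map_pow, map_neg, AlgEquiv.commutes], i, by simp⟩

theorem six_of (x : Kˣ) (hf : C.σ (x : K) = x) (h : dvH (𝓞 K) K (Additive.ofMul x) = 0) : 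
    ∃ i : ℕ, (x : K) = algebraMap F K C.z ^ i ∨ (x : K) = - algebraMap F K C.z ^ i := by
  obtain ⟨a, ha⟩ := C.fixed_mem hf
  have h0 : a ≠ 0 := by
    rintro rfl
    rw [map_zero] at ha
    exact x.ne_zero ha.symm
  have e : x = Fm F K (Units.mk0 a h0) := Units.ext ha.symm
  rw [e] at h
  obtain ⟨i, hi⟩ := C.unitF _ h
  refine ⟨i, ?_⟩
  rw [← ha]
  rcases hi with hi | hi
  · left; rw [← map_pow, ← hi]; rfl
  · right; rw [← map_pow, ← map_neg, ← hi]; rfl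

theorem pow6 (x : Kˣ) (hf : C.σ (x : K) = x) (h : dvH (𝓞 K) K (Additive.ofMul x) = 0) : (x : K) ^ 6 = 1 := by
  have h3 := C.zK3
  obtain ⟨i, h | h⟩ := C.six_of x hf h <;> rw [h]
  · rw [← pow_mul, show i * 6 = 3 * (2 * i) by ring, pow_mul, h3, one_pow]
  · rw [Even.neg_pow (by decide), ← pow_mul, show i * 6 = 3 * (2 * i) by ring, pow_mul, h3, one_pow]

noncomputable def ιU (K : Type*) [Field K] [NumberField K] : (𝓞 K)ˣ →* Kˣ := Units.map (algebraMap (𝓞 K) K : 𝓞 K →* K)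

theorem dv_ι (x : (𝓞 K)ˣ) : dvH (𝓞 K) K (Additive.ofMul (ιU K x)) = 0 := by
  ext w
  show ordZ w (ιU K x) = 0
  rw [ordZ_alg_eq_zero w _ (x : 𝓞 K) rfl]
  intro hx
  exact w.isPrime.ne_top (Ideal.eq_top_of_isUnit_mem _ hx x.isUnit)

theorem ι_inj : Function.Injective (ιU K) :=
  Units.map_injective (FaithfulSMul.algebraMap_injective (𝓞 K) K)

noncomputable def σU : (𝓞 K)ˣ →* (𝓞 K)ˣ := Units.map ((RingOfIntegers.mapRingEquiv (C.σ : K ≃+* K) : 𝓞 K →+* 𝓞 K) : 𝓞 K →* 𝓞 K)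

theorem ισ (x : (𝓞 K)ˣ) : ((ιU K (C.σU x) : Kˣ) : K) = C.σ ((ιU K x : Kˣ) : K) := rfl

theorem hE (h6 : Module.finrank ℚ K = 6) : 
    ((dvH (𝓞 K) K).ker.map (dOp (unitH (C.σ : K ≃+* K)))).relIndex (dvH (𝓞 K) K).ker = 18 := by
  let f : (𝓞 K)ˣ →* (𝓞 K)ˣ := MonoidHom.id _ / C.σU
  have hσ : ∀ x, C.σU (C.σU (C.σU x)) = x := by
    intro x
    apply ι_inj
    apply Units.ext
    rw [C.ισ, C.ισ, C.ισ, C.σ3]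
  have hfin : ∀ x, x ^ 6 = 1 → x ∈ Units.torsion K := by
    intro x hx
    rw [Units.torsion, CommGroup.mem_torsion, isOfFinOrder_iff_pow_eq_one]
    exact ⟨6, by norm_num, hx⟩
  have h6' : ∀ x : (𝓞 K)ˣ, C.σU x = x → x ^ 6 = 1 := by
    intro x hx
    apply ι_inj
    apply Units.ext
    rw [map_pow, Units.val_pow_eq_pow_val, map_one]
    exact C.pow6 _ (by rw [← C.ισ, hx]) (dv_ι x)
  have hk : Nat.card f.ker = 6 := by
    have e : f.ker = rootsOfUnity 6 (𝓞 K) := by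
      ext x
      rw [MonoidHom.mem_ker, mem_rootsOfUnity]
      have : f x = 1 ↔ C.σU x = x := by
        show x / C.σU x = 1 ↔ _
        rw [div_eq_one, eq_comm]
      rw [this]
      refine ⟨h6' x, fun h => ?_⟩
      apply ι_inj
      apply Units.ext
      rw [C.ισ]
      refine (C.fix6 _ ?_).1
      rw [← Units.val_pow_eq_pow_val, ← map_pow, h]; simp
    rw [e]
    have hp : IsPrimitiveRoot (algebraMap (𝓞 F) (𝓞 K) (-C.hz.toInteger)) 6 := by
      apply IsPrimitiveRoot.of_map_of_injective (f := algebraMap (𝓞 K) K) _ (FaithfulSMul.algebraMap_injective (𝓞 K) K)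
      convert prim6 _ C.zsumK using 1
      rw [map_neg, map_neg]
      rfl
    exact hp.card_rootsOfUnity
  have h18 := idx_units (rank_two (algebraMap F K C.z) (C.hz.map_of_injective (algebraMap F K).injective) h6) C.σU hσ (by
    intro x
    apply hfin
    apply h6'
    rw [map_mul, map_mul, hσ]
    rw [mul_comm, mul_assoc]) f (fun x => rfl) hk
  have e1 : (dvH (𝓞 K) K).ker = (⊤ : AddSubgroup (Additive (𝓞 K)ˣ)).map (ιU K).toAdditive := by
    ext x
    rw [AddMonoidHom.mem_ker]
    constructor
    · intro h
      obtain ⟨r, hr⟩ := exists_unit_of_ordZ (R := 𝓞 K) (x.toMul : Kˣ) (fun w => DFunLike.congr_fun h w)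
      exact ⟨Additive.ofMul r, trivial, uext hr⟩
    · rintro ⟨r, -, rfl⟩
      exact dv_ι _
  have e2 : (dvH (𝓞 K) K).ker.map (dOp (unitH (C.σ : K ≃+* K))) = (MonoidHom.toAdditive f).range.map (ιU K).toAdditive := by
    rw [e1]
    ext x
    constructor
    · rintro ⟨_, ⟨r, -, rfl⟩, rfl⟩
      refine ⟨MonoidHom.toAdditive f r, ⟨r, rfl⟩, ?_⟩
      rw [dOp_apply]
      exact map_div (ιU K) r.toMul (C.σU r.toMul)
    · rintro ⟨_, ⟨r, rfl⟩, rfl⟩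
      refine ⟨_, ⟨r, trivial, rfl⟩, ?_⟩
      rw [dOp_apply]
      exact (map_div (ιU K) r.toMul (C.σU r.toMul)).symm
  rw [e2, e1, AddSubgroup.relIndex_map_map_of_injective, AddSubgroup.relIndex_top_right]
  · exact h18
  · exact ι_inj

variable [IsPrincipalIdealRing (𝓞 F)]

theorem norm_cube (w : HeightOneSpectrum (𝓞 K)) (hr : ram F w = 3) (h3 : (3 : 𝓞 K) ∉ w.asIdeal) (y : Kˣ)
    (hy : (y : K) * C.σ y * C.σ (C.σ y) = algebraMap F K C.z) :
    ∃ n d : 𝓞 F, n ∉ (und F w).asIdeal ∧ d ∉ (und F w).asIdeal ∧ C.hz.toInteger * d ^ 3 - n ^ 3 ∈ (und F w).asIdeal := by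
  have hs := C.fixed_of_ram w hr
  have hσ := C.val_σ w hs
  set V := w.valuation K with hV
  have hVZ : V (algebraMap F K C.z) = 1 := by
    have : V (algebraMap F K C.z) ^ 3 = 1 := by rw [← map_pow, C.zK3, map_one]
    exact (pow_eq_one_iff.1 this).resolve_right (by norm_num)
  have hVy : V (y : K) = 1 := by
    have : V (y : K) ^ 3 = 1 := by
      rw [← hVZ, ← hy, map_mul, map_mul, hσ, hσ, hσ, pow_succ, pow_two]
    exact (pow_eq_one_iff.1 this).resolve_right (by norm_num)
  have hV1 : V (C.σ y) = 1 := by rw [hσ, hVy]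
  have hV2 : V (C.σ (C.σ y)) = 1 := by rw [hσ, hV1]
  have hd : V (C.σ y - y) < 1 := by
    apply lt_of_le_of_ne (Valuation.map_sub_le _ hV1.le hVy.le)
    intro h
    have := C.ram_one_of w hs y hVy.le h
    omega
  have hd1 : V (C.σ (C.σ y) - C.σ y) < 1 := by rw [← map_sub, hσ]; exact hd
  have hd2 : V (C.σ (C.σ y) - y) < 1 := by
    have : C.σ (C.σ (y : K)) - y = (C.σ (C.σ (y : K)) - C.σ y) + (C.σ y - y) := by ring
    rw [this]
    exact Valuation.map_add_lt _ hd1 hd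
  have hV3 : V (3 : K) = 1 := by
    have : V (algebraMap (𝓞 K) K 3) = 1 := (HeightOneSpectrum.valuation_eq_one_iff_notMem (K := K) w (r := (3 : 𝓞 K))).2 h3
    rwa [map_ofNat] at this
  obtain ⟨a', ha'⟩ := C.tr_mem (y : K)
  obtain ⟨a, rfl⟩ : ∃ a, a' = 3 * a := ⟨a' / 3, by field_simp⟩
  have ha : 3 * algebraMap F K a = y + C.σ y + C.σ (C.σ y) := by
    rw [← ha', map_mul, map_ofNat]
  have hay : V (algebraMap F K a - y) < 1 := by
    have h1 : V (3 * (algebraMap F K a - y)) < 1 := by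
      have : 3 * (algebraMap F K a - y) = (C.σ y - y) + (C.σ (C.σ y) - y) := by rw [mul_sub, ha]; ring
      rw [this]
      exact Valuation.map_add_lt _ hd hd2
    rwa [map_mul, hV3, one_mul] at h1
  have hVa : V (algebraMap F K a) = 1 := by
    have := Valuation.map_add_eq_of_lt_right V (x := algebraMap F K a - y) (y := (y : K)) (by rw [hVy]; exact hay)
    rw [hVy] at this
    simpa using this
  have ha1 : V (algebraMap F K a - C.σ y) < 1 := by
    have : algebraMap F K a - C.σ y = (algebraMap F K a - y) - (C.σ y - y) := by ring
    rw [this]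
    exact Valuation.map_sub_lt _ hay hd
  have ha2 : V (algebraMap F K a - C.σ (C.σ y)) < 1 := by
    have : algebraMap F K a - C.σ (C.σ y) = (algebraMap F K a - y) - (C.σ (C.σ y) - y) := by ring
    rw [this]
    exact Valuation.map_sub_lt _ hay hd2
  have hfin : V (algebraMap F K a ^ 3 - algebraMap F K C.z) < 1 := by
    have : algebraMap F K a ^ 3 - algebraMap F K C.z = (algebraMap F K a - y) * algebraMap F K a ^ 2
      + (algebraMap F K a - C.σ y) * (y * algebraMap F K a) + (algebraMap F K a - C.σ (C.σ y)) * (y * C.σ y) := by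
      rw [← hy]; ring
    rw [this]
    refine Valuation.map_add_lt _ (Valuation.map_add_lt _ ?_ ?_) ?_
    · simpa [hVa] using hay
    · simpa [hVa, hVy] using ha1
    · simpa [hV1, hVy] using ha2
  have ha0 : a ≠ 0 := by
    intro h
    rw [h, map_zero, map_zero] at hVa
    exact zero_ne_one hVa
  have ho : ordZ (und F w) (Units.mk0 a ha0) = 0 := by
    have h1 : ordZ w (Fm F K (Units.mk0 a ha0)) = 0 := (ordZ_eq_zero_iff w _).2 hVa
    rw [ordZ_ram] at h1
    exact (mul_eq_zero.1 h1).resolve_left (ram_pos w).ne'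
  obtain ⟨n, d, hn, hd, hnd⟩ := exists_frac_ordZ (und F w) _ ho
  refine ⟨n, d, hn, hd, ?_⟩
  rw [mem_und]
  have key : algebraMap (𝓞 K) K (algebraMap (𝓞 F) (𝓞 K) (C.hz.toInteger * d ^ 3 - n ^ 3)) = 
      - ((algebraMap F K a ^ 3 - algebraMap F K C.z) * algebraMap F K (algebraMap (𝓞 F) F d) ^ 3) := by
    have hnd' : a * algebraMap (𝓞 F) F d = algebraMap (𝓞 F) F n := hnd
    have : algebraMap (𝓞 K) K (algebraMap (𝓞 F) (𝓞 K) (C.hz.toInteger * d ^ 3 - n ^ 3)) = 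
      algebraMap F K (algebraMap (𝓞 F) F (C.hz.toInteger * d ^ 3 - n ^ 3)) := rfl
    rw [this]
    simp only [map_sub, map_mul, map_pow, ← hnd']
    have hi : algebraMap (𝓞 F) F C.hz.toInteger = C.z := rfl
    rw [hi]; ring
  rw [← HeightOneSpectrum.valuation_lt_one_iff_mem (K := K)]
  change V (algebraMap (𝓞 K) K (algebraMap (𝓞 F) (𝓞 K) (C.hz.toInteger * d ^ 3 - n ^ 3))) < 1
  rw [key, Valuation.map_neg, map_mul]
  have hVd : V (algebraMap F K (algebraMap (𝓞 F) F d) ^ 3) ≤ 1 := by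
    rw [map_pow]
    exact pow_le_one' (w.valuation_le_one (algebraMap (𝓞 F) (𝓞 K) d)) 3
  exact mul_lt_one_of_lt_of_le hfin hVd

theorem not_norm (w : HeightOneSpectrum (𝓞 K)) (hr : ram F w = 3) (q : ℕ) (hq : q.Prime) (hq3 : q % 3 = 2)
    (hw : (q : 𝓞 K) ∈ w.asIdeal) (y : Kˣ)
    (hy : (y : K) * C.σ y * C.σ (C.σ y) = algebraMap F K C.z) : q % 9 = 8 := by
  have h3 : (3 : 𝓞 K) ∉ w.asIdeal := by
    have := coprime_not_mem w q 3 ((Nat.coprime_primes hq Nat.prime_three).2 (by omega)) hw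
    exact_mod_cast this
  obtain ⟨n, d, hn, hd, h⟩ := C.norm_cube w hr h3 y hy
  let _ := Ideal.Quotient.field (und F w).asIdeal
  set mk := Ideal.Quotient.mk (und F w).asIdeal with hmk
  have hn0 : mk n ≠ 0 := by rwa [hmk, Ne, Ideal.Quotient.eq_zero_iff_mem]
  have hd0 : mk d ≠ 0 := by rwa [hmk, Ne, Ideal.Quotient.eq_zero_iff_mem]
  have e : mk C.hz.toInteger * mk d ^ 3 = mk n ^ 3 := by
    rw [← map_pow, ← map_pow, ← map_mul]
    exact Ideal.Quotient.eq.2 h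
  have hu : mk C.hz.toInteger ≠ 0 := by
    intro h0
    rw [h0, zero_mul] at e
    exact pow_ne_zero 3 hn0 e.symm
  refine (z_cube_iff C.hz hq hq3 (und F w) ((natCast_und w q).2 hw) (Units.mk0 _ hu) rfl).1 ⟨Units.mk0 _ hn0 / Units.mk0 _ hd0, ?_⟩
  apply Units.ext
  simp only [Units.val_mk0, Units.val_pow_eq_pow_val, Units.val_div_eq_div_val]
  field_simp
  exact e
end CubicData
end

section
open IsDedekindDomain NumberField
set_option linter.unusedSectionVars false

namespace AD
variable {F K : Type*} [Field F] [NumberField F] [Field K] [NumberField K] [Algebra F K]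
  [IsCyclotomicExtension {3} ℚ F] [IsPrincipalIdealRing (𝓞 F)] {C : CubicData F K} (A : AD C)

theorem hasse (C : CubicData F K) (b : Fˣ) (h : ∀ v : HeightOneSpectrum (𝓞 F), TameTriv v b C.mU) :
    ∃ y : Kˣ, (y : K) * C.σ y * C.σ (C.σ y) = algebraMap F K b := by
  have : Algebra.IsAlgebraic F K := by
    have : IsScalarTower ℚ F K := IsScalarTower.of_algebraMap_eq (fun x => by simp)
    exact Algebra.IsAlgebraic.tower_top (K := ℚ) F
  obtain ⟨y, hy⟩ := hasse_norm (eisE C.hz) C.hz C.mU b C.α (by rw [C.hα]; simp [CubicData.mU]) (by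
    rw [eq_top_iff]
    intro x _
    obtain ⟨a, b, c, rfl⟩ := C.rep x
    have hα : C.α ∈ IntermediateField.adjoin F {C.α} := IntermediateField.mem_adjoin_simple_self F C.α
    exact add_mem (add_mem (IntermediateField.algebraMap_mem _ a) (mul_mem (IntermediateField.algebraMap_mem _ b) hα))
      (mul_mem (IntermediateField.algebraMap_mem _ c) (pow_mem hα 2))) C.σ C.hσ h
  have h0 : y ≠ 0 := by
    rintro rfl
    rw [zero_mul, zero_mul] at hy
    exact b.ne_zero ((map_eq_zero_iff _ (algebraMap F K).injective).1 hy.symm)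
  exact ⟨Units.mk0 y h0, hy⟩

theorem m_cases (A : AD C) (v : HeightOneSpectrum (𝓞 F)) : (3 : 𝓞 F) ∈ v.asIdeal ∨ (∃ i, (A.q i : 𝓞 F) ∈ v.asIdeal) ∨
    ((C.m : 𝓞 F) ∉ v.asIdeal ∧ (3 : 𝓞 F) ∉ v.asIdeal) := by
  by_cases h3 : (3 : 𝓞 F) ∈ v.asIdeal
  · exact Or.inl h3
  by_cases hm : (C.m : 𝓞 F) ∈ v.asIdeal
  · right; left
    rw [A.hm] at hm
    push_cast at hm
    rcases v.isPrime.mem_or_mem hm with h | h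
    · exact absurd (v.isPrime.mem_of_pow_mem _ h) h3
    · obtain ⟨i, -, hi⟩ := (Ideal.IsPrime.prod_mem_iff (p := v.asIdeal)).1 h
      exact ⟨i, v.isPrime.mem_of_pow_mem _ hi⟩
  · exact Or.inr (Or.inr ⟨hm, h3⟩)

theorem ord_m (v : HeightOneSpectrum (𝓞 F)) (h : (C.m : 𝓞 F) ∉ v.asIdeal) : ordZ v C.mU = 0 :=
  (ordZ_alg_eq_zero v _ (C.m : 𝓞 F) (by simp [CubicData.mU])).2 h

theorem z_norm (A : AD C) (h8 : ∀ i, A.q i % 9 = 8) : ∃ y : Kˣ, (y : K) * C.σ y * C.σ (C.σ y) = algebraMap F K C.z := by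
  have hz0 : C.z ≠ 0 := C.hz.ne_zero (by norm_num)
  refine hasse C (Units.mk0 C.z hz0) fun v => ?_
  have hzv : C.hz.toInteger ∉ v.asIdeal := by
    intro h
    have : C.hz.toInteger ^ 3 = 1 := by
      apply FaithfulSMul.algebraMap_injective (𝓞 F) F
      rw [map_pow, map_one]
      exact C.z3
    exact v.isPrime.ne_top (Ideal.eq_top_of_isUnit_mem _ (v.asIdeal.pow_mem_of_mem h 3 (by norm_num)) (by rw [this]; exact isUnit_one))
  have h0 := (ordZ_alg_eq_zero v (Units.mk0 C.z hz0) C.hz.toInteger rfl).2 hzv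
  unfold TameTriv
  rw [h0, zpow_zero, div_one]
  rcases A.m_cases v with h | ⟨i, h⟩ | ⟨h, -⟩
  · exact ⟨_, lam_cube C.hz v h _⟩
  · obtain ⟨c, hc⟩ := (z_cube_iff C.hz (A.hp i) (A.h3 i) v h (resid F v (Units.mk0 C.z hz0))
      (resid_alg v _ C.hz.toInteger hzv rfl)).2 (h8 i)
    exact ⟨c ^ (ordZ v C.mU), by rw [hc]; rw [← zpow_natCast, ← zpow_natCast, ← zpow_mul, ← zpow_mul, mul_comm]⟩
  · exact ⟨1, by rw [ord_m v h]; simp⟩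

theorem t_s_fixed (w) (h : C.s w = w) : C.s (C.t w) = C.t w := by
  have h1 := C.ts w
  rw [h] at h1
  have h2 := congrArg C.s h1
  rw [C.s3] at h2
  exact h2

theorem key (A : AD C) (D : Dv (𝓞 K)) (f : Additive Kˣ) (hf : unitH (C.σ : K ≃+* K) f = f)
    (hD : dvH (𝓞 K) K f = nOp (permH C.s) D) : ∃ x, nOp (unitH (C.σ : K ≃+* K)) x = f + unitH C.τ f := by
  obtain ⟨g, rfl⟩ := (unitH_fix f).1 hf
  obtain ⟨p, q, hg⟩ := C.frep g
  have hb : algebraMap F K g * C.τ (algebraMap F K g) = ((p ^ 2 - p * q + q ^ 2 : ℚ) : K) := by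
    rw [hg, C.τF]
    have := C.zsumK
    have h3 := C.zK3
    simp only [map_add, map_mul, map_pow, map_ratCast]
    push_cast
    linear_combination (p * q : K) * this + (q : K) ^ 2 * h3
  set ρ : ℚ := p ^ 2 - p * q + q ^ 2 with hρ
  have hg0 : algebraMap F K g ≠ 0 := (map_ne_zero _).2 g.ne_zero
  have hρ0 : ρ ≠ 0 := by
    intro h
    rw [h, Rat.cast_zero] at hb
    rcases mul_eq_zero.1 hb with h | h
    · exact hg0 h
    · exact hg0 ((map_eq_zero_iff _ C.τ.injective).1 h)
  have hρF : (ρ : F) ≠ 0 := by exact_mod_cast hρ0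
  set b : Fˣ := Units.mk0 (ρ : F) hρF with hbdef
  have hbK : CubicData.Fm F K b = CubicData.Fm F K g * (unitH C.τ (Additive.ofMul (CubicData.Fm F K g))).toMul := by
    apply Units.ext
    show algebraMap F K (ρ : F) = algebraMap F K g * C.τ (algebraMap F K g)
    rw [hb, map_ratCast]
  have hord : ∀ w, C.s w = w → 3 ∣ ordZ w (CubicData.Fm F K b) := by
    intro w hw
    have hn : ∀ w, C.s w = w → (3 : ℤ) ∣ (nOp (permH C.s) D) w := by
      intro w hf
      have hf' : C.s.symm w = w := by rw [Equiv.symm_apply_eq, hf]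
      rw [nOp_apply, Finsupp.add_apply, Finsupp.add_apply, permH_apply, permH_apply, hf', permH_apply, hf']
      exact ⟨D w, by ring⟩
    rw [hbK, ordZ_mul]
    have e1 : ordZ w (CubicData.Fm F K g) = (nOp (permH C.s) D) w := by rw [← hD]; rfl
    have e2 : ordZ w ((unitH C.τ (Additive.ofMul (CubicData.Fm F K g))).toMul) = (nOp (permH C.s) D) (C.t.symm w) := by
      rw [← permH_apply, ← hD]
      have := dvH_gal C.τ (Additive.ofMul (CubicData.Fm F K g))
      exact DFunLike.congr_fun this w
    rw [e1, e2]
    refine dvd_add (hn w hw) (hn _ ?_)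
    have : C.t.symm w = C.t w := by rw [Equiv.symm_apply_eq, C.t2]
    rw [this]
    exact t_s_fixed w hw
  obtain ⟨y, hy⟩ := hasse C b (by
    intro v
    rcases A.m_cases v with h | ⟨i, h⟩ | ⟨hm, h3⟩
    · exact ⟨_, lam_cube C.hz v h _⟩
    · have hq0 : (A.q i : F) ≠ 0 := by exact_mod_cast (A.hp i).ne_zero
      have h1 : ordZ v (Units.mk0 (A.q i : F) hq0) = 1 :=
        ord_gen _ _ (place_eq_of_prime _ _ (irr_q C.hz (A.hp i) (A.h3 i)) h) _ (by simp)
      have hI := qgood_int (A.hp i) (A.h3 i) v h (Units.mk0 (A.q i : F) hq0) rfl h1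
      have hn0 : (ρ.num : F) ≠ 0 := by exact_mod_cast (Rat.num_ne_zero.2 hρ0)
      have hd0 : ((ρ.den : ℤ) : F) ≠ 0 := by exact_mod_cast ρ.den_ne_zero
      have hbq : b = Units.mk0 _ hn0 / Units.mk0 _ hd0 := by
        apply Units.ext
        rw [Units.val_div_eq_div_val]
        show (ρ : F) = (ρ.num : F) / ((ρ.den : ℤ) : F)
        rw [Rat.cast_def]; simp
      refine qgood_tame v (Units.mk0 (A.q i : F) hq0) _ _ ?_ (hI (C.m : ℤ) _ (by simp [CubicData.mU]))
      rw [hbq]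
      exact qgood_div _ _ _ _ (hI _ _ rfl) (hI _ _ rfl)
    · unfold TameTriv
      rw [ord_m v hm, zpow_zero, one_div]
      obtain ⟨w, rfl⟩ := exists_over (K := K) v
      by_cases hw : C.s w = w
      · have hr : ram F w = 1 := C.ram_unram w
          (fun h => h3 (by have := (CubicData.natCast_und (F := F) w 3).2 (by exact_mod_cast h); exact_mod_cast this))
          (fun h => hm ((CubicData.natCast_und (F := F) w C.m).2 h))
        obtain ⟨k, hk⟩ := hord w hw
        rw [ordZ_ram, hr, one_mul] at hk
        rw [hk]
        exact ⟨(resid F (und F w) C.mU ^ (-k)), by rw [← zpow_neg, ← zpow_natCast, ← zpow_mul]; congr 1; push_cast; ring⟩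
      · obtain ⟨β, hβ⟩ := C.α_int
        obtain ⟨c, hc⟩ := C.residue_nonfixed w hw β
        have hβ3 : β ^ 3 = (C.m : 𝓞 K) := by
          apply FaithfulSMul.algebraMap_injective (𝓞 K) K
          rw [map_pow, hβ, C.hα, map_natCast]
        have hcm : c ^ 3 - (C.m : 𝓞 F) ∈ (und F w).asIdeal := by
          rw [mem_und, map_sub, map_pow, map_natCast, ← hβ3]
          have : algebraMap (𝓞 F) (𝓞 K) c ^ 3 - β ^ 3 = (algebraMap (𝓞 F) (𝓞 K) c ^ 2 + algebraMap (𝓞 F) (𝓞 K) c * β + β ^ 2) * (algebraMap (𝓞 F) (𝓞 K) c - β) := by ring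
          rw [this]
          exact Ideal.mul_mem_left _ _ hc
        let _ := Ideal.Quotient.field (und F w).asIdeal
        have e : (resid F (und F w) C.mU : 𝓞 F ⧸ (und F w).asIdeal) = Ideal.Quotient.mk _ c ^ 3 := by
          rw [resid_alg (und F w) C.mU (C.m : 𝓞 F) hm (by simp [CubicData.mU]), ← map_pow]
          exact (Ideal.Quotient.eq.2 hcm).symm
        have hc0 : Ideal.Quotient.mk (und F w).asIdeal c ≠ 0 := by
          intro h
          rw [h] at e
          exact (resid F (und F w) C.mU).ne_zero (by rw [e]; simp)
        have e' : resid F (und F w) C.mU = Units.mk0 _ hc0 ^ 3 := Units.ext e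
        rw [e']
        exact ⟨Units.mk0 _ hc0 ^ (- ordZ (und F w) b), by rw [← zpow_neg, ← zpow_natCast, ← zpow_natCast, ← zpow_mul, ← zpow_mul, mul_comm]⟩)
  refine ⟨Additive.ofMul y, ?_⟩
  apply CubicData.uext
  rw [C.nOp_coe]
  refine hy.trans ?_
  exact congrArg (fun u : Kˣ => (u : K)) hbK

theorem ker_six (C : CubicData F K) (x : Additive Kˣ) (h1 : dvH (𝓞 K) K x = 0) (h2 : x ∈ (nOp (unitH (C.σ : K ≃+* K))).range) :
    ∃ i : ℕ, ((x.toMul : Kˣ) : K) = algebraMap F K C.z ^ i ∨ ((x.toMul : Kˣ) : K) = - algebraMap F K C.z ^ i := by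
  apply C.six_of x.toMul _ h1
  obtain ⟨y, rfl⟩ := h2
  rw [C.nOp_coe]
  simp only [map_mul, C.σ3]
  ring

theorem ker_of_pow (x : Additive Kˣ) (h : ((x.toMul : Kˣ) : K) ^ 6 = 1) : dvH (𝓞 K) K x = 0 := by
  ext w
  show ordZ w x.toMul = 0
  have h1 : x.toMul ^ 6 = 1 := Units.ext (by simpa using h)
  have h2 := ordZ_pow w x.toMul 6
  rw [h1, ordZ_one] at h2
  push_cast at h2
  omega

theorem he6 (A : AD C) (h8 : ∀ i, A.q i % 9 = 8) :
    Nat.card ((dvH (𝓞 K) K).ker ⊓ (nOp (unitH (C.σ : K ≃+* K))).range : AddSubgroup (Additive Kˣ)) = 6 := by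
  have h3 := C.zK3
  have e : (dvH (𝓞 K) K).ker ⊓ (nOp (unitH (C.σ : K ≃+* K))).range = (rootsOfUnity 6 K).toAddSubgroup := by
    ext x
    have hx : x ∈ (rootsOfUnity 6 K).toAddSubgroup ↔ ((x.toMul : Kˣ) : K) ^ 6 = 1 :=
      mem_rootsOfUnity' 6 x.toMul
    rw [hx, AddSubgroup.mem_inf, AddMonoidHom.mem_ker]
    constructor
    · rintro ⟨h1, h2⟩
      obtain ⟨i, h | h⟩ := ker_six C x h1 h2 <;> rw [h]
      · rw [← pow_mul, show i * 6 = 3 * (2 * i) by ring, pow_mul, h3, one_pow]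
      · rw [Even.neg_pow (by decide), ← pow_mul, show i * 6 = 3 * (2 * i) by ring, pow_mul, h3, one_pow]
    · intro h
      refine ⟨ker_of_pow x h, ?_⟩
      obtain ⟨-, i, hi⟩ := C.fix6 _ h
      obtain ⟨y, hy⟩ := A.z_norm h8
      refine ⟨i • Additive.ofMul (-y), ?_⟩
      rw [map_nsmul]
      apply CubicData.uext
      rw [hi]
      show (((nOp (unitH (C.σ : K ≃+* K)) (Additive.ofMul (-y))).toMul ^ i : Kˣ) : K) = _
      rw [Units.val_pow_eq_pow_val, C.nOp_coe]
      congr 1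
      show (((-y : Kˣ) : K)) * C.σ ((-y : Kˣ) : K) * C.σ (C.σ ((-y : Kˣ) : K)) = _
      rw [map_neg, ← hy, Units.val_neg, map_neg, map_neg]
      ring
  rw [e]
  exact (prim6 _ C.zsumK).card_rootsOfUnity

theorem he2 (A : AD C) (h8 : ¬ ∀ i, A.q i % 9 = 8) :
    Nat.card ((dvH (𝓞 K) K).ker ⊓ (nOp (unitH (C.σ : K ≃+* K))).range : AddSubgroup (Additive Kˣ)) = 2 := by
  have h3 := C.zK3
  have hnn : ∀ y : Kˣ, (y : K) * C.σ y * C.σ (C.σ y) ≠ algebraMap F K C.z := by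
    intro y hy
    push Not at h8
    obtain ⟨i, hi⟩ := h8
    have hP : A.q i ∈ A.P := (A.mem_P _).2 (Or.inl ⟨i, rfl⟩)
    exact hi (C.not_norm _ (A.wP_ram ⟨_, hP⟩) (A.q i) (A.hp i) (A.h3 i) (A.wP_mem ⟨_, hP⟩) y hy)
  have hz : ∀ (i : ℕ) (y : Kˣ), (y : K) * C.σ y * C.σ (C.σ y) = algebraMap F K C.z ^ i → algebraMap F K C.z ^ i = 1 := by
    intro i y hy
    rw [← Nat.div_add_mod i 3, pow_add, pow_mul, h3, one_pow, one_mul] at hy ⊢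
    have : i % 3 < 3 := Nat.mod_lt _ (by norm_num)
    interval_cases i % 3
    · simp
    · exact absurd (by rw [hy, pow_one]) (hnn y)
    · refine absurd ?_ (hnn (y ^ 2))
      simp only [Units.val_pow_eq_pow_val, map_pow]
      rw [← mul_pow, ← mul_pow, hy]
      linear_combination algebraMap F K C.z * h3
  have e : (dvH (𝓞 K) K).ker ⊓ (nOp (unitH (C.σ : K ≃+* K))).range = (rootsOfUnity 2 K).toAddSubgroup := by
    ext x
    have hx : x ∈ (rootsOfUnity 2 K).toAddSubgroup ↔ ((x.toMul : Kˣ) : K) ^ 2 = 1 :=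
      mem_rootsOfUnity' 2 x.toMul
    rw [hx, AddSubgroup.mem_inf, AddMonoidHom.mem_ker]
    constructor
    · rintro ⟨h1, h2⟩
      obtain ⟨i, h⟩ := ker_six C x h1 h2
      obtain ⟨y, rfl⟩ := h2
      rw [C.nOp_coe] at h ⊢
      rcases h with h | h
      · rw [h, hz i _ h, one_pow]
      · have h' : ((-y.toMul : Kˣ) : K) * C.σ ((-y.toMul : Kˣ) : K) * C.σ (C.σ ((-y.toMul : Kˣ) : K)) = algebraMap F K C.z ^ i := by
          rw [Units.val_neg, map_neg, map_neg]
          linear_combination - h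
        rw [h, hz i _ h']; norm_num
    · intro h
      have h6 : ((x.toMul : Kˣ) : K) ^ 6 = 1 := by rw [show 6 = 2 * 3 by norm_num, pow_mul, h, one_pow]
      refine ⟨ker_of_pow x h6, x, ?_⟩
      apply CubicData.uext
      rw [C.nOp_coe, (C.fix6 _ h6).1, (C.fix6 _ h6).1]
      linear_combination ((x.toMul : Kˣ) : K) * h
  rw [e]
  exact (IsPrimitiveRoot.neg_one 0 (by norm_num) : IsPrimitiveRoot (-1 : K) 2).card_rootsOfUnity

open Classical in
theorem final (A : AD C) (h6 : Module.finrank ℚ K = 6) : ∃ n : ℕ,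
    Nat.card {c : ClassGroup (𝓞 K) // c ^ 3 = 1} = n ^ 2 ∧
    n * 18 = 3 ^ (A.J + if C.m % 9 = 1 ∨ C.m % 9 = 8 then 0 else 1) * (if ∀ i, A.q i % 9 = 8 then 6 else 2) := by
  refine ⟨(dvH (𝓞 K) K).range.relIndex ((dvH (𝓞 K) K).range.comap (dOp (permH C.s))), ?_, ?_⟩
  · rw [card_cl3 (𝓞 K) K]
    exact square_thm (unitH (C.σ : K ≃+* K)) (unitH C.τ) (permH C.s) (permH C.t) (dvH (𝓞 K) K)
      C.us3 C.ps3 C.T2 C.hts C.hTS (fun x => dvH_gal _ x) (fun x => dvH_gal _ x) C.h90L (h90_perm C.s C.s3) (hN C)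
      (A.hfix C.hTS) C.hEsq A.key
  · have := count_thm (unitH (C.σ : K ≃+* K)) (permH C.s) (dvH (𝓞 K) K) C.us3 C.ps3 (fun x => dvH_gal _ x)
      C.h90L (h90_perm C.s C.s3) _ (if ∀ i, A.q i % 9 = 8 then 6 else 2) A.hT (C.hE h6) (by
        split_ifs with h
        · exact A.he6 h
        · exact A.he2 h)
    rw [A.P_card] at this
    exact this
end AD
end

section
open IsDedekindDomain NumberField
set_option linter.unusedSectionVars false

namespace Setup
open Polynomial IntermediateField

theorem lift_aux {L K : Type*} [Field L] [Field K] [Algebra L K] [FiniteDimensional L K] (x y : K)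
    (hx : L⟮x⟯ = ⊤) (p : L[X]) (hp : p.Monic) (hd : p.natDegree = Module.finrank L K)
    (h1 : aeval x p = 0) (h2 : aeval y p = 0) : ∃ σ : K ≃ₐ[L] K, σ x = y := by
  have hi : IsIntegral L x := ⟨p, hp, by simpa [aeval_def] using h1⟩
  have hm : minpoly L x = p := by
    have hdv := minpoly.dvd L x h1
    symm
    refine eq_of_monic_of_dvd_of_natDegree_le (minpoly.monic hi) hp hdv ?_
    rw [hd, ← IntermediateField.adjoin.finrank hi, hx, IntermediateField.finrank_top']
  have hy : y ∈ (minpoly L x).aroots K := by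
    rw [mem_aroots, hm]; exact ⟨hp.ne_zero, h2⟩
  let f := (algHomAdjoinIntegralEquiv L hi).symm ⟨y, hy⟩
  have hf : f (AdjoinSimple.gen L x) = y := algHomAdjoinIntegralEquiv_symm_apply_gen L hi ⟨y, hy⟩
  let e : K ≃ₐ[L] L⟮x⟯ := topEquiv.symm.trans (equivOfEq hx.symm)
  have he : e x = AdjoinSimple.gen L x := by
    apply Subtype.ext; rfl
  let g : K →ₐ[L] K := f.comp (e : K →ₐ[L] L⟮x⟯)
  refine ⟨AlgEquiv.ofBijective g (Algebra.IsAlgebraic.algHom_bijective g), ?_⟩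
  show f (e x) = y
  rw [he, hf]

theorem not_cube (J : ℕ) (hJ : 1 ≤ J) (q : Fin J → ℕ)
    (hp : ∀ i, (q i).Prime) (hinj : Function.Injective q) (h3 : ∀ i, q i % 3 = 2)
    (t : Fin J → ℕ) (ht : ∀ i, t i = 1 ∨ t i = 2) (s : ℕ) (x : ℚ)
    (h : x ^ 3 = ((3 ^ s * ∏ i, q i ^ t i : ℕ) : ℚ)) : False := by
  classical
  let i₀ : Fin J := ⟨0, hJ⟩
  have := Fact.mk (hp i₀)
  rw [← Finset.mul_prod_erase _ _ (Finset.mem_univ i₀), mul_left_comm] at h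
  set c := 3 ^ s * ∏ i ∈ Finset.univ.erase i₀, q i ^ t i with hc
  have hnd : ¬ q i₀ ∣ c := by
    rw [hc, (hp i₀).dvd_mul, not_or]
    constructor
    · intro hd
      have := (Nat.prime_dvd_prime_iff_eq (hp i₀) Nat.prime_three).1 ((hp i₀).dvd_of_dvd_pow hd)
      have := h3 i₀
      omega
    · intro hd
      obtain ⟨j, hj, hd⟩ := (Prime.dvd_finsetProd_iff (hp i₀).prime _).1 hd
      have := (Nat.prime_dvd_prime_iff_eq (hp i₀) (hp j)).1 ((hp i₀).dvd_of_dvd_pow hd)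
      exact (Finset.mem_erase.1 hj).1 (hinj this.symm)
  have hc0 : c ≠ 0 := by rintro h; rw [h] at hnd; simp at hnd
  have hq0 := (hp i₀).ne_zero
  have hx : x ≠ 0 := by
    rintro rfl
    have : ((q i₀ ^ t i₀ * c : ℕ) : ℚ) ≠ 0 := by
      rw [Nat.cast_ne_zero]; positivity
    exact this (by rw [← h]; simp)
  have hv := congrArg (padicValRat (q i₀)) h
  rw [padicValRat.pow, padicValRat.of_nat, padicValNat.mul (pow_ne_zero _ hq0) hc0,
    padicValNat.prime_pow, padicValNat.eq_zero_of_not_dvd hnd] at hv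
  have := ht i₀
  push_cast at hv
  omega

theorem rep_aux {F K : Type*} [Field F] [NumberField F] [Field K] [NumberField K] [Algebra F K]
    (z : F) (α : K) (m : ℕ) (hα : α ^ 3 = m)
    (hgen : Algebra.adjoin ℚ ({algebraMap F K z, α} : Set K) = ⊤) (x : K) :
    ∃ a b c : F, x = algebraMap F K a + algebraMap F K b * α + algebraMap F K c * α ^ 2 := by
  have hx : x ∈ Algebra.adjoin ℚ ({algebraMap F K z, α} : Set K) := by rw [hgen]; trivial
  induction hx using Algebra.adjoin_induction with
  | mem x hx =>
    rcases hx with rfl | rfl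
    · exact ⟨z, 0, 0, by simp⟩
    · exact ⟨0, 1, 0, by simp⟩
  | algebraMap r => exact ⟨(r : F), 0, 0, by simp⟩
  | add x y _ _ hx hy =>
    obtain ⟨a, b, c, rfl⟩ := hx
    obtain ⟨a', b', c', rfl⟩ := hy
    exact ⟨a + a', b + b', c + c', by simp only [map_add]; ring⟩
  | mul x y _ _ hx hy =>
    obtain ⟨a, b, c, rfl⟩ := hx
    obtain ⟨a', b', c', rfl⟩ := hy
    refine ⟨a * a' + m * (b * c' + c * b'), a * b' + b * a' + m * (c * c'), a * c' + b * b' + c * a', ?_⟩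
    simp only [map_add, map_mul, map_natCast, ← hα]; ring

theorem adj_top {K : Type*} [Field K] [NumberField K] (x y : K)
    (hgen : Algebra.adjoin ℚ ({x, y} : Set K) = ⊤) : (ℚ⟮x⟯)⟮y⟯ = ⊤ := by
  have h1 : ℚ⟮x, y⟯ = ⊤ := by
    rw [eq_top_iff]
    intro w _
    have hw : w ∈ Algebra.adjoin ℚ ({x, y} : Set K) := by rw [hgen]; trivial
    exact algebra_adjoin_le_adjoin ℚ _ hw
  rw [← adjoin_simple_adjoin_simple] at h1
  exact (restrictScalars_eq_top_iff (K := ℚ)).1 h1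

theorem main (J : ℕ) (hJ : 1 ≤ J) (q : Fin J → ℕ)
    (hp : ∀ i, (q i).Prime) (hinj : Function.Injective q) (h3 : ∀ i, q i % 3 = 2)
    (t : Fin J → ℕ) (ht : ∀ i, t i = 1 ∨ t i = 2) (s : ℕ) (hs : s ≤ 2)
    (m : ℕ) (hm : m = 3 ^ s * ∏ i, q i ^ t i)
    (K : Type) [Field K] [NumberField K] (ζ α : K)
    (hζ : IsPrimitiveRoot ζ 3) (hα : α ^ 3 = (m : K))
    (hgen : Algebra.adjoin ℚ ({ζ, α} : Set K) = ⊤) : ∃ n : ℕ,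
    Nat.card {c : ClassGroup (𝓞 K) // c ^ 3 = 1} = n ^ 2 ∧
    ((∀ i, q i % 9 = 8) → n * 18 = 3 ^ (J + if m % 9 = 1 ∨ m % 9 = 8 then 0 else 1) * 6) ∧
    (¬ (∀ i, q i % 9 = 8) → n * 18 = 3 ^ (J + if m % 9 = 1 ∨ m % 9 = 8 then 0 else 1) * 2) := by
  have hcyc : IsCyclotomicExtension {3} ℚ ℚ⟮ζ⟯ :=
    hζ.intermediateField_adjoin_isCyclotomicExtension ℚ
  have hpid : IsPrincipalIdealRing (𝓞 ℚ⟮ζ⟯) := IsCyclotomicExtension.Rat.three_pid _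
  have hm0 : m ≠ 0 := by
    rw [hm]
    exact mul_ne_zero (by positivity)
      (Finset.prod_ne_zero_iff.2 fun i _ => pow_ne_zero _ (hp i).ne_zero)
  have hα0 : α ≠ 0 := by
    rintro rfl
    have : (m : K) = 0 := by rw [← hα]; simp
    exact hm0 (by exact_mod_cast this)
  let z : ℚ⟮ζ⟯ := AdjoinSimple.gen ℚ ζ
  have hzζ : algebraMap ℚ⟮ζ⟯ K z = ζ := rfl
  have hz : IsPrimitiveRoot z 3 := by
    rw [← hzζ] at hζ
    exact hζ.of_map_of_injective (algebraMap ℚ⟮ζ⟯ K).injective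
  have hrep := rep_aux z α m hα hgen
  have hFK := adj_top ζ α hgen
  have hLK := adj_top α ζ (by rwa [Set.pair_comm])
  have hd2 : Module.finrank ℚ ℚ⟮ζ⟯ = 2 := by
    rw [IsCyclotomicExtension.Rat.finrank 3]; rfl
  have hirr : Irreducible (X ^ 3 - C (m : ℚ)) :=
    X_pow_sub_C_irreducible_of_prime Nat.prime_three fun x hx =>
      not_cube J hJ q hp hinj h3 t ht s x (by rw [hx, ← hm])
  have hαi : IsIntegral ℚ α := Algebra.IsIntegral.isIntegral α
  have hd3 : Module.finrank ℚ ℚ⟮α⟯ = 3 := by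
    rw [adjoin.finrank hαi, ← minpoly.eq_of_irreducible_of_monic hirr (by simp [hα])
      (monic_X_pow_sub_C _ (by norm_num)), natDegree_X_pow_sub_C]
  have hm1 := Module.finrank_mul_finrank ℚ ℚ⟮ζ⟯ K
  have hm2 := Module.finrank_mul_finrank ℚ ℚ⟮α⟯ K
  have haFi : IsIntegral ℚ⟮ζ⟯ α := Algebra.IsIntegral.isIntegral α
  have hle : Module.finrank ℚ⟮ζ⟯ K ≤ 3 := by
    rw [← IntermediateField.finrank_top' (F := ℚ⟮ζ⟯) (E := K), ← hFK, adjoin.finrank haFi]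
    have hdv := minpoly.dvd ℚ⟮ζ⟯ α (p := X ^ 3 - C (m : ℚ⟮ζ⟯)) (by simp [hα])
    have := natDegree_le_of_dvd hdv (monic_X_pow_sub_C _ (by norm_num)).ne_zero
    rwa [natDegree_X_pow_sub_C] at this
  rw [hd2] at hm1
  rw [hd3] at hm2
  have hpos : 0 < Module.finrank ℚ K := Module.finrank_pos
  have h6 : Module.finrank ℚ K = 6 := by omega
  obtain ⟨σ, hσ⟩ := lift_aux (L := ℚ⟮ζ⟯) α (ζ * α) hFK (X ^ 3 - C (m : ℚ⟮ζ⟯))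
    (monic_X_pow_sub_C _ (by norm_num)) (by rw [natDegree_X_pow_sub_C]; omega) (by simp [hα])
    (by simp [mul_pow, hα, hζ.pow_eq_one])
  have hζ0 : ζ ^ 2 + ζ + 1 = 0 := by
    have h1 := hζ.geom_sum_eq_zero (by norm_num)
    simp only [Finset.sum_range_succ, Finset.sum_range_zero, pow_zero, pow_one] at h1
    linear_combination h1
  have hc3 : (X ^ 2 + X + 1 : ℚ⟮α⟯[X]) = X ^ 2 + X + 1 := rfl
  have hcd : (X ^ 2 + X + 1 : ℚ⟮α⟯[X]).natDegree = 2 := by compute_degree!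
  obtain ⟨τ, hτ⟩ := lift_aux (L := ℚ⟮α⟯) ζ (ζ ^ 2) hLK (X ^ 2 + X + 1)
    (by monicity!) (by rw [hcd]; omega) (by simpa using hζ0)
    (by
      have h1 := hζ.pow_eq_one
      simp only [map_add, map_pow, aeval_X, map_one]
      linear_combination hζ0 + ζ * h1)
  let D : CubicData ℚ⟮ζ⟯ K :=
    { z := z, hz := hz, m := m, α := α, hα := hα, hα0 := hα0, rep := hrep, σ := σ, hσ := hσ,
      τ := (τ : K ≃+* K), hτz := hτ,
      hτα := τ.commutes (AdjoinSimple.gen ℚ α) }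
  let A : AD D :=
    { J := J, q := q, hp := hp, hinj := hinj, h3 := h3, t := t, ht := ht, s := s, hs := hs,
      hm := hm }
  obtain ⟨n, h1, h2⟩ := A.final h6
  refine ⟨n, h1, fun h => ?_, fun h => ?_⟩
  · rw [if_pos (show ∀ i, A.q i % 9 = 8 from h)] at h2
    convert h2 using 3
  · rw [if_neg (show ¬ ∀ i, A.q i % 9 = 8 from h)] at h2
    convert h2 using 3

end Setup
end

theorem stmt_16 (J : ℕ) (hJ : 1 ≤ J) (q : Fin J → ℕ)
    (hq_prime : ∀ i, (q i).Prime) (hq_distinct : Function.Injective q)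
    (hq_mod3 : ∀ i, q i % 3 = 2)
    (t : Fin J → ℕ) (ht : ∀ i, t i = 1 ∨ t i = 2)
    (s : ℕ) (hs : s ≤ 2)
    (m : ℕ) (hm : m = 3 ^ s * ∏ i, q i ^ t i)
    (K : Type) [Field K] [NumberField K] (ζ α : K)
    (hζ : IsPrimitiveRoot ζ 3) (hα : α ^ 3 = (m : K))
    (hgen : Algebra.adjoin ℚ ({ζ, α} : Set K) = ⊤)
    (r : ℕ)
    (hr₁ : (∀ i, q i % 9 = 8) → ¬(m % 9 = 1 ∨ m % 9 = 8) → r = J)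
    (hr₂ : (∀ i, q i % 9 = 8) → (m % 9 = 1 ∨ m % 9 = 8) → r = J - 1)
    (hr₃ : (∃ i, q i % 9 = 2 ∨ q i % 9 = 5) → ¬(m % 9 = 1 ∨ m % 9 = 8) → r = J - 1)
    (hr₄ : (∃ i, q i % 9 = 2 ∨ q i % 9 = 5) → (m % 9 = 1 ∨ m % 9 = 8) → r = J - 2) :
    Nat.card {c : ClassGroup (RingOfIntegers K) // c ^ 3 = 1} = 3 ^ (2 * r) := by
  obtain ⟨n, h1, h2, h3⟩ := Setup.main J hJ q hq_prime hq_distinct hq_mod3 t ht s hs m hm K ζ α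
    hζ hα hgen
  have key : n = 3 ^ r := by
    obtain ⟨j, rfl⟩ := Nat.exists_eq_add_of_le' hJ
    by_cases ha : ∀ i, q i % 9 = 8
    · have h := h2 ha
      by_cases hb : m % 9 = 1 ∨ m % 9 = 8
      · rw [hr₂ ha hb]
        rw [if_pos hb, add_zero, pow_succ] at h
        rw [Nat.add_sub_cancel]; omega
      · rw [hr₁ ha hb]
        rw [if_neg hb, pow_succ] at h
        omega
    · have h := h3 ha
      have ha' : ∃ i, q i % 9 = 2 ∨ q i % 9 = 5 := by
        by_contra hc
        push Not at hc
        exact ha fun i => by have := hc i; have := hq_mod3 i; omega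
      by_cases hb : m % 9 = 1 ∨ m % 9 = 8
      · rw [hr₄ ha' hb]
        rw [if_pos hb, add_zero] at h
        rcases j with _ | k
        · simp at h; omega
        · rw [pow_succ, pow_succ] at h
          rw [show k + 1 + 1 - 2 = k by omega]; omega
      · rw [hr₃ ha' hb]
        rw [if_neg hb, pow_succ, pow_succ] at h
        rw [Nat.add_sub_cancel]; omega
  rw [h1, key, ← pow_mul, mul_comm]
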